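/- Let H ⊆ ℝ² be a subset whose subspace topology is Polish, and let p < q be rational numbers. Let π(ℳ_{p,q}) denote the set of all x ∈ H₀ such that x lies in the same path component of H as the endpoint e₁(J) of some J ∈ 𝒥_{p,q}. Then π(ℳ_{p,q}) is a ≈_H-invariant Borel subset of H, and the restriction of the path-connectedness relation ≈_H to π(ℳ_{p,q}) is essentially hyperfinite. -/

import Mathlib

/-- `E` is a Borel equivalence relation on the measurable space `X`. -/
def IsBorelEquivRel {X : Type} [MeasurableSpace X] (E : X → X → Prop) : Prop :=
  Equivalence E ∧ MeasurableSet {p : X × X | E p.1 p.2}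

/-- A finite Borel equivalence relation: every class is finite. -/
def IsFiniteBorelEquivRel {X : Type} [MeasurableSpace X] (E : X → X → Prop) : Prop :=
  IsBorelEquivRel E ∧ ∀ x, {y | E x y}.Finite

/-- `E` is hyperfinite: an increasing union of finite Borel equivalence relations. -/
def IsHyperfinite {X : Type} [MeasurableSpace X] (E : X → X → Prop) : Prop :=
  ∃ F : ℕ → X → X → Prop,
    (∀ n, IsFiniteBorelEquivRel (F n)) ∧
    (∀ n x y, F n x y → F (n + 1) x y) ∧
    (∀ x y, E x y ↔ ∃ n, F n x y)

/-- Borel reducibility of `E` to `F`. -/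
def IsBorelReducible {X Y : Type} [MeasurableSpace X] [MeasurableSpace Y]
    (E : X → X → Prop) (F : Y → Y → Prop) : Prop :=
  ∃ f : X → Y, Measurable f ∧ ∀ x y, E x y ↔ F (f x) (f y)

/-- `E` is essentially hyperfinite: Borel reducible to a hyperfinite Borel
equivalence relation on some standard Borel space. -/
def IsEssentiallyHyperfinite {X : Type} [MeasurableSpace X] (E : X → X → Prop) : Prop :=
  ∃ (Y : Type) (mY : MeasurableSpace Y), @StandardBorelSpace Y mY ∧
    ∃ F : Y → Y → Prop, @IsBorelEquivRel Y mY F ∧ @IsHyperfinite Y mY F ∧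
      @IsBorelReducible X Y _ mY E F

/-- `J` is an arc in the plane with endpoints `u` and `v`: the image of a continuous
injective map from the unit interval sending `0` to `u` and `1` to `v`. -/
def IsArcWith (J : Set (ℝ × ℝ)) (u v : ℝ × ℝ) : Prop :=
  ∃ f : unitInterval → ℝ × ℝ, Continuous f ∧ Function.Injective f ∧
    Set.range f = J ∧ f 0 = u ∧ f 1 = v

/-- `J` is an arc in the plane. -/
def IsArc (J : Set (ℝ × ℝ)) : Prop := ∃ u v, IsArcWith J u v

/-! ### Crossing paths in a disc -/

theorem log_branch_sub {c : ℂ} {L w : ℝ → ℂ} (hL : Continuous L) (hw : Continuous w)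
    (hpos : ∀ t, 0 < (w t).re) (h : ∀ t, Complex.exp (L t) = c * w t) (s t : ℝ) :
    L s - L t = Complex.log (w s) - Complex.log (w t) := by
  have hw0 : ∀ t, w t ≠ 0 := fun t ht => by simpa [ht] using hpos t
  have hlog : Continuous fun t => L t - Complex.log (w t) :=
    hL.sub (hw.clog fun t => Or.inl (hpos t))
  have := Complex.isCoveringMap_exp.const_of_comp hlog (fun a a' => by
    apply Subtype.ext
    simp [Complex.exp_sub, h, Complex.exp_log (hw0 _), hw0]) s t
  linear_combination this

theorem one_sub_exp_mul_I (α : ℝ) : 1 - Complex.exp (α * Complex.I) =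
    ((2 * Real.sin (α / 2) : ℝ) : ℂ) *
      (Complex.cos ((α / 2 - Real.pi / 2 : ℝ)) + Complex.sin ((α / 2 - Real.pi / 2 : ℝ)) *
        Complex.I) := by
  have h1 : Complex.cos ((α / 2 - Real.pi / 2 : ℝ)) = Complex.sin (α / 2) := by
    push_cast; rw [Complex.cos_sub_pi_div_two]
  have h2 : Complex.sin ((α / 2 - Real.pi / 2 : ℝ)) = - Complex.cos (α / 2) := by
    push_cast; rw [Complex.sin_sub_pi_div_two]
  rw [h1, h2, Complex.exp_mul_I]
  have e : (α : ℂ) = 2 * (α / 2) := by ring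
  rw [e, Complex.cos_two_mul, Complex.sin_two_mul]
  have e' : (2 * ((α : ℂ) / 2)) / 2 = α / 2 := by ring
  push_cast
  rw [e']
  linear_combination (-2) * Complex.sin_sq_add_cos_sq (α / 2 : ℂ)

theorem arg_one_sub_exp_mul_I {α : ℝ} (h0 : 0 < α) (h1 : α < 2 * Real.pi) :
    Complex.arg (1 - Complex.exp (α * Complex.I)) = α / 2 - Real.pi / 2 := by
  rw [one_sub_exp_mul_I, Complex.arg_mul_cos_add_sin_mul_I]
  · exact mul_pos two_pos (Real.sin_pos_of_pos_of_lt_pi (by linarith) (by linarith))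
  · constructor <;> linarith [Real.pi_pos]

theorem arg_one_sub_exp_mul_I' {α : ℝ} (h0 : -(2 * Real.pi) < α) (h1 : α < 0) :
    Complex.arg (1 - Complex.exp (α * Complex.I)) = α / 2 + Real.pi / 2 := by
  have := arg_one_sub_exp_mul_I (α := α + 2 * Real.pi) (by linarith) (by linarith)
  rw [show ((α + 2 * Real.pi : ℝ) : ℂ) * Complex.I = α * Complex.I + 2 * Real.pi * Complex.I by
    push_cast; ring, Complex.exp_add, Complex.exp_two_pi_mul_I, mul_one] at this
  rw [this]; ring

theorem log_branch_sub_im {θ α β : ℝ} {c : ℂ} {L h : ℝ → ℂ} (hL : Continuous L)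
    (hh : Continuous h)
    (hn : ∀ t, ‖h t‖ ≤ 1) (hne : ∀ t, h t ≠ Complex.exp (θ * Complex.I))
    (hexp : ∀ t, Complex.exp (L t) = c * (Complex.exp (θ * Complex.I) - h t))
    (h0 : h 0 = Complex.exp (α * Complex.I)) (h1 : h 1 = Complex.exp (β * Complex.I)) :
    (L 1 - L 0).im = Complex.arg (1 - Complex.exp ((β - θ : ℝ) * Complex.I)) -
      Complex.arg (1 - Complex.exp ((α - θ : ℝ) * Complex.I)) := by
  set e := Complex.exp (θ * Complex.I) with he
  have he0 : e ≠ 0 := Complex.exp_ne_zero _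
  have hen : ‖e‖ = 1 := Complex.norm_exp_ofReal_mul_I θ
  have key := log_branch_sub (c := c * e) hL (w := fun t => 1 - e⁻¹ * h t)
    (by fun_prop) (fun t => by
      have hz : ‖e⁻¹ * h t‖ ≤ 1 := by simpa [hen] using hn t
      have hz1 : e⁻¹ * h t ≠ 1 := fun h' => hne t (by
        rw [← mul_right_inj' (inv_ne_zero he0), h', inv_mul_cancel₀ he0])
      set z := e⁻¹ * h t
      rw [Complex.sub_re, Complex.one_re, sub_pos]
      refine lt_of_le_of_ne ((Complex.re_le_norm z).trans hz) fun hre => hz1 ?_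
      have : z.re * z.re + z.im * z.im ≤ 1 := by
        rw [← Complex.normSq_apply, Complex.normSq_eq_norm_sq]; nlinarith [norm_nonneg z]
      apply Complex.ext
      · exact hre
      · rw [hre] at this; simp only [Complex.one_im]; nlinarith) (fun t => by
      rw [hexp, mul_assoc, mul_sub e, mul_one, mul_inv_cancel_left₀ he0]) 1 0
  rw [key, Complex.sub_im, Complex.log_im, Complex.log_im]
  simp only [h0, h1, he, ← Complex.exp_neg, ← Complex.exp_add]
  congr 4 <;> push_cast <;> ring

theorem exists_eq_of_paths_in_disc {f g : ℝ → ℂ} (hf : Continuous f) (hg : Continuous g)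
    (hfn : ∀ t, ‖f t‖ ≤ 1) (hgn : ∀ t, ‖g t‖ ≤ 1) {a b c d : ℝ} (hab : a < b) (hbc : b < c)
    (hcd : c < d) (hda : d < a + 2 * Real.pi)
    (hf0 : f 0 = Complex.exp (a * Complex.I)) (hg0 : g 0 = Complex.exp (b * Complex.I))
    (hf1 : f 1 = Complex.exp (c * Complex.I)) (hg1 : g 1 = Complex.exp (d * Complex.I)) :
    ∃ s t, f s = g t := by
  by_contra! hne
  let F : C(ℝ × ℝ, ℂ) := ⟨fun x => f x.1 - g x.2, by fun_prop⟩
  have hF : ∀ x, F x ≠ 0 := fun x => sub_ne_zero.2 (hne _ _)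
  obtain ⟨L, ⟨-, hL⟩, -⟩ := Complex.isCoveringMapOn_exp.existsUnique_continuousMap_lifts
    F (a₀ := (0, 0)) (Complex.exp_log (hF _)) (fun x => hF x)
  have hexp : ∀ s t, Complex.exp (L (s, t)) = f s - g t := fun s t => congrFun hL (s, t)
  have hLc : Continuous L := L.continuous
  have s0 := log_branch_sub_im (θ := a) (α := b) (β := d)
    (c := 1) (L := fun t => L (0, t)) (h := g) (by fun_prop) hg hgn
    (fun t => by rw [← hf0]; exact (hne _ _).symm) (fun t => by rw [hexp, hf0, one_mul]) hg0 hg1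
  have s1 := log_branch_sub_im (θ := c) (α := b) (β := d)
    (c := 1) (L := fun t => L (1, t)) (h := g) (by fun_prop) hg hgn
    (fun t => by rw [← hf1]; exact (hne _ _).symm) (fun t => by rw [hexp, hf1, one_mul]) hg0 hg1
  have t0 := log_branch_sub_im (θ := b) (α := a) (β := c) (c := -1)
    (L := fun t => L (t, 0)) (h := f) (by fun_prop) hf hfn
    (fun t => by rw [← hg0]; exact (hne _ _)) (fun t => by rw [hexp, hg0]; ring) hf0 hf1
  have t1 := log_branch_sub_im (θ := d) (α := a) (β := c) (c := -1)
    (L := fun t => L (t, 1)) (h := f) (by fun_prop) hf hfn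
    (fun t => by rw [← hg1]; exact (hne _ _)) (fun t => by rw [hexp, hg1]; ring) hf0 hf1
  rw [arg_one_sub_exp_mul_I (by linarith) (by linarith),
    arg_one_sub_exp_mul_I (by linarith) (by linarith)] at s0
  rw [arg_one_sub_exp_mul_I (by linarith) (by linarith),
    arg_one_sub_exp_mul_I' (by linarith) (by linarith)] at s1
  rw [arg_one_sub_exp_mul_I (by linarith) (by linarith),
    arg_one_sub_exp_mul_I' (by linarith) (by linarith)] at t0
  rw [arg_one_sub_exp_mul_I' (by linarith) (by linarith),
    arg_one_sub_exp_mul_I' (by linarith) (by linarith)] at t1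
  simp only [Complex.sub_im] at s0 s1 t0 t1
  linarith [Real.pi_pos]

/-! ### Triods -/

/-- The squared Euclidean distance in the plane. -/
def sqDist (z x : ℝ × ℝ) : ℝ := (x.1 - z.1) ^ 2 + (x.2 - z.2) ^ 2

/-- The point at angle `θ` on the circle with centre `z` and radius `r`. -/
noncomputable def circlePoint (z : ℝ × ℝ) (r θ : ℝ) : ℝ × ℝ :=
  (z.1 + r * Real.cos θ, z.2 + r * Real.sin θ)

theorem continuous_sqDist : Continuous fun w : (ℝ × ℝ) × (ℝ × ℝ) => sqDist w.1 w.2 := by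
  unfold sqDist; fun_prop

theorem JoinedIn.inter_nonempty_of_interleaved {A B : Set (ℝ × ℝ)} {z : ℝ × ℝ} {r : ℝ}
    (hr : 0 < r) (hA : ∀ x ∈ A, sqDist z x ≤ r ^ 2) (hB : ∀ x ∈ B, sqDist z x ≤ r ^ 2)
    {a b c d : ℝ} (hab : a < b) (hbc : b < c) (hcd : c < d) (hda : d < a + 2 * Real.pi)
    (h₁ : JoinedIn A (circlePoint z r a) (circlePoint z r c))
    (h₂ : JoinedIn B (circlePoint z r b) (circlePoint z r d)) : (A ∩ B).Nonempty := by
  obtain ⟨γ, hγ⟩ := h₁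
  obtain ⟨δ, hδ⟩ := h₂
  let T : ℝ × ℝ → ℂ := fun x => ((x.1 - z.1 : ℝ) : ℂ) / r + ((x.2 - z.2 : ℝ) : ℂ) / r * Complex.I
  have hT : Continuous T := by fun_prop
  have hr0 : (r : ℂ) ≠ 0 := by exact_mod_cast hr.ne'
  have hTn : ∀ x, sqDist z x ≤ r ^ 2 → ‖T x‖ ≤ 1 := by
    intro x hx
    have h1 : T x = (((x.1 - z.1) / r : ℝ) : ℂ) + (((x.2 - z.2) / r : ℝ) : ℂ) * Complex.I := by
      simp only [T]; push_cast; ring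
    rw [h1, Complex.norm_add_mul_I]
    rw [Real.sqrt_le_left zero_le_one, one_pow, div_pow, div_pow, ← add_div, div_le_one (by positivity)]
    exact hx
  have hTc : ∀ θ, T (circlePoint z r θ) = Complex.exp (θ * Complex.I) := by
    intro θ
    simp only [T, circlePoint, Complex.exp_mul_I]
    push_cast
    field_simp
    ring
  have hTi : ∀ x y, T x = T y → x = y := by
    intro x y h
    have hre := congrArg Complex.re h
    have him := congrArg Complex.im h
    simp only [T, Complex.add_re, Complex.add_im, Complex.mul_re, Complex.mul_im, ← Complex.ofReal_div,
      Complex.ofReal_re, Complex.ofReal_im, Complex.I_re, Complex.I_im] at hre him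
    ring_nf at hre him
    ext
    · have := hr.ne'; field_simp at hre; linarith
    · have := hr.ne'; field_simp at him; linarith
  have hγe : ∀ t, γ.extend t ∈ A := fun t => hγ _
  have hδe : ∀ t, δ.extend t ∈ B := fun t => hδ _
  obtain ⟨s, t, hst⟩ := exists_eq_of_paths_in_disc (f := fun t => T (γ.extend t))
    (g := fun t => T (δ.extend t)) (hT.comp γ.continuous_extend) (hT.comp δ.continuous_extend)
    (fun t => hTn _ (hA _ (hγe t))) (fun t => hTn _ (hB _ (hδe t))) hab hbc hcd hda
    (by simp [hTc]) (by simp [hTc]) (by simp [hTc]) (by simp [hTc])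
  exact ⟨_, hγe s, hTi _ _ hst ▸ hδe t⟩

theorem exists_circlePoint_eq {z x : ℝ × ℝ} {r : ℝ} (hr : 0 < r) (h : sqDist z x = r ^ 2) :
    ∃ θ ∈ Set.Ioc (-Real.pi) Real.pi, x = circlePoint z r θ := by
  set w : ℂ := ⟨x.1 - z.1, x.2 - z.2⟩ with hw
  have hn : ‖w‖ = r := by
    have : ‖w‖ ^ 2 = r ^ 2 := by
      rw [← Complex.normSq_eq_norm_sq, Complex.normSq_apply, ← h, sqDist]; ring
    exact (pow_left_inj₀ (norm_nonneg _) hr.le two_ne_zero).1 this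
  refine ⟨w.arg, w.arg_mem_Ioc, ?_⟩
  have := Complex.norm_mul_cos_arg w
  have h2 := Complex.norm_mul_sin_arg w
  rw [hn] at this h2
  rw [circlePoint, this, h2]
  ext <;> simp [hw]

theorem joinedIn_of_mem_uIcc {X : Type*} [TopologicalSpace X] {f : unitInterval → X}
    (hf : Continuous f) {S : Set X} {s t : unitInterval} (h : ∀ u ∈ Set.uIcc s t, f u ∈ S) :
    JoinedIn S (f s) (f t) := by
  have h1 : JoinedIn (Set.uIcc s t) s t := by
    have h2 : JoinedIn (Set.uIcc (s : ℝ) t) (s : ℝ) t :=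
      (convex_uIcc (s : ℝ) (t : ℝ)).isPathConnected ⟨_, Set.left_mem_uIcc⟩ |>.joinedIn _
        Set.left_mem_uIcc _ Set.right_mem_uIcc
    have h3 := h2.map_continuousOn (f := Set.projIcc (0 : ℝ) 1 zero_le_one)
      continuous_projIcc.continuousOn
    rw [Set.projIcc_val, Set.projIcc_val] at h3
    refine h3.mono ?_
    rintro _ ⟨u, hu, rfl⟩
    have hI : u ∈ Set.Icc (0 : ℝ) 1 :=
      Set.uIcc_subset_Icc s.2 t.2 hu
    rw [Set.projIcc_of_mem _ hI]
    rcases le_total s t with hst | hst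
    · rw [Set.uIcc_of_le hst]; rw [Set.uIcc_of_le (by exact_mod_cast hst)] at hu; exact hu
    · rw [Set.uIcc_of_ge hst]; rw [Set.uIcc_of_ge (by exact_mod_cast hst)] at hu; exact hu
  exact (h1.map_continuousOn hf.continuousOn).mono (by rintro _ ⟨u, hu, rfl⟩; exact h u hu)

theorem exists_first_mem_closed {X : Type*} [TopologicalSpace X] {f : unitInterval → X}
    (hf : Continuous f) {C : Set X} (hC : IsClosed C) (h : ∃ t, f t ∈ C) :
    ∃ t, f t ∈ C ∧ ∀ s < t, f s ∉ C := by
  obtain ⟨t, ht, hl⟩ := (hC.preimage hf).isCompact.exists_isLeast h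
  exact ⟨t, ht, fun s hs hs' => (hl hs').not_gt hs⟩

/-- Three arcs `γ i` in `S` issuing from `c` and pairwise disjoint otherwise. -/
structure IsTriod {X : Type*} [TopologicalSpace X] (S : Set X) (c : X)
    (γ : Fin 3 → unitInterval → X) : Prop where
  continuous : ∀ i, Continuous (γ i)
  injective : ∀ i, Function.Injective (γ i)
  mem : ∀ i t, γ i t ∈ S
  zero : ∀ i, γ i 0 = c
  disjoint : ∀ i j s t, i ≠ j → γ i s = γ j t → s = 0 ∧ t = 0

/-- Path classes of `S` containing a triod. -/
def triodicClasses {X : Type*} [TopologicalSpace X] (S : Set X) : Set (Set X) :=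
  {B | ∃ c γ, IsTriod S c γ ∧ B = {x | JoinedIn S c x}}

/-- Three points of a circle are joined to a common point inside the disc and within `B`, with
angles separated by `q₁` and `q₂`. -/
def HasSpider (B : Set (ℝ × ℝ)) (z : ℝ × ℝ) (r q₁ q₂ : ℝ) : Prop :=
  ∃ c : ℝ × ℝ, ∃ θ : Fin 3 → ℝ, (-Real.pi < θ 0 ∧ θ 0 < q₁ ∧ q₁ < θ 1 ∧ θ 1 < q₂ ∧ q₂ < θ 2 ∧
    θ 2 ≤ Real.pi) ∧
    ∀ i, JoinedIn (B ∩ {x | sqDist z x ≤ r ^ 2}) c (circlePoint z r (θ i))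

theorem HasSpider.inter_nonempty {B B' : Set (ℝ × ℝ)} {z : ℝ × ℝ} {r q₁ q₂ : ℝ} (hr : 0 < r)
    (h : HasSpider B z r q₁ q₂) (h' : HasSpider B' z r q₁ q₂) : (B ∩ B').Nonempty := by
  obtain ⟨c, θ, ⟨h0, h1, h2, h3, h4, h5⟩, hj⟩ := h
  obtain ⟨c', θ', ⟨h0', h1', h2', h3', h4', h5'⟩, hj'⟩ := h'
  by_contra hemp
  have hne : ∀ i, θ i ≠ θ' i := by
    intro i hi
    exact hemp ⟨_, (hj i).target_mem.1, hi ▸ (hj' i).target_mem.1⟩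
  have key : ∀ i j, θ i < θ' i → θ' i < θ j → θ j < θ' j → θ' j < θ i + 2 * Real.pi → False := by
    intro i j a b c d
    obtain ⟨x, hx, hx'⟩ := JoinedIn.inter_nonempty_of_interleaved hr (fun x hx => hx.2)
      (fun x hx => hx.2) a b c d ((hj i).symm.trans (hj j)) ((hj' i).symm.trans (hj' j))
    exact hemp ⟨x, hx.1, hx'.1⟩
  have key' : ∀ i j, θ' i < θ i → θ i < θ' j → θ' j < θ j → θ j < θ' i + 2 * Real.pi → False := by
    intro i j a b c d
    obtain ⟨x, hx, hx'⟩ := JoinedIn.inter_nonempty_of_interleaved hr (fun x hx => hx.2)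
      (fun x hx => hx.2) a b c d ((hj' i).symm.trans (hj' j)) ((hj i).symm.trans (hj j))
    exact hemp ⟨x, hx'.1, hx.1⟩
  have k01 := key 0 1
  have k02 := key 0 2
  have k12 := key 1 2
  have k01' := key' 0 1
  have k02' := key' 0 2
  have k12' := key' 1 2
  rcases lt_or_gt_of_ne (hne 0) with a | a <;> rcases lt_or_gt_of_ne (hne 1) with b | b <;>
    rcases lt_or_gt_of_ne (hne 2) with c | c
  · exact k01 a (by linarith) b (by linarith)
  · exact k01 a (by linarith) b (by linarith)
  · exact k02 a (by linarith) c (by linarith)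
  · exact k12' b (by linarith) c (by linarith)
  · exact k12 b (by linarith) c (by linarith)
  · exact k02' a (by linarith) c (by linarith)
  · exact k01' a (by linarith) b (by linarith)
  · exact k01' a (by linarith) b (by linarith)

theorem exists_perm_strict {θ : Fin 3 → ℝ} (h : Function.Injective θ) :
    ∃ σ : Fin 3 → Fin 3, θ (σ 0) < θ (σ 1) ∧ θ (σ 1) < θ (σ 2) := by
  have h01 := h.ne (show (0 : Fin 3) ≠ 1 by decide)
  have h02 := h.ne (show (0 : Fin 3) ≠ 2 by decide)
  have h12 := h.ne (show (1 : Fin 3) ≠ 2 by decide)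
  rcases lt_or_gt_of_ne h01 with a | a <;> rcases lt_or_gt_of_ne h02 with b | b <;>
    rcases lt_or_gt_of_ne h12 with c | c
  · exact ⟨![0, 1, 2], a, c⟩
  · exact ⟨![0, 2, 1], b, c⟩
  · linarith
  · exact ⟨![2, 0, 1], b, a⟩
  · exact ⟨![1, 0, 2], a, b⟩
  · linarith
  · exact ⟨![1, 2, 0], c, b⟩
  · exact ⟨![2, 1, 0], c, a⟩

theorem IsTriod.exists_hasSpider {S : Set (ℝ × ℝ)} {c : ℝ × ℝ}
    {γ : Fin 3 → unitInterval → ℝ × ℝ} (h : IsTriod S c γ) :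
    ∃ d : ℚ × ℚ × ℚ × ℚ × ℚ, (0 : ℝ) < d.2.2.1 ∧
      HasSpider {x | JoinedIn S c x} ((d.1 : ℝ), (d.2.1 : ℝ)) d.2.2.1 d.2.2.2.1 d.2.2.2.2 := by
  have hpos : ∀ i, 0 < sqDist c (γ i 1) := by
    intro i
    have hne : γ i 1 ≠ c := by
      rw [← h.zero i]; exact (h.injective i).ne (by simp)
    refine lt_of_le_of_ne (by unfold sqDist; positivity) fun h0 => hne ?_
    unfold sqDist at h0
    ext <;> nlinarith [sq_nonneg ((γ i 1).1 - c.1), sq_nonneg ((γ i 1).2 - c.2)]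
  obtain ⟨r, hr0, hr⟩ : ∃ r : ℚ, (0 : ℝ) < r ∧ ∀ i, (r : ℝ) ^ 2 < sqDist c (γ i 1) := by
    have : ∀ᶠ r : ℝ in nhdsWithin 0 (Set.Ioi 0), ∀ i, r ^ 2 < sqDist c (γ i 1) := by
      rw [Filter.eventually_all]
      intro i
      refine nhdsWithin_le_nhds ?_
      have : Filter.Tendsto (fun r : ℝ => r ^ 2) (nhds 0) (nhds 0) := by
        simpa using (continuous_pow (M := ℝ) 2).tendsto 0
      exact this.eventually (gt_mem_nhds (hpos i))
    obtain ⟨u, hu, hu'⟩ := mem_nhdsGT_iff_exists_Ioo_subset.1 this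
    obtain ⟨q, hq, hq'⟩ := exists_rat_btwn (show (0 : ℝ) < u from hu)
    exact ⟨q, hq, hu' ⟨hq, hq'⟩⟩
  obtain ⟨z, hz0, hz1⟩ : ∃ z : ℚ × ℚ, sqDist ((z.1 : ℝ), (z.2 : ℝ)) c < (r : ℝ) ^ 2 ∧
      ∀ i, (r : ℝ) ^ 2 < sqDist ((z.1 : ℝ), (z.2 : ℝ)) (γ i 1) := by
    have hd : DenseRange (Prod.map ((↑) : ℚ → ℝ) ((↑) : ℚ → ℝ)) :=
      Rat.denseRange_cast.prodMap Rat.denseRange_cast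
    have hc : ∀ x, Continuous fun z => sqDist z x := fun x =>
      continuous_sqDist.comp (continuous_id.prodMk continuous_const)
    have ho : IsOpen ({z | sqDist z c < (r : ℝ) ^ 2} ∩ ⋂ i, {z | (r : ℝ) ^ 2 < sqDist z (γ i 1)}) :=
      (isOpen_lt (hc c) continuous_const).inter
        (isOpen_iInter_of_finite fun i => isOpen_lt continuous_const (hc _))
    obtain ⟨z, hz⟩ := hd.exists_mem_open ho ⟨c, by simp [sqDist]; positivity, by simpa using hr⟩
    exact ⟨z, hz.1, fun i => Set.mem_iInter.1 hz.2 i⟩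
  set Z : ℝ × ℝ := ((z.1 : ℝ), (z.2 : ℝ)) with hZ
  have hexit : ∀ i, ∃ t, t ≠ 0 ∧ sqDist Z (γ i t) = (r : ℝ) ^ 2 ∧
      ∀ s ≤ t, sqDist Z (γ i s) ≤ (r : ℝ) ^ 2 := by
    intro i
    have hc : Continuous fun t => sqDist Z (γ i t) :=
      continuous_sqDist.comp (continuous_const.prodMk (h.continuous i))
    obtain ⟨t, ht, hlt⟩ := exists_first_mem_closed hc (isClosed_Ici (a := (r : ℝ) ^ 2))
      ⟨1, (hz1 i).le⟩
    simp only [Set.mem_Ici, not_le] at ht hlt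
    have ht0 : t ≠ 0 := by
      rintro rfl
      rw [h.zero] at ht
      linarith
    have hle : sqDist Z (γ i t) ≤ (r : ℝ) ^ 2 := by
      have hmem : t ∈ closure (Set.Iio t) := by
        have hne : (Set.Iio t).Nonempty := ⟨0, unitInterval.pos_iff_ne_zero.2 ht0⟩
        rw [closure_Iio' hne]; exact Set.mem_Iic.2 le_rfl
      exact closure_minimal (fun s hs => (hlt s hs).le) (isClosed_le hc continuous_const) hmem
    refine ⟨t, ht0, le_antisymm hle ht, fun s hs => ?_⟩
    rcases hs.eq_or_lt with rfl | hs
    · exact hle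
    · exact (hlt s hs).le
  choose t ht0 hteq htle using hexit
  choose θ hθ hθeq using fun i => exists_circlePoint_eq hr0 (hteq i)
  have hinj : Function.Injective θ := by
    intro i j hij
    by_contra hne
    exact ht0 i (h.disjoint i j (t i) (t j) hne (by rw [hθeq i, hθeq j, hij])).1
  obtain ⟨σ, hσ1, hσ2⟩ := exists_perm_strict hinj
  obtain ⟨q₁, hq₁, hq₁'⟩ := exists_rat_btwn hσ1
  obtain ⟨q₂, hq₂, hq₂'⟩ := exists_rat_btwn hσ2
  refine ⟨(z.1, z.2, r, q₁, q₂), hr0, c, θ ∘ σ,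
    ⟨(hθ _).1, hq₁, hq₁', hq₂, hq₂', (hθ _).2⟩, fun i => ?_⟩
  have h1 : ∀ u, JoinedIn S c (γ (σ i) u) := fun u => by
    have := joinedIn_of_mem_uIcc (h.continuous (σ i)) (s := 0) (t := u) fun v _ => h.mem (σ i) v
    rwa [h.zero] at this
  have := joinedIn_of_mem_uIcc (h.continuous (σ i)) (s := 0) (t := t (σ i))
    (S := {x | JoinedIn S c x} ∩ {x | sqDist Z x ≤ (r : ℝ) ^ 2}) (fun u hu => ⟨h1 u, by
      rw [Set.uIcc_of_le unitInterval.nonneg'] at hu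
      exact htle _ u hu.2⟩)
  rw [h.zero, hθeq] at this
  exact this

theorem JoinedIn.setOf_eq {X : Type*} [TopologicalSpace X] {S : Set X} {x y : X}
    (h : JoinedIn S x y) : {z | JoinedIn S x z} = {z | JoinedIn S y z} :=
  Set.ext fun _ => ⟨fun h' => h.symm.trans h', fun h' => h.trans h'⟩

theorem countable_triodicClasses (S : Set (ℝ × ℝ)) : (triodicClasses S).Countable := by
  have hex : ∀ B ∈ triodicClasses S, ∃ d : ℚ × ℚ × ℚ × ℚ × ℚ, (0 : ℝ) < d.2.2.1 ∧
      HasSpider B ((d.1 : ℝ), (d.2.1 : ℝ)) d.2.2.1 d.2.2.2.1 d.2.2.2.2 := by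
    rintro B ⟨c, γ, h, rfl⟩
    exact h.exists_hasSpider
  choose! d hd hd' using hex
  refine Set.MapsTo.countable_of_injOn (f := d) (t := Set.univ) (fun _ _ => trivial) ?_
    Set.countable_univ
  intro B hB B' hB' heq
  have h1 := hd' B' hB'
  rw [← heq] at h1
  obtain ⟨x, hx, hx'⟩ := (hd' B hB).inter_nonempty (hd B hB) h1
  obtain ⟨c, γ, -, rfl⟩ := hB
  obtain ⟨c', γ', -, rfl⟩ := hB'
  rw [JoinedIn.setOf_eq hx, JoinedIn.setOf_eq hx']

/-! ### Normalised parametrisations of arcs -/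

/-- The plane. -/
abbrev Plane := ℝ × ℝ

/-- Continuous curves in the plane. -/
abbrev Curve := C(unitInterval, ℝ × ℝ)

instance : MeasurableSpace Curve := borel _
instance : BorelSpace Curve := ⟨rfl⟩

/-- A positive bump centred at the `n`-th point of a dense sequence. -/
noncomputable def bump (n : ℕ) (x : Plane) : ℝ :=
  1 / (1 + dist x (TopologicalSpace.denseSeq Plane n))

theorem bump_pos (n : ℕ) (x : Plane) : 0 < bump n x := by unfold bump; positivity

theorem bump_le_one (n : ℕ) (x : Plane) : bump n x ≤ 1 := by
  unfold bump
  rw [div_le_one (by positivity)]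
  linarith [dist_nonneg (x := x) (y := TopologicalSpace.denseSeq Plane n)]

theorem continuous_bump (n : ℕ) : Continuous (bump n) := by
  unfold bump
  exact continuous_const.div (by fun_prop) fun x => by positivity

theorem bddAbove_bump_image (n : ℕ) (A : Set Plane) : BddAbove (bump n '' A) :=
  ⟨1, by rintro _ ⟨x, -, rfl⟩; exact bump_le_one n x⟩

/-- A strictly monotone bounded function on nonempty compact sets. -/
noncomputable def weight (A : Set Plane) : ℝ := ∑' n, (1 / 2) ^ (n + 1) * sSup (bump n '' A)

theorem sSup_bump_nonneg (n : ℕ) (A : Set Plane) : 0 ≤ sSup (bump n '' A) :=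
  Real.sSup_nonneg (by rintro _ ⟨x, -, rfl⟩; exact (bump_pos n x).le)

theorem sSup_bump_le_one (n : ℕ) (A : Set Plane) : sSup (bump n '' A) ≤ 1 :=
  Real.sSup_le (by rintro _ ⟨x, -, rfl⟩; exact bump_le_one n x) zero_le_one

theorem summable_half_pow : Summable fun n : ℕ => (1 / 2 : ℝ) ^ (n + 1) :=
  (summable_nat_add_iff 1).2 summable_geometric_two

theorem summable_weight (A : Set Plane) :
    Summable fun n : ℕ => (1 / 2 : ℝ) ^ (n + 1) * sSup (bump n '' A) :=
  Summable.of_nonneg_of_le (fun n => mul_nonneg (by positivity) (sSup_bump_nonneg n A))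
    (fun n => mul_le_of_le_one_right (by positivity) (sSup_bump_le_one n A)) summable_half_pow

theorem weight_nonneg (A : Set Plane) : 0 ≤ weight A :=
  tsum_nonneg fun n => mul_nonneg (by positivity) (sSup_bump_nonneg n A)

theorem weight_le_one (A : Set Plane) : weight A ≤ 1 := by
  have h1 : ∑' n : ℕ, (1 / 2 : ℝ) ^ (n + 1) = 1 := by
    simp_rw [pow_succ, tsum_mul_right, tsum_geometric_two]; norm_num
  rw [← h1]
  exact (summable_weight A).tsum_le_tsum
    (fun n => mul_le_of_le_one_right (by positivity) (sSup_bump_le_one n A)) summable_half_pow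

theorem sSup_bump_mono (n : ℕ) {A B : Set Plane} (h : A ⊆ B) :
    sSup (bump n '' A) ≤ sSup (bump n '' B) := by
  rcases A.eq_empty_or_nonempty with rfl | hA
  · simpa using sSup_bump_nonneg n B
  · exact csSup_le_csSup (bddAbove_bump_image n B) (hA.image _) (Set.image_mono h)

theorem weight_mono {A B : Set Plane} (h : A ⊆ B) : weight A ≤ weight B :=
  (summable_weight A).tsum_le_tsum
    (fun n => mul_le_mul_of_nonneg_left (sSup_bump_mono n h) (by positivity)) (summable_weight B)

theorem weight_lt {A B : Set Plane} (hA : IsClosed A) (h : A ⊆ B) (hne : A.Nonempty)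
    {x : Plane} (hx : x ∈ B) (hxA : x ∉ A) : weight A < weight B := by
  obtain ⟨ε, hε, hball⟩ := Metric.isOpen_iff.1 hA.isOpen_compl x hxA
  obtain ⟨n, hn⟩ := (TopologicalSpace.denseRange_denseSeq Plane).exists_dist_lt x
    (show 0 < ε / 3 by positivity)
  refine Summable.tsum_lt_tsum (i := n)
    (fun n => mul_le_mul_of_nonneg_left (sSup_bump_mono n h) (by positivity)) ?_
    (summable_weight A) (summable_weight B)
  refine mul_lt_mul_of_pos_left ?_ (by positivity)
  calc sSup (bump n '' A) ≤ 1 / (1 + 2 * ε / 3) := by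
        refine csSup_le (hne.image _) ?_
        rintro _ ⟨y, hy, rfl⟩
        have : ε ≤ dist y x := by
          by_contra! hlt
          exact hball hlt hy
        have h3 := dist_triangle_right y x (TopologicalSpace.denseSeq Plane n)
        unfold bump
        exact one_div_le_one_div_of_le (by positivity) (by linarith)
    _ < bump n x := by
        unfold bump
        exact one_div_lt_one_div_of_lt (by positivity) (by linarith)
    _ ≤ _ := le_csSup (bddAbove_bump_image n B) ⟨x, hx, rfl⟩

theorem image_Icc_zero_eq (f : unitInterval → Plane) (t : unitInterval) :
    f '' Set.Icc 0 t = Set.range fun s : unitInterval => f (s * t) := by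
  ext x
  constructor
  · rintro ⟨u, ⟨-, hu⟩, rfl⟩
    rcases eq_or_ne t 0 with rfl | ht
    · exact ⟨0, by rw [le_antisymm hu unitInterval.nonneg']; simp⟩
    · have ht' : (0 : ℝ) < t := unitInterval.coe_pos.2 (unitInterval.pos_iff_ne_zero.2 ht)
      refine ⟨⟨u / t, div_nonneg u.2.1 t.2.1, (div_le_one ht').2 hu⟩, ?_⟩
      simp only
      congr 1
      ext
      simp [div_mul_cancel₀ _ ht'.ne']
  · rintro ⟨s, rfl⟩
    exact ⟨s * t, ⟨unitInterval.nonneg', unitInterval.mul_le_right⟩, rfl⟩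

/-- The weight of an initial piece of a curve. -/
noncomputable def arcWeight (f : unitInterval → Plane) (t : unitInterval) : ℝ :=
  weight (f '' Set.Icc 0 t)

theorem arcWeight_mono (f : unitInterval → Plane) : Monotone (arcWeight f) := fun _ _ h =>
  weight_mono (Set.image_mono (Set.Icc_subset_Icc_right h))

theorem mem_image_of_arcWeight_eq {f : unitInterval → Plane} (hf : Continuous f)
    {s t : unitInterval} (h : arcWeight f s = arcWeight f t) : ∀ u ≤ t, f u ∈ f '' Set.Icc 0 s := by
  intro u hu
  rcases le_total t s with hst | hst
  · exact ⟨u, ⟨unitInterval.nonneg', hu.trans hst⟩, rfl⟩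
  by_contra hne
  have := weight_lt (isCompact_Icc.image hf).isClosed
    (Set.image_mono (Set.Icc_subset_Icc_right hst) : f '' Set.Icc 0 s ⊆ f '' Set.Icc 0 t)
    ⟨_, 0, ⟨le_rfl, unitInterval.nonneg'⟩, rfl⟩ ⟨u, ⟨unitInterval.nonneg', hu⟩, rfl⟩ hne
  exact this.ne h

theorem continuous_arcWeight_uncurry :
    Continuous fun x : Curve × unitInterval => arcWeight x.1 x.2 := by
  unfold arcWeight weight
  refine continuous_tsum (u := fun n => (1 / 2 : ℝ) ^ (n + 1)) (fun n => ?_) summable_half_pow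
    (fun n x => ?_)
  · refine continuous_const.mul ?_
    have := isCompact_univ.continuous_sSup
      (f := fun (x : Curve × unitInterval) (s : unitInterval) => bump n (x.1 (s * x.2)))
      (K := Set.univ) (by
        have : Continuous fun y : (Curve × unitInterval) × unitInterval => y.1.1 (y.2 * y.1.2) := by
          fun_prop
        exact (continuous_bump n).comp this)
    have e : (fun x : Curve × unitInterval => sSup (bump n '' (x.1 '' Set.Icc 0 x.2))) =
        fun x : Curve × unitInterval =>
          sSup ((fun s : unitInterval => bump n (x.1 (s * x.2))) '' Set.univ) := by
      funext x
      rw [image_Icc_zero_eq, ← Set.range_comp, Set.image_univ]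
      rfl
    rw [e]
    exact this
  · rw [Real.norm_of_nonneg (mul_nonneg (by positivity) (sSup_bump_nonneg n _))]
    exact mul_le_of_le_one_right (by positivity) (sSup_bump_le_one n _)

theorem continuous_arcWeight (f : Curve) : Continuous (arcWeight f) :=
  continuous_arcWeight_uncurry.comp (continuous_const.prodMk continuous_id)

/-- The total length of a curve in the normalised parametrisation. -/
noncomputable def Curve.len (f : Curve) : unitInterval :=
  ⟨arcWeight f 1 - arcWeight f 0, sub_nonneg.2 (arcWeight_mono f unitInterval.nonneg'), by
    linarith [weight_le_one (f '' Set.Icc 0 1), weight_nonneg (f '' Set.Icc 0 0),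
      show arcWeight f 1 = weight (f '' Set.Icc 0 1) from rfl,
      show arcWeight f 0 = weight (f '' Set.Icc 0 0) from rfl]⟩

theorem Curve.coe_len (f : Curve) : (f.len : ℝ) = arcWeight f 1 - arcWeight f 0 := rfl

theorem Curve.continuous_len : Continuous Curve.len := by
  refine Continuous.subtype_mk ?_ _
  exact (continuous_arcWeight_uncurry.comp (continuous_id.prodMk continuous_const)).sub
    (continuous_arcWeight_uncurry.comp (continuous_id.prodMk continuous_const))

/-- A curve which runs with unit weight speed along an arc (or stays at a point) and then rests. -/
structure IsArcCode (f : Curve) : Prop where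
  weight_eq : ∀ t, arcWeight f t = arcWeight f 0 + min t f.len
  eq_iff : ∀ s t, f s = f t ↔ min s f.len = min t f.len

namespace IsArcCode

variable {f g : Curve}

theorem injOn (hf : IsArcCode f) : Set.InjOn f (Set.Icc 0 f.len) := by
  intro s hs t ht h
  have := (hf.eq_iff s t).1 h
  rwa [min_eq_left hs.2, min_eq_left ht.2] at this

theorem apply_min (hf : IsArcCode f) (t : unitInterval) : f (min t f.len) = f t :=
  (hf.eq_iff _ _).2 (by simp)

theorem apply_len (hf : IsArcCode f) : f f.len = f 1 :=
  (hf.eq_iff _ _).2 (by simp [unitInterval.le_one'])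

theorem apply_of_len_le (hf : IsArcCode f) {t : unitInterval} (h : f.len ≤ t) : f t = f 1 :=
  (hf.eq_iff _ _).2 (by simp [unitInterval.le_one', h])

theorem range_eq (hf : IsArcCode f) : Set.range f = f '' Set.Icc 0 f.len := by
  ext x
  constructor
  · rintro ⟨t, rfl⟩
    exact ⟨min t f.len, ⟨unitInterval.nonneg', min_le_right _ _⟩, hf.apply_min t⟩
  · rintro ⟨t, -, rfl⟩
    exact ⟨t, rfl⟩

end IsArcCode

theorem isArcCode_of_weight {f : Curve} {ℓ : unitInterval}
    (h : ∀ t, arcWeight f t = arcWeight f 0 + min t ℓ)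
    (h' : ∀ s t, f s = f t ↔ min s ℓ = min t ℓ) : IsArcCode f ∧ f.len = ℓ := by
  have hl : f.len = ℓ := by
    ext
    rw [Curve.coe_len, h 1, add_sub_cancel_left, min_eq_right unitInterval.le_one']
  exact ⟨⟨by rwa [hl], by rwa [hl]⟩, hl⟩

/-- The curve truncated at time `a`. -/
def Curve.trunc (f : Curve) (a : unitInterval) : Curve := ⟨fun t => f (min t a), by fun_prop⟩

@[simp] theorem Curve.trunc_apply (f : Curve) (a t : unitInterval) :
    f.trunc a t = f (min t a) := rfl

theorem Curve.trunc_image_Icc (f : Curve) (a t : unitInterval) :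
    f.trunc a '' Set.Icc 0 t = f '' Set.Icc 0 (min t a) := by
  ext x
  constructor
  · rintro ⟨u, ⟨-, hu⟩, rfl⟩
    exact ⟨min u a, ⟨unitInterval.nonneg', min_le_min_right _ hu⟩, rfl⟩
  · rintro ⟨u, ⟨h0, hu⟩, rfl⟩
    exact ⟨u, ⟨h0, hu.trans (min_le_left _ _)⟩, by
      rw [Curve.trunc_apply, min_eq_left (hu.trans (min_le_right _ _))]⟩

theorem Curve.trunc_range (f : Curve) (a : unitInterval) :
    Set.range (f.trunc a) = f '' Set.Icc 0 a := by
  have := f.trunc_image_Icc a 1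
  rw [min_eq_right unitInterval.le_one'] at this
  rw [← this, ← Set.image_univ]
  congr 1
  ext t
  simp [unitInterval.le_one']

theorem IsArcCode.trunc {f : Curve} (hf : IsArcCode f) (a : unitInterval) :
    IsArcCode (f.trunc a) ∧ (f.trunc a).len = min a f.len := by
  refine isArcCode_of_weight (fun t => ?_) (fun s t => ?_)
  · unfold arcWeight
    rw [Curve.trunc_image_Icc, Curve.trunc_image_Icc]
    have h1 := hf.weight_eq (min t a)
    have h2 : min (0 : unitInterval) a = 0 := min_eq_left unitInterval.nonneg'
    rw [h2]
    unfold arcWeight at h1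
    rw [h1, min_assoc]
  · rw [Curve.trunc_apply, Curve.trunc_apply, hf.eq_iff, min_assoc, min_assoc]

/-- Curves all of whose fibres are intervals. -/
def HasMonotoneFibres (f : Curve) : Prop :=
  ∀ s t, s ≤ t → f s = f t → ∀ u ∈ Set.Icc s t, f u = f s

theorem HasMonotoneFibres.exists_isArcCode {f : Curve} (hf : HasMonotoneFibres f) :
    ∃ g : Curve, IsArcCode g ∧ Set.range g = Set.range f ∧ g 0 = f 0 ∧ g 1 = f 1 := by
  let u : unitInterval → Set.Icc 0 f.len := fun t =>
    ⟨⟨arcWeight f t - arcWeight f 0, sub_nonneg.2 (arcWeight_mono f unitInterval.nonneg'), by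
      have := f.len.2.2
      rw [Curve.coe_len] at this
      linarith [arcWeight_mono f (unitInterval.le_one' (t := t))]⟩, unitInterval.nonneg', by
      change arcWeight f t - arcWeight f 0 ≤ arcWeight f 1 - arcWeight f 0
      linarith [arcWeight_mono f (unitInterval.le_one' (t := t))]⟩
  have hu : ∀ t, ((u t : unitInterval) : ℝ) = arcWeight f t - arcWeight f 0 := fun _ => rfl
  have hcont : Continuous u :=
    ((((continuous_arcWeight f).sub continuous_const).subtype_mk _).subtype_mk _)
  have hmono : Monotone u := fun s t h => by
    change arcWeight f s - arcWeight f 0 ≤ arcWeight f t - arcWeight f 0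
    linarith [arcWeight_mono f h]
  have hu0 : (u 0 : unitInterval) = 0 := by ext; rw [hu]; simp
  have hu1 : (u 1 : unitInterval) = f.len := by ext; rw [hu, Curve.coe_len]
  have hsurj : Function.Surjective u := by
    rintro ⟨v, hv0, hv1⟩
    have hc : ContinuousOn (fun t => (u t : unitInterval)) (Set.Icc 0 1) :=
      (continuous_subtype_val.comp hcont).continuousOn
    obtain ⟨t, -, ht⟩ := intermediate_value_Icc (unitInterval.nonneg' (t := 1)) hc
      (show v ∈ _ from by rw [hu0, hu1]; exact ⟨hv0, hv1⟩)
    exact ⟨t, Subtype.ext ht⟩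
  have hq : Topology.IsQuotientMap u := hcont.isClosedMap.isQuotientMap hcont hsurj
  have hfib : ∀ s t, u s = u t → f s = f t := by
    have : ∀ s t, s ≤ t → u s = u t → f s = f t := by
      intro s t hst h
      have hw : arcWeight f s = arcWeight f t := by
        have := congrArg (fun x : Set.Icc 0 f.len => ((x : unitInterval) : ℝ)) h
        simp only [hu] at this
        linarith
      obtain ⟨r, hr, hrt⟩ := mem_image_of_arcWeight_eq f.continuous hw t le_rfl
      have := hf r t (hr.2.trans hst) hrt
      rw [this s ⟨hr.2, hst⟩, hrt]
    intro s t h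
    rcases le_total s t with hst | hst
    · exact this s t hst h
    · exact (this t s hst h.symm).symm
  have hfib' : ∀ s t, f s = f t → u s = u t := by
    have : ∀ s t, s ≤ t → f s = f t → u s = u t := by
      intro s t hst h
      ext
      rw [hu, hu]
      congr 1
      refine le_antisymm (arcWeight_mono f hst) (weight_mono ?_)
      rintro _ ⟨v, ⟨hv0, hv⟩, rfl⟩
      rcases le_total v s with hvs | hvs
      · exact ⟨v, ⟨hv0, hvs⟩, rfl⟩
      · exact ⟨s, ⟨unitInterval.nonneg', le_rfl⟩, (hf s t hst h v ⟨hvs, hv⟩).symm⟩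
    intro s t h
    rcases le_total s t with hst | hst
    · exact this s t hst h
    · exact (this t s hst h.symm).symm
  choose inv hinv using hsurj
  let g₀ : Set.Icc 0 f.len → Plane := fun v => f (inv v)
  have hg₀u : ∀ t, g₀ (u t) = f t := fun t => hfib _ _ (hinv (u t))
  have hg₀c : Continuous g₀ := hq.continuous_iff.2 (by
    convert f.continuous using 1
    exact funext hg₀u)
  have hlen0 : (0 : unitInterval) ≤ f.len := unitInterval.nonneg'
  let g : Curve := ⟨fun t => g₀ (Set.projIcc 0 f.len hlen0 t), hg₀c.comp continuous_projIcc⟩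
  have hg : ∀ t, g t = g₀ (Set.projIcc 0 f.len hlen0 t) := fun _ => rfl
  have hproj : ∀ t : unitInterval, (Set.projIcc 0 f.len hlen0 t : unitInterval) = min t f.len := by
    intro t
    rw [Set.coe_projIcc, min_comm, max_eq_right (le_min unitInterval.nonneg' hlen0)]
  have hgimage : ∀ t, g '' Set.Icc 0 (u t : unitInterval) = f '' Set.Icc 0 t := by
    intro t
    ext x
    constructor
    · rintro ⟨v, ⟨-, hv⟩, rfl⟩
      have hvl : v ≤ f.len := hv.trans (u t).2.2
      set v' : Set.Icc 0 f.len := ⟨v, unitInterval.nonneg', hvl⟩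
      have e : g v = f (min (inv v') t) := by
        rw [hg, ← hg₀u]
        congr 1
        ext1
        rw [hproj, min_eq_left hvl, hmono.map_min, hinv, min_eq_left (show v' ≤ u t from hv)]
      exact ⟨_, ⟨unitInterval.nonneg', min_le_right _ _⟩, e.symm⟩
    · rintro ⟨s, ⟨-, hs⟩, rfl⟩
      refine ⟨u s, ⟨unitInterval.nonneg', hmono hs⟩, ?_⟩
      rw [hg, Set.projIcc_val, hg₀u]
  have hweight : ∀ t, arcWeight g (u t) = arcWeight f t := fun t => by
    unfold arcWeight; rw [hgimage]
  have himagemin : ∀ t, g '' Set.Icc 0 (min t f.len) = g '' Set.Icc 0 t := by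
    intro t
    ext x
    constructor
    · rintro ⟨v, ⟨h0, hv⟩, rfl⟩
      exact ⟨v, ⟨h0, hv.trans (min_le_left _ _)⟩, rfl⟩
    · rintro ⟨v, ⟨h0, hv⟩, rfl⟩
      refine ⟨min v f.len, ⟨unitInterval.nonneg', min_le_min_right _ hv⟩, ?_⟩
      rw [hg, hg]
      congr 1
      ext1
      rw [hproj, hproj, min_assoc, min_self]
  obtain ⟨hcode, hlen⟩ := isArcCode_of_weight (f := g) (ℓ := f.len) (fun t => by
      have h1 : arcWeight g t = arcWeight g (min t f.len) := by
        unfold arcWeight; rw [himagemin]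
      obtain ⟨s, hs⟩ : ∃ s, (u s : unitInterval) = min t f.len := by
        obtain ⟨s, hs⟩ := hq.surjective (Set.projIcc 0 f.len hlen0 t)
        exact ⟨s, by rw [hs, hproj]⟩
      have h0 := hweight 0
      rw [hu0] at h0
      rw [h1, ← hs, hweight, h0, hu]
      ring) (fun s t => by
      rw [hg, hg, ← hproj, ← hproj]
      obtain ⟨a, ha⟩ := hq.surjective (Set.projIcc 0 f.len hlen0 s)
      obtain ⟨b, hb⟩ := hq.surjective (Set.projIcc 0 f.len hlen0 t)
      rw [← ha, ← hb, hg₀u, hg₀u]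
      exact ⟨fun h => congrArg _ (hfib' _ _ h), fun h => hfib _ _ (Subtype.ext h)⟩)
  refine ⟨g, hcode, ?_, ?_, ?_⟩
  · rw [hcode.range_eq, hlen, ← hu1, hgimage, ← Set.image_univ]
    congr 1
    ext t
    simp [unitInterval.le_one']
  · have := hg₀u 0
    rw [hg, ← this]
    congr 1
    ext1
    rw [hproj, hu0, min_eq_left hlen0]
  · have := hg₀u 1
    rw [hg, ← this]
    congr 1
    ext1
    rw [hproj, hu1, min_eq_right unitInterval.le_one']

/-! ### Existence and uniqueness of arcs -/

/-- Closed sets of times containing the endpoints such that `f` agrees at the ends of each gap. -/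
def GapCollapsing {X : Type*} (f : unitInterval → X) (K : Set unitInterval) : Prop :=
  IsClosed K ∧ 0 ∈ K ∧ 1 ∈ K ∧
    ∀ a ∈ K, ∀ b ∈ K, a < b → (∀ u, a < u → u < b → u ∉ K) → f a = f b

theorem exists_minimal_gapCollapsing {X : Type*} [TopologicalSpace X] [T2Space X]
    {f : unitInterval → X} (hf : Continuous f) : ∃ K, Minimal (GapCollapsing f) K := by
  obtain ⟨m, hm⟩ := zorn_superset {K | GapCollapsing f K} (by
    intro c hc hchain
    rcases c.eq_empty_or_nonempty with rfl | hcne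
    · refine ⟨Set.univ, ⟨isClosed_univ, trivial, trivial, fun a _ b _ hab h => ?_⟩, by simp⟩
      obtain ⟨u, hu, hu'⟩ := exists_between hab
      exact absurd trivial (h u hu hu')
    refine ⟨⋂₀ c, ⟨isClosed_sInter fun K hK => (hc hK).1, fun K hK => (hc hK).2.1,
      fun K hK => (hc hK).2.2.1, fun a ha b hb hab hgap => ?_⟩, fun K hK => Set.sInter_subset_of_mem hK⟩
    by_contra hne
    obtain ⟨U, V, hU, hV, haU, hbV, hUV⟩ := t2_separation hne
    obtain ⟨m, ham, hmb⟩ := exists_between hab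
    obtain ⟨a₀, ⟨haa₀, ha₀m⟩, ha₀⟩ := (mem_nhdsGE_iff_exists_mem_Ioc_Ico_subset ham).1
      (mem_nhdsWithin_of_mem_nhds ((hU.preimage hf).mem_nhds haU))
    obtain ⟨b₀, ⟨hmb₀, hbb₀⟩, hb₀⟩ := (mem_nhdsLE_iff_exists_mem_Ico_Ioc_subset hmb).1
      (mem_nhdsWithin_of_mem_nhds ((hV.preimage hf).mem_nhds hbV))
    obtain ⟨a', haa', ha'a₀⟩ := exists_between haa₀
    obtain ⟨b', hb₀b', hbb'⟩ := exists_between hbb₀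
    have hab' : a' < b' := (ha'a₀.trans_le (ha₀m.trans hmb₀)).trans hb₀b'
    have : Nonempty c := hcne.to_subtype
    obtain ⟨K, hK⟩ := (isCompact_Icc (a := a') (b := b')).elim_directed_family_closed
      (fun K : c => (K : Set unitInterval)) (fun K => (hc K.2).1) (by
        rw [← Set.sInter_eq_iInter]
        refine Set.eq_empty_of_forall_notMem ?_
        rintro u ⟨⟨hu1, hu2⟩, hu⟩
        exact hgap u (haa'.trans_le hu1) (hu2.trans_lt hbb') hu)
      (by
        intro K K'
        rcases hchain.total K.2 K'.2 with h | h
        · exact ⟨K, subset_rfl, h⟩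
        · exact ⟨K', h, subset_rfl⟩)
    have hKc := hc K.2
    obtain ⟨α, ⟨hαK, hα⟩, hαm⟩ := (hKc.1.inter isClosed_Iic).isCompact.exists_isGreatest
      (s := (K : Set unitInterval) ∩ Set.Iic a') ⟨a, ha K K.2, haa'.le⟩
    obtain ⟨β, ⟨hβK, hβ⟩, hβm⟩ := (hKc.1.inter isClosed_Ici).isCompact.exists_isLeast
      (s := (K : Set unitInterval) ∩ Set.Ici b') ⟨b, hb K K.2, hbb'.le⟩
    have haα : a ≤ α := hαm ⟨ha K K.2, haa'.le⟩
    have hβb : β ≤ b := hβm ⟨hb K K.2, hbb'.le⟩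
    have heq := hKc.2.2.2 α hαK β hβK
      ((show α ≤ a' from hα).trans_lt (hab'.trans_le hβ)) (by
      intro u hu1 hu2 huK
      rcases le_total u a' with h | h
      · exact (hαm ⟨huK, h⟩).not_gt hu1
      rcases le_total b' u with h' | h'
      · exact (hβm ⟨huK, h'⟩).not_gt hu2
      · exact Set.notMem_empty u (hK ▸ ⟨⟨h, h'⟩, huK⟩))
    exact Set.disjoint_left.1 hUV (ha₀ ⟨haα, lt_of_le_of_lt hα ha'a₀⟩)
      (heq ▸ hb₀ ⟨hb₀b'.trans_le hβ, hβb⟩))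
  exact ⟨m, hm⟩

theorem JoinedIn.exists_hasMonotoneFibres {S : Set Plane} {x y : Plane} (h : JoinedIn S x y) :
    ∃ g : Curve, HasMonotoneFibres g ∧ Set.range g ⊆ S ∧ g 0 = x ∧ g 1 = y := by
  obtain ⟨f, hfS⟩ := h
  obtain ⟨K, hK, hmin⟩ := exists_minimal_gapCollapsing f.continuous
  have hgap : ∀ s ∈ K, ∀ t ∈ K, s < t → f s = f t → ∀ u, s < u → u < t → u ∉ K := by
    intro s hs t ht hst heq
    have hK' : GapCollapsing f (K \ Set.Ioo s t) := by
      refine ⟨hK.1.sdiff isOpen_Ioo, ⟨hK.2.1, fun h => (h.1.trans_le unitInterval.nonneg').false⟩,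
        ⟨hK.2.2.1, fun h => (h.2.trans_le unitInterval.le_one').false⟩, ?_⟩
      intro a ha b hb hab hu
      by_cases hex : ∃ u, a < u ∧ u < b ∧ u ∈ K
      · obtain ⟨u, hau, hub, huK⟩ := hex
        have hust : u ∈ Set.Ioo s t := by
          by_contra hn
          exact hu u hau hub ⟨huK, hn⟩
        have has : a ≤ s := by
          by_contra! hsa
          exact ha.2 ⟨hsa, hau.trans hust.2⟩
        have htb : t ≤ b := by
          by_contra! hbt
          exact hb.2 ⟨hust.1.trans hub, hbt⟩
        have has' : a = s := by
          by_contra hne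
          exact hu s (lt_of_le_of_ne has hne) (hust.1.trans hub) ⟨hs, fun h => h.1.false⟩
        have htb' : t = b := by
          by_contra hne
          exact hu t (hau.trans hust.2) (lt_of_le_of_ne htb hne) ⟨ht, fun h => h.2.false⟩
        rw [has', ← htb', heq]
      · exact hK.2.2.2 a ha.1 b hb.1 hab fun u h1 h2 h3 => hex ⟨u, h1, h2, h3⟩
    intro u hsu hut huK
    exact (hmin hK' Set.sdiff_subset huK).2 ⟨hsu, hut⟩
  have hm : ∀ t, ∃ m, m ∈ K ∧ m ≤ t ∧ ∀ k ∈ K, k ≤ t → k ≤ m := fun t => by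
    obtain ⟨m, hm, hm'⟩ := (hK.1.inter isClosed_Iic).isCompact.exists_isGreatest
      (s := K ∩ Set.Iic t) ⟨0, hK.2.1, unitInterval.nonneg'⟩
    exact ⟨m, hm.1, hm.2, fun k hk hkt => hm' ⟨hk, hkt⟩⟩
  choose m hmK hmle hmax using hm
  have hn : ∀ t, ∃ n, n ∈ K ∧ t ≤ n ∧ ∀ k ∈ K, t ≤ k → n ≤ k := fun t => by
    obtain ⟨m, hm, hm'⟩ := (hK.1.inter isClosed_Ici).isCompact.exists_isLeast
      (s := K ∩ Set.Ici t) ⟨1, hK.2.2.1, unitInterval.le_one'⟩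
    exact ⟨m, hm.1, hm.2, fun k hk hkt => hm' ⟨hk, hkt⟩⟩
  choose n hnK hnle hnmin using hn
  have hmn : ∀ t, f (m t) = f (n t) := by
    intro t
    rcases ((hmle t).trans (hnle t)).eq_or_lt with h | h
    · rw [h]
    · refine hK.2.2.2 _ (hmK t) _ (hnK t) h fun u hu1 hu2 huK => ?_
      rcases le_total u t with hut | hut
      · exact (hmax t u huK hut).not_gt hu1
      · exact (hnmin t u huK hut).not_gt hu2
  have hmmono : Monotone m := fun s t hst => hmax t _ (hmK s) ((hmle s).trans hst)
  have hcont : Continuous fun t => f (m t) := by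
    have huc := CompactSpace.uniformContinuous_of_continuous f.continuous
    refine UniformContinuous.continuous ?_
    rw [Metric.uniformContinuous_iff] at huc ⊢
    intro ε hε
    obtain ⟨δ, hδ, hd⟩ := huc ε hε
    refine ⟨δ, hδ, ?_⟩
    have key : ∀ s t, s ≤ t → dist s t < δ → dist (f (m s)) (f (m t)) < ε := by
      intro s t hst hdist
      rcases le_or_gt (m t) s with h | h
      · rw [le_antisymm (hmmono hst) (hmax s _ (hmK t) h), dist_self]; exact hε
      · rw [hmn s]
        apply hd
        have h1 : n s ≤ m t := hnmin s _ (hmK t) h.le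
        refine lt_of_le_of_lt ?_ hdist
        rw [Subtype.dist_eq, Subtype.dist_eq, Real.dist_eq, Real.dist_eq, abs_sub_comm,
          abs_sub_comm (s : ℝ), abs_of_nonneg (sub_nonneg.2 (show (n s : ℝ) ≤ m t from h1)),
          abs_of_nonneg (sub_nonneg.2 (show (s : ℝ) ≤ t from hst))]
        have h2 : (s : ℝ) ≤ n s := hnle s
        have h3 : (m t : ℝ) ≤ t := hmle t
        linarith
    intro s t hdist
    rcases le_total s t with h | h
    · exact key s t h hdist
    · rw [dist_comm]; exact key t s h (by rwa [dist_comm])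
  refine ⟨⟨fun t => f (m t), hcont⟩, ?_, ?_, ?_, ?_⟩
  · intro s t hst heq u hu
    simp only [ContinuousMap.coe_mk] at heq ⊢
    have h1 := hmmono hu.1
    have h2 := hmmono hu.2
    rcases h1.eq_or_lt with h1 | h1
    · rw [h1]
    rcases h2.eq_or_lt with h2 | h2
    · rw [h2, heq]
    · exact absurd (hmK u) (hgap _ (hmK s) _ (hmK t) (h1.trans h2) heq _ h1 h2)
  · rintro _ ⟨t, rfl⟩
    exact hfS _
  · change f (m 0) = x
    rw [le_antisymm (hmle 0) unitInterval.nonneg', f.source]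
  · change f (m 1) = y
    rw [le_antisymm (hmle 1) (hmax 1 1 hK.2.2.1 le_rfl), f.target]

theorem JoinedIn.exists_isArcCode {S : Set Plane} {x y : Plane} (h : JoinedIn S x y) :
    ∃ g : Curve, IsArcCode g ∧ Set.range g ⊆ S ∧ g 0 = x ∧ g 1 = y := by
  obtain ⟨f, hf, hfS, h0, h1⟩ := h.exists_hasMonotoneFibres
  obtain ⟨g, hg, hr, hg0, hg1⟩ := hf.exists_isArcCode
  exact ⟨g, hg, hr ▸ hfS, hg0.trans h0, hg1.trans h1⟩

theorem joinedIn_range (f : Curve) (s t : unitInterval) : JoinedIn (Set.range f) (f s) (f t) :=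
  joinedIn_of_mem_uIcc f.continuous fun u _ => ⟨u, rfl⟩

namespace IsArcCode

variable {f g : Curve}

theorem arcWeight_zero_eq (h : f 0 = g 0) : arcWeight f 0 = arcWeight g 0 := by
  simp [arcWeight, h]

/-- An arc contained in another arc with the same starting point is an initial segment. -/
theorem initial_segment (hf : IsArcCode f) (hg : IsArcCode g) (h0 : f 0 = g 0)
    (hr : Set.range f ⊆ Set.range g) : f.len ≤ g.len ∧ ∀ t, f t = g (min t f.len) := by
  have hex : ∀ t, ∃ u : Set.Icc 0 g.len, g u = f t := fun t => by
    have := hr ⟨t, rfl⟩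
    rw [hg.range_eq] at this
    obtain ⟨u, hu, hut⟩ := this
    exact ⟨⟨u, hu⟩, hut⟩
  choose φ hφ using hex
  let e : Set.Icc 0 g.len → Plane := fun u => g u
  have he : Topology.IsClosedEmbedding e :=
    Continuous.isClosedEmbedding (by fun_prop) fun u v huv => Subtype.ext (hg.injOn u.2 v.2 huv)
  have hφc : Continuous φ := by
    rw [he.isInducing.continuous_iff]
    convert f.continuous using 1
    exact funext hφ
  have hφc' : Continuous fun t => (φ t : unitInterval) := by fun_prop
  have hφ0 : (φ 0 : unitInterval) = 0 :=
    hg.injOn (φ 0).2 ⟨le_rfl, unitInterval.nonneg'⟩ ((hφ 0).trans h0)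
  have hinj : Set.InjOn (fun t => (φ t : unitInterval)) (Set.Icc 0 f.len) := by
    intro s hs t ht hst
    refine hf.injOn hs ht ?_
    rw [← hφ s, ← hφ t]
    exact congrArg g hst
  have hmono : StrictMonoOn (fun t => (φ t : unitInterval)) (Set.Icc 0 f.len) :=
    hφc'.continuousOn.strictMonoOn_of_injOn_Icc unitInterval.nonneg'
      (by simp only [hφ0]; exact unitInterval.nonneg') hinj
  have himg : ∀ t ≤ f.len, f '' Set.Icc 0 t = g '' Set.Icc 0 (φ t) := by
    intro t ht
    ext x
    constructor
    · rintro ⟨s, ⟨h0, hs⟩, rfl⟩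
      exact ⟨φ s, ⟨unitInterval.nonneg', hmono.monotoneOn ⟨h0, hs.trans ht⟩
        ⟨unitInterval.nonneg', ht⟩ hs⟩, hφ s⟩
    · rintro ⟨v, ⟨hv0, hv⟩, rfl⟩
      obtain ⟨s, hs, hsv⟩ := intermediate_value_Icc (unitInterval.nonneg' (t := t))
        hφc'.continuousOn (show v ∈ _ from by rw [hφ0]; exact ⟨hv0, hv⟩)
      exact ⟨s, hs, by rw [← hφ s]; exact congrArg g hsv⟩
  have hid : ∀ t ≤ f.len, (φ t : unitInterval) = t := by
    intro t ht
    have h1 : arcWeight f t = arcWeight g (φ t) := by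
      unfold arcWeight; rw [himg t ht]
    rw [hf.weight_eq, hg.weight_eq, arcWeight_zero_eq h0, min_eq_left ht,
      min_eq_left (φ t).2.2] at h1
    ext
    linarith
  refine ⟨by rw [← hid _ le_rfl]; exact (φ f.len).2.2, fun t => ?_⟩
  rw [← hf.apply_min t, ← hφ, hid _ (min_le_right _ _)]

end IsArcCode

/-! ### Triod-free sets -/

namespace unitInterval

/-- Affine interpolation in the unit interval. -/
def lerp (a b t : unitInterval) : unitInterval :=
  ⟨(1 - (t : ℝ)) * a + t * b, by
    have := a.2.1; have := b.2.1; have := t.2.1; have := a.2.2; have := b.2.2; have := t.2.2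
    constructor <;> nlinarith⟩

theorem coe_lerp (a b t : unitInterval) : (lerp a b t : ℝ) = (1 - (t : ℝ)) * a + t * b := rfl

theorem continuous_lerp (a b : unitInterval) : Continuous (lerp a b) := by
  unfold lerp; fun_prop

@[simp] theorem lerp_zero (a b : unitInterval) : lerp a b 0 = a := by ext; simp [coe_lerp]

@[simp] theorem lerp_one (a b : unitInterval) : lerp a b 1 = b := by ext; simp [coe_lerp]

theorem lerp_injective {a b : unitInterval} (h : a ≠ b) : Function.Injective (lerp a b) := by
  intro s t hst
  have h1 := congrArg Subtype.val hst
  rw [coe_lerp, coe_lerp] at h1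
  have h2 : ((b : ℝ) - a) * (s - t) = 0 := by linarith
  rcases mul_eq_zero.1 h2 with h3 | h3
  · exact absurd (Subtype.ext (by linarith)) h
  · exact Subtype.ext (by linarith)

theorem lerp_mem_uIcc (a b t : unitInterval) : lerp a b t ∈ Set.uIcc a b := by
  have ht := t.2.1
  have ht' := t.2.2
  rcases le_total a b with h | h
  · rw [Set.uIcc_of_le h]
    have h' : (a : ℝ) ≤ b := h
    constructor <;> rw [← Subtype.coe_le_coe, coe_lerp] <;> nlinarith
  · rw [Set.uIcc_of_ge h]
    have h' : (b : ℝ) ≤ a := h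
    constructor <;> rw [← Subtype.coe_le_coe, coe_lerp] <;> nlinarith

theorem range_lerp (a b : unitInterval) : Set.range (lerp a b) = Set.uIcc a b := by
  refine Set.Subset.antisymm (by rintro _ ⟨t, rfl⟩; exact lerp_mem_uIcc a b t) ?_
  have := intermediate_value_uIcc (a := (0 : unitInterval)) (b := 1)
    (continuous_lerp a b).continuousOn
  rw [lerp_zero, lerp_one] at this
  exact this.trans (Set.image_subset_range _ _)

end unitInterval

open unitInterval (lerp)

theorem isTriod_of_legs {X : Type*} [TopologicalSpace X] {S : Set X} {c : X}
    {f : Fin 3 → unitInterval → X} {a b : Fin 3 → unitInterval}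
    (hf : ∀ i, Continuous (f i)) (hab : ∀ i, a i ≠ b i)
    (hinj : ∀ i, Set.InjOn (f i) (Set.uIcc (a i) (b i))) (hc : ∀ i, f i (a i) = c)
    (hS : ∀ i, ∀ u ∈ Set.uIcc (a i) (b i), f i u ∈ S)
    (hdisj : ∀ i j, i < j → ∀ u ∈ Set.uIcc (a i) (b i), u ≠ a i →
      ∀ v ∈ Set.uIcc (a j) (b j), f i u ≠ f j v) :
    IsTriod S c fun i t => f i (lerp (a i) (b i) t) := by
  have key : ∀ i j s t, i < j → f i (lerp (a i) (b i) s) = f j (lerp (a j) (b j) t) →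
      s = 0 ∧ t = 0 := by
    intro i j s t hij h
    have h1 : lerp (a i) (b i) s = a i := by
      by_contra hne
      exact hdisj i j hij _ (unitInterval.lerp_mem_uIcc _ _ _) hne _
        (unitInterval.lerp_mem_uIcc _ _ _) h
    have h2 : lerp (a j) (b j) t = a j := by
      refine hinj j (unitInterval.lerp_mem_uIcc _ _ _) Set.left_mem_uIcc ?_
      rw [← h, h1, hc, hc]
    exact ⟨unitInterval.lerp_injective (hab i) (by simpa using h1),
      unitInterval.lerp_injective (hab j) (by simpa using h2)⟩
  refine ⟨fun i => (hf i).comp (unitInterval.continuous_lerp _ _), fun i s t h => ?_,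
    fun i t => hS i _ (unitInterval.lerp_mem_uIcc _ _ _), fun i => by simp [hc], ?_⟩
  · exact unitInterval.lerp_injective (hab i)
      (hinj i (unitInterval.lerp_mem_uIcc _ _ _) (unitInterval.lerp_mem_uIcc _ _ _) h)
  · intro i j s t hij h
    rcases lt_or_gt_of_ne hij with hlt | hlt
    · exact key i j s t hlt h
    · exact (key j i t s hlt h.symm).symm

/-- A set without triods. -/
def TriodFree (S : Set Plane) : Prop := ∀ c γ, ¬IsTriod S c γ

theorem TriodFree.false_of_legs {S : Set Plane} (hS : TriodFree S) {c : Plane}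
    {f₁ f₂ f₃ : Curve} {a₁ b₁ a₂ b₂ a₃ b₃ : unitInterval}
    (h₁ : a₁ ≠ b₁) (h₂ : a₂ ≠ b₂) (h₃ : a₃ ≠ b₃)
    (i₁ : Set.InjOn f₁ (Set.uIcc a₁ b₁)) (i₂ : Set.InjOn f₂ (Set.uIcc a₂ b₂))
    (i₃ : Set.InjOn f₃ (Set.uIcc a₃ b₃))
    (c₁ : f₁ a₁ = c) (c₂ : f₂ a₂ = c) (c₃ : f₃ a₃ = c)
    (s₁ : ∀ u ∈ Set.uIcc a₁ b₁, f₁ u ∈ S) (s₂ : ∀ u ∈ Set.uIcc a₂ b₂, f₂ u ∈ S)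
    (s₃ : ∀ u ∈ Set.uIcc a₃ b₃, f₃ u ∈ S)
    (d₁₂ : ∀ u ∈ Set.uIcc a₁ b₁, u ≠ a₁ → ∀ v ∈ Set.uIcc a₂ b₂, f₁ u ≠ f₂ v)
    (d₁₃ : ∀ u ∈ Set.uIcc a₁ b₁, u ≠ a₁ → ∀ v ∈ Set.uIcc a₃ b₃, f₁ u ≠ f₃ v)
    (d₂₃ : ∀ u ∈ Set.uIcc a₂ b₂, u ≠ a₂ → ∀ v ∈ Set.uIcc a₃ b₃, f₂ u ≠ f₃ v) : False := by
  refine hS c _ (isTriod_of_legs (f := ![f₁, f₂, f₃]) (a := ![a₁, a₂, a₃]) (b := ![b₁, b₂, b₃])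
    ?_ ?_ ?_ ?_ ?_ ?_)
  · intro i; fin_cases i
    exacts [f₁.continuous, f₂.continuous, f₃.continuous]
  · intro i; fin_cases i
    exacts [h₁, h₂, h₃]
  · intro i; fin_cases i
    exacts [i₁, i₂, i₃]
  · intro i; fin_cases i
    exacts [c₁, c₂, c₃]
  · intro i; fin_cases i
    exacts [s₁, s₂, s₃]
  · intro i j hij
    fin_cases i <;> fin_cases j <;> first | exact absurd hij (by decide) | skip
    exacts [d₁₂, d₁₃, d₂₃]

theorem IsArcCode.injOn_uIcc {f : Curve} (hf : IsArcCode f) {a b : unitInterval}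
    (ha : a ≤ f.len) (hb : b ≤ f.len) : Set.InjOn f (Set.uIcc a b) :=
  hf.injOn.mono fun u hu => (⟨unitInterval.nonneg', hu.2.trans (sup_le ha hb)⟩ :
    0 ≤ u ∧ u ≤ f.len)

/-- The last time up to `t` at which a curve visits a closed set. -/
theorem exists_last_le {X : Type*} [TopologicalSpace X] {f : unitInterval → X} (hf : Continuous f)
    {C : Set X} (hC : IsClosed C) {s t : unitInterval} (hst : s ≤ t) (hs : f s ∈ C) :
    ∃ α, s ≤ α ∧ α ≤ t ∧ f α ∈ C ∧ ∀ u, α < u → u ≤ t → f u ∉ C := by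
  obtain ⟨α, ⟨hα, hαt⟩, hmax⟩ := ((hC.preimage hf).inter isClosed_Iic).isCompact.exists_isGreatest
    (s := f ⁻¹' C ∩ Set.Iic t) ⟨s, hs, hst⟩
  exact ⟨α, hmax ⟨hs, hst⟩, hαt, hα, fun u h1 h2 h3 => (hmax ⟨h3, h2⟩).not_gt h1⟩

/-- The first time from `s` on at which a curve visits a closed set. -/
theorem exists_first_ge {X : Type*} [TopologicalSpace X] {f : unitInterval → X} (hf : Continuous f)
    {C : Set X} (hC : IsClosed C) {s t : unitInterval} (hst : s ≤ t) (ht : f t ∈ C) :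
    ∃ α, s ≤ α ∧ α ≤ t ∧ f α ∈ C ∧ ∀ u, s ≤ u → u < α → f u ∉ C := by
  obtain ⟨α, ⟨hα, hαt⟩, hmin⟩ := ((hC.preimage hf).inter isClosed_Ici).isCompact.exists_isLeast
    (s := f ⁻¹' C ∩ Set.Ici s) ⟨t, ht, hst⟩
  exact ⟨α, hαt, hmin ⟨ht, hst⟩, hα, fun u h1 h2 h3 => (hmin ⟨h3, h1⟩).not_gt h2⟩

theorem Curve.isClosed_range (f : Curve) : IsClosed (Set.range f) :=
  (isCompact_range f.continuous).isClosed

theorem TriodFree.trichotomy {S : Set Plane} (hS : TriodFree S) {f g : Curve}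
    (hf : IsArcCode f) (hg : IsArcCode g) (h0 : f 0 = g 0)
    (hfS : ∀ t < f.len, f t ∈ S) (hgS : ∀ t < g.len, g t ∈ S) :
    Set.range f ⊆ Set.range g ∨ Set.range g ⊆ Set.range f ∨
      ∃ b, 0 < b ∧ b < f.len ∧ ∀ s, 0 < s → s ≤ b → f s ∉ Set.range g := by
  have hcl : IsClosed {t | t ≤ f.len ∧ t ≤ g.len ∧ ∀ s, f (min s t) = g (min s t)} := by
    refine (isClosed_le continuous_id continuous_const).and
      ((isClosed_le continuous_id continuous_const).and ?_)
    have : {t | ∀ s, f (min s t) = g (min s t)} = ⋂ s, {t | f (min s t) = g (min s t)} := by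
      ext; simp
    exact this ▸ isClosed_iInter fun s => isClosed_eq (by fun_prop) (by fun_prop)
  obtain ⟨t₀, ⟨ht₀f, ht₀g, hagree⟩, hmax⟩ := hcl.isCompact.exists_isGreatest
    ⟨0, unitInterval.nonneg', unitInterval.nonneg', fun s => by
      rw [min_eq_right unitInterval.nonneg', h0]⟩
  have hagree' : ∀ s ≤ t₀, f s = g s := fun s hs => by simpa [min_eq_left hs] using hagree s
  rcases ht₀f.eq_or_lt with h | hltf
  · left
    rw [hf.range_eq]
    rintro _ ⟨s, hs, rfl⟩
    exact ⟨s, (hagree' s (hs.2.trans h.ge)).symm⟩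
  rcases ht₀g.eq_or_lt with h | hltg
  · right; left
    rw [hg.range_eq]
    rintro _ ⟨s, hs, rfl⟩
    exact ⟨s, hagree' s (hs.2.trans h.ge)⟩
  right; right
  have claim : ∃ b, t₀ < b ∧ b < f.len ∧ ∀ s, t₀ < s → s ≤ b → f s ∉ Set.range g := by
    by_contra! hno
    have hA : ∀ b, t₀ < b → b < f.len → ∃ α, t₀ < α ∧ α ≤ b ∧ f α = g g.len := by
      intro b hb hbf
      obtain ⟨t, ht, htb, htg⟩ : ∃ t, t₀ < t ∧ t ≤ b ∧ f t ∉ Set.range g := by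
        by_contra! hall
        obtain ⟨hc, hl⟩ := hf.trunc b
        rw [min_eq_left hbf.le] at hl
        have hr : Set.range (f.trunc b) ⊆ Set.range g := by
          rw [Curve.trunc_range]
          rintro _ ⟨s, hs, rfl⟩
          rcases le_or_gt s t₀ with h | h
          · exact ⟨s, (hagree' s h).symm⟩
          · exact hall s h hs.2
        obtain ⟨h1, h2⟩ := hc.initial_segment hg (by simp [Curve.trunc_apply, h0]) hr
        rw [hl] at h1 h2
        refine (hmax ⟨hbf.le, h1, fun s => ?_⟩).not_gt hb
        rw [← h2 s, Curve.trunc_apply]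
      obtain ⟨s, hs, hst, hsg⟩ := hno t ht (htb.trans_lt hbf)
      obtain ⟨α, hsα, hαt, ⟨γ, hγ⟩, hafter⟩ := exists_last_le f.continuous g.isClosed_range hst hsg
      refine ⟨α, hs.trans_le hsα, hαt.trans htb, ?_⟩
      have hαt' : α < t := lt_of_le_of_ne hαt (by rintro rfl; exact htg ⟨γ, hγ⟩)
      have htf : t < f.len := htb.trans_lt hbf
      rcases le_or_gt g.len γ with h | hγl
      · rw [← hγ, hg.apply_of_len_le h, hg.apply_len]
      exfalso
      have hγ0 : 0 < γ := by
        rw [unitInterval.pos_iff_ne_zero]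
        rintro rfl
        have := hf.injOn ⟨unitInterval.nonneg', (hαt'.trans htf).le⟩
          ⟨le_rfl, unitInterval.nonneg'⟩ (hγ.symm.trans h0.symm)
        rw [this] at hsα
        exact (unitInterval.nonneg'.trans_lt hs).not_ge hsα
      obtain ⟨γ', hγγ', hγ'⟩ := exists_between hγl
      refine hS.false_of_legs (c := f α) (f₁ := f) (f₂ := g) (f₃ := g) (a₁ := α) (b₁ := t)
        (a₂ := γ) (b₂ := 0) (a₃ := γ) (b₃ := γ') hαt'.ne hγ0.ne' hγγ'.ne
        (hf.injOn_uIcc (hαt'.trans htf).le htf.le) (hg.injOn_uIcc hγl.le unitInterval.nonneg')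
        (hg.injOn_uIcc hγl.le hγ'.le) rfl hγ hγ ?_ ?_ ?_ ?_ ?_ ?_
      · exact fun u hu => hfS u (hu.2.trans_lt (sup_lt_iff.2 ⟨hαt'.trans htf, htf⟩))
      · exact fun u hu => hgS u (hu.2.trans_lt (sup_lt_iff.2 ⟨hγl, hγ0.trans hγl⟩))
      · exact fun u hu => hgS u (hu.2.trans_lt (sup_lt_iff.2 ⟨hγl, hγ'⟩))
      · intro u hu hne v _ he
        rw [Set.uIcc_of_le hαt'.le] at hu
        exact hafter u (lt_of_le_of_ne hu.1 hne.symm) hu.2 ⟨v, he.symm⟩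
      · intro u hu hne v _ he
        rw [Set.uIcc_of_le hαt'.le] at hu
        exact hafter u (lt_of_le_of_ne hu.1 hne.symm) hu.2 ⟨v, he.symm⟩
      · intro u hu hne v hv he
        rw [Set.uIcc_of_ge hγ0.le] at hu
        rw [Set.uIcc_of_le hγγ'.le] at hv
        have := hg.injOn ⟨hu.1, hu.2.trans hγl.le⟩ ⟨unitInterval.nonneg', hv.2.trans hγ'.le⟩ he
        exact (lt_of_le_of_ne hu.2 hne).not_ge (this ▸ hv.1)
    obtain ⟨b, hb, hbf⟩ := exists_between hltf
    obtain ⟨α, hα, hαb, hαg⟩ := hA b hb hbf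
    obtain ⟨b', hb', hb'α⟩ := exists_between hα
    obtain ⟨α', hα', hαb', hαg'⟩ := hA b' hb' (hb'α.trans_le (hαb.trans hbf.le))
    have := hf.injOn ⟨unitInterval.nonneg', hαb.trans hbf.le⟩
      ⟨unitInterval.nonneg', hαb'.trans (hb'α.le.trans (hαb.trans hbf.le))⟩ (hαg.trans hαg'.symm)
    exact (hαb'.trans_lt hb'α).ne this.symm
  obtain ⟨b, hb, hbf, hbg⟩ := claim
  rcases eq_or_ne t₀ 0 with rfl | hne
  · exact ⟨b, hb, hbf, hbg⟩
  exfalso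
  obtain ⟨b', hb', hb'g⟩ := exists_between hltg
  refine hS.false_of_legs (c := f t₀) (f₁ := f) (f₂ := f) (f₃ := g) (a₁ := t₀) (b₁ := b)
    (a₂ := t₀) (b₂ := 0) (a₃ := t₀) (b₃ := b') hb.ne hne hb'.ne
    (hf.injOn_uIcc hltf.le hbf.le) (hf.injOn_uIcc hltf.le unitInterval.nonneg')
    (hg.injOn_uIcc hltg.le hb'g.le) rfl rfl (hagree' t₀ le_rfl).symm ?_ ?_ ?_ ?_ ?_ ?_
  · exact fun u hu => hfS u (hu.2.trans_lt (sup_lt_iff.2 ⟨hltf, hbf⟩))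
  · exact fun u hu => hfS u (hu.2.trans_lt (sup_lt_iff.2 ⟨hltf, unitInterval.nonneg'.trans_lt hltf⟩))
  · exact fun u hu => hgS u (hu.2.trans_lt (sup_lt_iff.2 ⟨hltg, hb'g⟩))
  · intro u hu hne v hv he
    rw [Set.uIcc_of_le hb.le] at hu
    rw [Set.uIcc_of_ge unitInterval.nonneg'] at hv
    exact hbg u (lt_of_le_of_ne hu.1 hne.symm) hu.2 ⟨v, by rw [← hagree' v hv.2, he]⟩
  · intro u hu hne v hv he
    rw [Set.uIcc_of_le hb.le] at hu
    exact hbg u (lt_of_le_of_ne hu.1 hne.symm) hu.2 ⟨v, he.symm⟩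
  · intro u hu hne v hv he
    rw [Set.uIcc_of_ge unitInterval.nonneg'] at hu
    rw [Set.uIcc_of_le hb'.le] at hv
    rw [hagree' u hu.2] at he
    have := hg.injOn ⟨hu.1, hu.2.trans hltg.le⟩ ⟨unitInterval.nonneg', hv.2.trans hb'g.le⟩ he
    exact (lt_of_le_of_ne hu.2 hne).not_ge (this ▸ hv.1)

/-- In a triod-free set there are at most two directions at each point. -/
theorem TriodFree.exists_range_subset {S : Set Plane} (hS : TriodFree S) {f g h : Curve}
    (hf : IsArcCode f) (hg : IsArcCode g) (hh : IsArcCode h) (hfg : f 0 = g 0) (hgh : g 0 = h 0)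
    (hfS : ∀ t < f.len, f t ∈ S) (hgS : ∀ t < g.len, g t ∈ S) (hhS : ∀ t < h.len, h t ∈ S) :
    (Set.range f ⊆ Set.range g ∨ Set.range g ⊆ Set.range f) ∨
    (Set.range g ⊆ Set.range h ∨ Set.range h ⊆ Set.range g) ∨
    (Set.range f ⊆ Set.range h ∨ Set.range h ⊆ Set.range f) := by
  rcases hS.trichotomy hf hg hfg hfS hgS with h1 | h1 | ⟨b₁, hb₁, hb₁l, h1⟩
  · exact Or.inl (Or.inl h1)
  · exact Or.inl (Or.inr h1)
  rcases hS.trichotomy hg hh hgh hgS hhS with h2 | h2 | ⟨b₂, hb₂, hb₂l, h2⟩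
  · exact Or.inr (Or.inl (Or.inl h2))
  · exact Or.inr (Or.inl (Or.inr h2))
  rcases hS.trichotomy hf hh (hfg.trans hgh) hfS hhS with h3 | h3 | ⟨b₃, hb₃, hb₃l, h3⟩
  · exact Or.inr (Or.inr (Or.inl h3))
  · exact Or.inr (Or.inr (Or.inr h3))
  by_cases hnh : Set.range h ⊆ Set.range g
  · exact Or.inr (Or.inl (Or.inr hnh))
  exfalso
  rcases (unitInterval.nonneg' (t := h.len)).eq_or_lt with hl | hl
  · refine hnh ?_
    rw [hh.range_eq, ← hl, Set.Icc_self]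
    rintro _ ⟨_, rfl, rfl⟩
    exact ⟨0, hgh⟩
  obtain ⟨b, hb, hbh⟩ := exists_between hl
  have hm : 0 < min b₁ b₃ := lt_min hb₁ hb₃
  refine hS.false_of_legs (c := f 0) (f₁ := f) (f₂ := g) (f₃ := h) (a₁ := 0) (b₁ := min b₁ b₃)
    (a₂ := 0) (b₂ := b₂) (a₃ := 0) (b₃ := b) hm.ne hb₂.ne hb.ne
    (hf.injOn_uIcc unitInterval.nonneg' ((min_le_left _ _).trans hb₁l.le))
    (hg.injOn_uIcc unitInterval.nonneg' hb₂l.le)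
    (hh.injOn_uIcc unitInterval.nonneg' hbh.le) rfl hfg.symm (hfg.trans hgh).symm ?_ ?_ ?_ ?_ ?_ ?_
  · exact fun u hu => hfS u (hu.2.trans_lt (sup_lt_iff.2
      ⟨unitInterval.nonneg'.trans_lt hb₁l, (min_le_left _ _).trans_lt hb₁l⟩))
  · exact fun u hu => hgS u (hu.2.trans_lt (sup_lt_iff.2 ⟨unitInterval.nonneg'.trans_lt hb₂l, hb₂l⟩))
  · exact fun u hu => hhS u (hu.2.trans_lt (sup_lt_iff.2 ⟨hl, hbh⟩))
  · intro u hu hne v _ he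
    rw [Set.uIcc_of_le unitInterval.nonneg'] at hu
    exact h1 u (unitInterval.pos_iff_ne_zero.2 hne) (hu.2.trans (min_le_left _ _)) ⟨v, he.symm⟩
  · intro u hu hne v _ he
    rw [Set.uIcc_of_le unitInterval.nonneg'] at hu
    exact h3 u (unitInterval.pos_iff_ne_zero.2 hne) (hu.2.trans (min_le_right _ _)) ⟨v, he.symm⟩
  · intro u hu hne v _ he
    rw [Set.uIcc_of_le unitInterval.nonneg'] at hu
    exact h2 u (unitInterval.pos_iff_ne_zero.2 hne) hu.2 ⟨v, he.symm⟩

/-! ### Concatenation and subarcs -/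

theorem hasMonotoneFibres_of_injective {f : Curve} (h : Function.Injective f) :
    HasMonotoneFibres f := by
  intro s t hst he u hu
  have := h he
  subst this
  rw [le_antisymm hu.2 hu.1]

theorem IsArcCode.hasMonotoneFibres {f : Curve} (hf : IsArcCode f) : HasMonotoneFibres f := by
  intro s t _ he u hu
  rw [hf.eq_iff] at he ⊢
  exact le_antisymm ((min_le_min_right _ hu.2).trans he.ge) (min_le_min_right _ hu.1)

theorem exists_isArcCode_of_injOn {f : Curve} {a b : unitInterval}
    (h : Set.InjOn f (Set.uIcc a b)) :
    ∃ g, IsArcCode g ∧ Set.range g = f '' Set.uIcc a b ∧ g 0 = f a ∧ g 1 = f b := by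
  let k : Curve := ⟨fun t => f (lerp a b t), f.continuous.comp (unitInterval.continuous_lerp a b)⟩
  have hk : HasMonotoneFibres k := by
    rcases eq_or_ne a b with rfl | hab
    · intro s t _ _ u _
      have : ∀ t, lerp a a t = a := fun t => by simpa using unitInterval.lerp_mem_uIcc a a t
      simp [k, this]
    · refine hasMonotoneFibres_of_injective fun s t hst => ?_
      exact unitInterval.lerp_injective hab
        (h (unitInterval.lerp_mem_uIcc _ _ _) (unitInterval.lerp_mem_uIcc _ _ _) hst)
  obtain ⟨g, hg, hr, h0, h1⟩ := hk.exists_isArcCode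
  refine ⟨g, hg, ?_, by simp [h0, k], by simp [h1, k]⟩
  rw [hr, ← unitInterval.range_lerp, ← Set.range_comp]
  rfl

/-- The concatenation of two curves. -/
noncomputable def Curve.append (f g : Curve) (h : f 1 = g 0) : Curve :=
  ((⟨f, rfl, h⟩ : Path (f 0) (g 0)).trans (⟨g, rfl, rfl⟩ : Path (g 0) (g 1))).toContinuousMap

namespace Curve

variable {f g : Curve} {h : f 1 = g 0}

theorem append_of_le {t : unitInterval} (ht : (t : ℝ) ≤ 1 / 2) :
    f.append g h t = f ⟨2 * t, (unitInterval.mul_pos_mem_iff zero_lt_two).2 ⟨t.2.1, ht⟩⟩ := by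
  change Path.trans _ _ t = _
  rw [Path.trans_apply, dif_pos ht]
  rfl

theorem append_of_ge {t : unitInterval} (ht : 1 / 2 ≤ (t : ℝ)) :
    f.append g h t = g ⟨2 * t - 1, unitInterval.two_mul_sub_one_mem_iff.2 ⟨ht, t.2.2⟩⟩ := by
  change Path.trans _ _ t = _
  rw [Path.trans_apply]
  split_ifs with h'
  · have : (t : ℝ) = 1 / 2 := le_antisymm h' ht
    simp only [this]
    norm_num
  · rfl

theorem append_zero : f.append g h 0 = f 0 := Path.source _

theorem append_one : f.append g h 1 = g 1 := Path.target _

theorem range_append : Set.range (f.append g h) = Set.range f ∪ Set.range g := Path.trans_range _ _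

end Curve

theorem HasMonotoneFibres.append {f g : Curve} (hf : HasMonotoneFibres f)
    (hg : HasMonotoneFibres g) (h : f 1 = g 0) (hd : ∀ s t, f s = g t → f s = f 1) :
    HasMonotoneFibres (f.append g h) := by
  have h1 : ∀ (s t u : unitInterval), s ≤ u → u ≤ t → (t : ℝ) ≤ 1 / 2 →
      f.append g h s = f.append g h t → f.append g h u = f.append g h s := by
    intro s t u hsu hut ht he
    have hsu' : (s : ℝ) ≤ u := hsu
    have hut' : (u : ℝ) ≤ t := hut
    rw [Curve.append_of_le ht, Curve.append_of_le (by linarith)] at he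
    rw [Curve.append_of_le (by linarith), Curve.append_of_le (by linarith)]
    refine hf _ _ ?_ he _ ⟨?_, ?_⟩ <;> rw [← Subtype.coe_le_coe] <;> simp only <;> linarith
  have h2 : ∀ (s t u : unitInterval), s ≤ u → u ≤ t → 1 / 2 ≤ (s : ℝ) →
      f.append g h s = f.append g h t → f.append g h u = f.append g h s := by
    intro s t u hsu hut ht he
    have hsu' : (s : ℝ) ≤ u := hsu
    have hut' : (u : ℝ) ≤ t := hut
    rw [Curve.append_of_ge ht, Curve.append_of_ge (by linarith)] at he
    rw [Curve.append_of_ge (by linarith), Curve.append_of_ge (by linarith)]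
    refine hg _ _ ?_ he _ ⟨?_, ?_⟩ <;> rw [← Subtype.coe_le_coe] <;> simp only <;> linarith
  intro s t hst he u hu
  rcases le_total (t : ℝ) (1 / 2) with ht | ht
  · exact h1 s t u hu.1 hu.2 ht he
  rcases le_total (1 / 2) (s : ℝ) with hs | hs
  · exact h2 s t u hu.1 hu.2 hs he
  let m : unitInterval := ⟨1 / 2, by norm_num, by norm_num⟩
  have hm : f.append g h m = f 1 := by
    rw [Curve.append_of_le (by simp [m])]
    congr 1
    ext
    simp [m]
  have hsm : f.append g h s = f 1 := by
    have := he
    rw [Curve.append_of_le hs, Curve.append_of_ge ht] at this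
    rw [Curve.append_of_le hs]
    exact hd _ _ this
  rcases le_total u m with hum | hum
  · exact h1 s m u hu.1 hum (by simp [m]) (hsm.trans hm.symm)
  · rw [h2 m t u hum hu.2 (by simp [m]) (by rw [hm, ← he, hsm]), hm, hsm]

theorem IsArcCode.exists_append {f g : Curve} (hf : IsArcCode f) (hg : IsArcCode g)
    (h : f 1 = g 0) (hd : ∀ s t, f s = g t → f s = f 1) :
    ∃ k, IsArcCode k ∧ Set.range k = Set.range f ∪ Set.range g ∧ k 0 = f 0 ∧ k 1 = g 1 := by
  obtain ⟨k, hk, hr, h0, h1⟩ :=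
    (hf.hasMonotoneFibres.append hg.hasMonotoneFibres h hd).exists_isArcCode
  exact ⟨k, hk, hr.trans Curve.range_append, h0.trans Curve.append_zero, h1.trans Curve.append_one⟩

theorem IsArcCode.len_eq_zero_of_eq {f : Curve} (hf : IsArcCode f) (h : f 0 = f 1) : f.len = 0 := by
  have := (hf.eq_iff 0 1).1 h
  rwa [min_eq_left unitInterval.nonneg', min_eq_right unitInterval.le_one', eq_comm] at this

theorem IsArcCode.apply_eq_of_len_eq_zero {f : Curve} (hf : IsArcCode f) (h : f.len = 0)
    (t : unitInterval) : f t = f 0 := by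
  rw [hf.eq_iff, h, min_eq_right unitInterval.nonneg', min_eq_right unitInterval.nonneg']

/-! ### Structure of triod-free components -/

/-- An arc leaving an interior point of another arc stays inside it. -/
theorem TriodFree.range_subset_of_mem {S : Set Plane} (hS : TriodFree S) {ψ k : Curve}
    {t₁ t₂ t₃ : unitInterval} (h₁₂ : t₁ < t₂) (h₂₃ : t₂ < t₃) (hψ : Set.InjOn ψ (Set.Icc t₁ t₃))
    (hψS : ∀ t ∈ Set.Icc t₁ t₃, ψ t ∈ S) (hk : IsArcCode k) (hkS : Set.range k ⊆ S)
    (hk0 : k 0 = ψ t₂) (hk₁ : ψ t₁ ∉ Set.range k) (hk₃ : ψ t₃ ∉ Set.range k) :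
    Set.range k ⊆ ψ '' Set.Icc t₁ t₃ := by
  rw [hk.range_eq]
  rintro _ ⟨s, hs, rfl⟩
  by_contra hns
  have hcl : IsClosed (ψ '' Set.Icc t₁ t₃) := (isCompact_Icc.image ψ.continuous).isClosed
  obtain ⟨α, -, hαs, ⟨u, hu, hut⟩, hafter⟩ := exists_last_le k.continuous hcl
    (unitInterval.nonneg' (t := s)) (by rw [hk0]; exact ⟨t₂, ⟨h₁₂.le, h₂₃.le⟩, rfl⟩)
  have hαs' : α < s := lt_of_le_of_ne hαs (by rintro rfl; exact hns ⟨u, hu, hut⟩)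
  have hu₁ : t₁ < u := lt_of_le_of_ne hu.1 (by rintro rfl; exact hk₁ ⟨α, hut.symm⟩)
  have hu₃ : u < t₃ := lt_of_le_of_ne hu.2 (by rintro rfl; exact hk₃ ⟨α, hut.symm⟩)
  refine hS.false_of_legs (c := k α) (f₁ := k) (f₂ := ψ) (f₃ := ψ) (a₁ := α) (b₁ := s)
    (a₂ := u) (b₂ := t₁) (a₃ := u) (b₃ := t₃) hαs'.ne hu₁.ne' hu₃.ne
    (hk.injOn_uIcc (hαs.trans hs.2) hs.2) ?_ ?_ rfl hut hut (fun u _ => hkS ⟨u, rfl⟩) ?_ ?_ ?_ ?_ ?_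
  · rw [Set.uIcc_of_ge hu₁.le]
    exact hψ.mono (Set.Icc_subset_Icc le_rfl hu.2)
  · rw [Set.uIcc_of_le hu₃.le]
    exact hψ.mono (Set.Icc_subset_Icc hu.1 le_rfl)
  · rw [Set.uIcc_of_ge hu₁.le]
    exact fun v hv => hψS v ⟨hv.1, hv.2.trans hu.2⟩
  · rw [Set.uIcc_of_le hu₃.le]
    exact fun v hv => hψS v ⟨hu.1.trans hv.1, hv.2⟩
  · intro v hv hne w hw he
    rw [Set.uIcc_of_le hαs] at hv
    rw [Set.uIcc_of_ge hu₁.le] at hw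
    exact hafter v (lt_of_le_of_ne hv.1 hne.symm) hv.2 ⟨w, ⟨hw.1, hw.2.trans hu.2⟩, he.symm⟩
  · intro v hv hne w hw he
    rw [Set.uIcc_of_le hαs] at hv
    rw [Set.uIcc_of_le hu₃.le] at hw
    exact hafter v (lt_of_le_of_ne hv.1 hne.symm) hv.2 ⟨w, ⟨hu.1.trans hw.1, hw.2⟩, he.symm⟩
  · intro v hv hne w hw he
    rw [Set.uIcc_of_ge hu₁.le] at hv
    rw [Set.uIcc_of_le hu₃.le] at hw
    have := hψ ⟨hv.1, hv.2.trans hu.2⟩ ⟨hu.1.trans hw.1, hw.2⟩ he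
    exact (lt_of_le_of_ne hv.2 hne).not_ge (this ▸ hw.1)

/-- A simple closed curve. -/
def IsCircle (ψ : Curve) : Prop := ψ 0 = ψ 1 ∧ Set.InjOn ψ (Set.Iio 1)

theorem IsCircle.injOn_uIcc {ψ : Curve} (h : IsCircle ψ) {a b : unitInterval} (ha : 0 < a)
    (hb : 0 < b) : Set.InjOn ψ (Set.uIcc a b) := by
  have h0 : ∀ s t, 0 < s → s < t → ψ s ≠ ψ t := by
    intro s t hs hst he
    rcases (unitInterval.le_one' (t := t)).eq_or_lt with rfl | ht
    · rw [← h.1] at he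
      exact hs.ne' (h.2 hst (zero_lt_one' unitInterval) he)
    · exact hst.ne (h.2 (hst.trans ht) ht he)
  intro s hs t ht he
  have hs0 : 0 < s := (lt_inf_iff.2 ⟨ha, hb⟩).trans_le hs.1
  have ht0 : 0 < t := (lt_inf_iff.2 ⟨ha, hb⟩).trans_le ht.1
  rcases lt_trichotomy s t with h' | h' | h'
  · exact absurd he (h0 s t hs0 h')
  · exact h'
  · exact absurd he.symm (h0 t s ht0 h')

theorem exists_isCircle {f g : Curve} (hf : IsArcCode f) (hg : IsArcCode g) (h0 : f 0 = g 0)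
    (h1 : f 1 = g 1) (hne : f ≠ g) :
    ∃ ψ, IsCircle ψ ∧ Set.range ψ ⊆ Set.range f ∪ Set.range g := by
  have hnr : ¬ Set.range f ⊆ Set.range g := by
    intro hr
    obtain ⟨h2, h3⟩ := hf.initial_segment hg h0 hr
    have h4 : g f.len = g g.len := by
      rw [hg.apply_len, ← h1, h3 1, min_eq_right unitInterval.le_one']
    have h5 := hg.injOn ⟨unitInterval.nonneg', h2⟩ ⟨unitInterval.nonneg', le_rfl⟩ h4
    exact hne (by ext1 t; rw [h3, h5, hg.apply_min])
  rw [hf.range_eq] at hnr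
  obtain ⟨_, ⟨s, hs, rfl⟩, hsg⟩ := Set.not_subset.1 hnr
  obtain ⟨a, -, has, ⟨c, hc⟩, ha⟩ := exists_last_le f.continuous g.isClosed_range hs.1 ⟨0, h0.symm⟩
  obtain ⟨b, hsb, hbl, ⟨d, hd⟩, hb⟩ := exists_first_ge f.continuous g.isClosed_range hs.2
    ⟨1, by rw [hf.apply_len, h1]⟩
  have has' : a < s := lt_of_le_of_ne has (by rintro rfl; exact hsg ⟨c, hc⟩)
  have hsb' : s < b := lt_of_le_of_ne hsb (by rintro rfl; exact hsg ⟨d, hd⟩)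
  have hout : ∀ u, a < u → u < b → f u ∉ Set.range g := fun u hau hub => by
    rcases le_total u s with h | h
    exacts [ha u hau h, hb u h hub]
  have hfinj := hf.injOn_uIcc ((has'.trans hsb').le.trans hbl) hbl
  rw [Set.uIcc_of_le (has'.trans hsb').le] at hfinj
  have hab : f a ≠ f b := fun h => (has'.trans hsb').ne
    (hfinj ⟨le_rfl, (has'.trans hsb').le⟩ ⟨(has'.trans hsb').le, le_rfl⟩ h)
  rw [← hg.apply_min] at hc hd
  have hcd : min d g.len ≠ min c g.len := fun h => hab (by rw [← hc, ← hd, h])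
  set c' := min c g.len
  set d' := min d g.len
  have hginj := hg.injOn_uIcc (a := d') (b := c') (min_le_right _ _) (min_le_right _ _)
  let F : Curve := ⟨fun t => f (lerp a b t), f.continuous.comp (unitInterval.continuous_lerp a b)⟩
  let G : Curve := ⟨fun t => g (lerp d' c' t), g.continuous.comp (unitInterval.continuous_lerp d' c')⟩
  have hFm : ∀ t, lerp a b t ∈ Set.Icc a b := fun t => by
    have := unitInterval.lerp_mem_uIcc a b t
    rwa [Set.uIcc_of_le (has'.trans hsb').le] at this
  have hF : Function.Injective F := fun s t hst =>
    unitInterval.lerp_injective (has'.trans hsb').ne (hfinj (hFm _) (hFm _) hst)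
  have hG : Function.Injective G := fun s t hst =>
    unitInterval.lerp_injective hcd
      (hginj (unitInterval.lerp_mem_uIcc _ _ _) (unitInterval.lerp_mem_uIcc _ _ _) hst)
  have hFG : ∀ s t, F s = G t → (s = 0 ∧ t = 1) ∨ (s = 1 ∧ t = 0) := by
    intro s t hst
    have hmem : f (lerp a b s) ∈ Set.range g := ⟨_, hst.symm⟩
    rcases (hFm s).1.eq_or_lt with h | h
    · have hs : s = 0 := unitInterval.lerp_injective (has'.trans hsb').ne (by simp [← h])
      refine Or.inl ⟨hs, hG ?_⟩
      rw [← hst, hs]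
      simp [F, G, hc]
    rcases (hFm s).2.eq_or_lt with h' | h'
    · have hs : s = 1 := unitInterval.lerp_injective (has'.trans hsb').ne (by simp [h'])
      refine Or.inr ⟨hs, hG ?_⟩
      rw [← hst, hs]
      simp [F, G, hd]
    · exact absurd hmem (hout _ h h')
  have hjoin : F 1 = G 0 := by simp [F, G, hd]
  refine ⟨F.append G hjoin, ⟨?_, ?_⟩, ?_⟩
  · rw [Curve.append_zero, Curve.append_one]
    simp [F, G, hc]
  · have key : ∀ s t : unitInterval, s < 1 → t < 1 → s < t →
        F.append G hjoin s ≠ F.append G hjoin t := by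
      intro s t hs1 ht1 hst he
      have hst' : (s : ℝ) < t := hst
      have ht1' : (t : ℝ) < 1 := ht1
      rcases le_or_gt (t : ℝ) (1 / 2) with ht | ht
      · rw [Curve.append_of_le ht, Curve.append_of_le (by linarith)] at he
        have := congrArg Subtype.val (hF he)
        simp at this
        linarith
      rcases le_or_gt (1 / 2) (s : ℝ) with hs | hs
      · rw [Curve.append_of_ge ht.le, Curve.append_of_ge hs] at he
        have := congrArg Subtype.val (hG he)
        simp at this
        linarith
      · rw [Curve.append_of_ge ht.le, Curve.append_of_le hs.le] at he
        rcases hFG _ _ he with ⟨-, h⟩ | ⟨h, -⟩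
        · have := congrArg Subtype.val h
          simp at this
          linarith
        · have := congrArg Subtype.val h
          simp at this
          linarith
    intro s hs t ht he
    rcases lt_trichotomy s t with h' | h' | h'
    · exact absurd he (key s t hs ht h')
    · exact h'
    · exact absurd he.symm (key t s ht hs h')
  · rw [Curve.range_append]
    refine Set.union_subset_union ?_ ?_
    · rintro _ ⟨t, rfl⟩; exact ⟨_, rfl⟩
    · rintro _ ⟨t, rfl⟩; exact ⟨_, rfl⟩

theorem IsCircle.image_Iio {ψ : Curve} (h : IsCircle ψ) : ψ '' Set.Iio 1 = Set.range ψ := by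
  refine Set.Subset.antisymm (Set.image_subset_range _ _) ?_
  rintro _ ⟨t, rfl⟩
  rcases (unitInterval.le_one' (t := t)).eq_or_lt with rfl | ht
  · exact ⟨0, zero_lt_one' unitInterval, h.1⟩
  · exact ⟨t, ht, rfl⟩

theorem IsCircle.mem_range_of_joinedIn {S : Set Plane} (hS : TriodFree S) {ψ : Curve}
    (h : IsCircle ψ) (hψS : Set.range ψ ⊆ S) {y : Plane} (hy : JoinedIn S (ψ 0) y) :
    y ∈ Set.range ψ := by
  obtain ⟨k, hk, hkS, hk0, hk1⟩ := hy.exists_isArcCode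
  by_contra hyn
  rw [← hk1, ← hk.apply_len] at hyn
  obtain ⟨α, -, hαs, hα, hafter⟩ := exists_last_le k.continuous ψ.isClosed_range
    (unitInterval.nonneg' (t := k.len)) (by rw [hk0]; exact ⟨0, rfl⟩)
  rw [← h.image_Iio] at hα
  obtain ⟨u, hu, huα⟩ := hα
  have hαs' : α < k.len := lt_of_le_of_ne hαs (by
    rintro rfl; exact hyn ⟨u, huα⟩)
  obtain ⟨b₂, b₃, a₂, a₃, h₂, h₃, e₂, e₃, i₂, i₃, hd⟩ : ∃ b₂ b₃ a₂ a₃ : unitInterval,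
      a₂ ≠ b₂ ∧ a₃ ≠ b₃ ∧ ψ a₂ = k α ∧ ψ a₃ = k α ∧ Set.InjOn ψ (Set.uIcc a₂ b₂) ∧
      Set.InjOn ψ (Set.uIcc a₃ b₃) ∧
      ∀ v ∈ Set.uIcc a₂ b₂, v ≠ a₂ → ∀ w ∈ Set.uIcc a₃ b₃, ψ v ≠ ψ w := by
    rcases (unitInterval.nonneg' (t := u)).eq_or_lt with rfl | hu0
    · obtain ⟨m, hm0, hm1⟩ := exists_between (zero_lt_one' unitInterval)
      obtain ⟨n, hmn, hn1⟩ := exists_between hm1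
      refine ⟨m, n, 0, 1, hm0.ne, hn1.ne', huα, h.1.symm.trans huα, ?_,
        h.injOn_uIcc (zero_lt_one' unitInterval) (hm0.trans hmn), ?_⟩
      · rw [Set.uIcc_of_le hm0.le]
        exact h.2.mono fun v hv => hv.2.trans_lt hm1
      · intro v hv hne w hw he
        rw [Set.uIcc_of_le hm0.le] at hv
        rw [Set.uIcc_of_ge hn1.le] at hw
        have hv0 : 0 < v := unitInterval.pos_iff_ne_zero.2 hne
        have := h.injOn_uIcc hv0 ((hm0.trans hmn).trans_le hw.1) Set.left_mem_uIcc
          Set.right_mem_uIcc he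
        exact (hv.2.trans_lt (hmn.trans_le hw.1)).ne this
    · obtain ⟨n, hun, hn1⟩ := exists_between (show u < 1 from hu)
      refine ⟨0, n, u, u, hu0.ne', hun.ne, huα, huα, ?_, h.injOn_uIcc hu0 (hu0.trans hun), ?_⟩
      · rw [Set.uIcc_of_ge hu0.le]
        exact h.2.mono fun v hv => hv.2.trans_lt hu
      · intro v hv hne w hw he
        rw [Set.uIcc_of_ge hu0.le] at hv
        rw [Set.uIcc_of_le hun.le] at hw
        have := h.2 (hv.2.trans_lt hu) (hw.2.trans_lt hn1) he
        exact (lt_of_le_of_ne hv.2 hne).not_ge (this ▸ hw.1)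
  refine hS.false_of_legs hαs'.ne h₂ h₃ (hk.injOn_uIcc hαs le_rfl) i₂ i₃ rfl e₂ e₃
    (fun v _ => hkS ⟨v, rfl⟩) (fun v _ => hψS ⟨v, rfl⟩) (fun v _ => hψS ⟨v, rfl⟩) ?_ ?_ hd
  · intro v hv hne w _ he
    rw [Set.uIcc_of_le hαs] at hv
    exact hafter v (lt_of_le_of_ne hv.1 hne.symm) hv.2 ⟨w, he.symm⟩
  · intro v hv hne w _ he
    rw [Set.uIcc_of_le hαs] at hv
    exact hafter v (lt_of_le_of_ne hv.1 hne.symm) hv.2 ⟨w, he.symm⟩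

/-! ### Parametrization of triod-free components -/

/-- Two sets are comparable for inclusion. -/
def RangesComparable (f g : Curve) : Prop :=
  Set.range f ⊆ Set.range g ∨ Set.range g ⊆ Set.range f

theorem RangesComparable.symm {f g : Curve} (h : RangesComparable f g) : RangesComparable g f :=
  Or.symm h

theorem IsArcCode.eq_of_comparable {f g : Curve} (hf : IsArcCode f) (hg : IsArcCode g)
    (h0 : f 0 = g 0) (hc : RangesComparable f g) (hl : f.len = g.len) : f = g := by
  rcases hc with h | h
  · ext1 t
    rw [(hf.initial_segment hg h0 h).2, hl, hg.apply_min]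
  · ext1 t
    rw [(hg.initial_segment hf h0.symm h).2, ← hl, hf.apply_min]

theorem TriodFree.comparable_trans {S : Set Plane} (hS : TriodFree S) {f g h : Curve}
    (hf : IsArcCode f) (hg : IsArcCode g) (hh : IsArcCode h) (hfg : f 0 = g 0) (hgh : g 0 = h 0)
    (hfS : Set.range f ⊆ S) (hhS : Set.range h ⊆ S) (hl : 0 < g.len)
    (h₁ : RangesComparable f g) (h₂ : RangesComparable g h) : RangesComparable f h := by
  rcases h₁ with h₁ | h₁ <;> rcases h₂ with h₂ | h₂
  · exact Or.inl (h₁.trans h₂)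
  · obtain ⟨-, h3⟩ := hf.initial_segment hg hfg h₁
    obtain ⟨-, h4⟩ := hh.initial_segment hg hgh.symm h₂
    rcases le_total f.len h.len with h' | h'
    · left
      rintro _ ⟨t, rfl⟩
      exact ⟨min t f.len, by rw [h3, h4, min_eq_left ((min_le_right _ _).trans h')]⟩
    · right
      rintro _ ⟨t, rfl⟩
      exact ⟨min t h.len, by rw [h3, h4, min_eq_left ((min_le_right _ _).trans h')]⟩
  · rcases hS.trichotomy hf hh (hfg.trans hgh) (fun t _ => hfS ⟨t, rfl⟩)
      (fun t _ => hhS ⟨t, rfl⟩) with h | h | ⟨b, hb, -, hbh⟩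
    · exact Or.inl h
    · exact Or.inr h
    · obtain ⟨-, h3⟩ := hg.initial_segment hf hfg.symm h₁
      refine absurd (h₂ ⟨min b g.len, rfl⟩) ?_
      rw [h3, min_eq_left (min_le_right _ _)]
      exact hbh _ (lt_min hb hl) (min_le_left _ _)
  · exact Or.inr (h₂.trans h₁)

theorem continuousOn_of_Icc {X : Type*} [TopologicalSpace X] {φ : ℝ → X} {K : Set ℝ}
    (h : ∀ a ∈ K, ∀ b ∈ K, ContinuousOn φ (Set.Icc a b)) : ContinuousOn φ K := by
  intro r hr
  have h1 : ContinuousWithinAt φ (K ∩ Set.Ici r) r := by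
    by_cases hex : ∃ b ∈ K, r < b
    · obtain ⟨b, hb, hrb⟩ := hex
      refine ContinuousWithinAt.mono ?_ Set.inter_subset_right
      exact ((h r hr b hb) r ⟨le_rfl, hrb.le⟩).mono_of_mem_nhdsWithin (Icc_mem_nhdsGE hrb)
    · refine (continuousWithinAt_singleton (f := φ) (x := r)).mono fun s hs => ?_
      by_contra hne
      exact hex ⟨s, hs.1, lt_of_le_of_ne hs.2 (Ne.symm hne)⟩
  have h2 : ContinuousWithinAt φ (K ∩ Set.Iic r) r := by
    by_cases hex : ∃ b ∈ K, b < r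
    · obtain ⟨b, hb, hrb⟩ := hex
      refine ContinuousWithinAt.mono ?_ Set.inter_subset_right
      exact ((h b hb r hr) r ⟨hrb.le, le_rfl⟩).mono_of_mem_nhdsWithin (Icc_mem_nhdsLE hrb)
    · refine (continuousWithinAt_singleton (f := φ) (x := r)).mono fun s hs => ?_
      by_contra hne
      exact hex ⟨s, hs.1, lt_of_le_of_ne hs.2 hne⟩
  refine (h1.union h2).mono fun s hs => ?_
  rcases le_total r s with h | h
  exacts [Or.inl ⟨hs, h⟩, Or.inr ⟨hs, h⟩]

/-- A parametrization of the path component of `x` in `S` by an interval, for which arcs are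
images of subintervals. -/
structure IsLineParam (S : Set Plane) (x : Plane) (K : Set ℝ) (φ : ℝ → Plane) : Prop where
  ordConnected : K.OrdConnected
  continuousOn : ContinuousOn φ K
  injOn : Set.InjOn φ K
  image_eq : φ '' K = {y | JoinedIn S x y}
  range_eq : ∀ a ∈ K, ∀ b ∈ K, ∀ f : Curve, IsArcCode f → Set.range f ⊆ S → f 0 = φ a → f 1 = φ b →
    Set.range f = φ '' Set.uIcc a b

theorem TriodFree.exists_isLineParam {S : Set Plane} (hS : TriodFree S) {x : Plane} (hx : x ∈ S)
    (huniq : ∀ f g : Curve, IsArcCode f → IsArcCode g → Set.range f ⊆ S → Set.range g ⊆ S →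
      JoinedIn S x (f 0) → f 0 = g 0 → f 1 = g 1 → f = g) : ∃ K φ, IsLineParam S x K φ := by
  have hxx : JoinedIn S x x := JoinedIn.refl hx
  have hex : ∀ y, JoinedIn S x y → ∃ f : Curve, IsArcCode f ∧ Set.range f ⊆ S ∧ f 0 = x ∧ f 1 = y :=
    fun y hy => hy.exists_isArcCode
  choose! a ha using hex
  have hau : ∀ y, JoinedIn S x y → ∀ f : Curve, IsArcCode f → Set.range f ⊆ S → f 0 = x → f 1 = y →
      f = a y := by
    intro y hy f hf hfS h0 h1
    obtain ⟨h2, h3, h4, h5⟩ := ha y hy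
    exact huniq _ _ hf h2 hfS h3 (h0 ▸ hxx) (h0.trans h4.symm) (h1.trans h5.symm)
  have hlen0 : ∀ y, JoinedIn S x y → (a y).len = 0 → y = x := by
    intro y hy h
    obtain ⟨h2, h3, h4, h5⟩ := ha y hy
    rw [← h5, h2.apply_eq_of_len_eq_zero h, h4]
  have hseg : ∀ y, JoinedIn S x y → ∀ t ≤ (a y).len, JoinedIn S x (a y t) ∧
      a (a y t) = (a y).trunc t ∧ (a (a y t)).len = t := by
    intro y hy t ht
    obtain ⟨h2, h3, h4, h5⟩ := ha y hy
    have hj : JoinedIn S x (a y t) := by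
      have := (joinedIn_range (a y) 0 t).mono h3
      rwa [h4] at this
    obtain ⟨h6, h7⟩ := h2.trunc t
    have h8 : (a y).trunc t = a (a y t) := by
      refine hau _ hj _ h6 ?_ (by simp [Curve.trunc_apply, h4])
        (by rw [Curve.trunc_apply, min_eq_right unitInterval.le_one'])
      rw [Curve.trunc_range]
      exact (Set.image_subset_range _ _).trans h3
    refine ⟨hj, h8.symm, ?_⟩
    rw [← h8, h7, min_eq_left ht]
  have hpos : ∀ y, JoinedIn S x y → y ≠ x → 0 < (a y).len := fun y hy hne =>
    unitInterval.pos_iff_ne_zero.2 fun h => hne (hlen0 y hy h)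
  obtain ⟨p, hp, hpx⟩ : ∃ p, JoinedIn S x p ∧ ((∀ y, JoinedIn S x y → y = x) ∨ p ≠ x) := by
    by_cases h : ∀ y, JoinedIn S x y → y = x
    · exact ⟨x, hxx, Or.inl h⟩
    · push Not at h
      obtain ⟨p, hp, hpx⟩ := h
      exact ⟨p, hp, Or.inr hpx⟩
  have htrans : ∀ y y' z, JoinedIn S x y → JoinedIn S x y' → JoinedIn S x z → y' ≠ x →
      RangesComparable (a y) (a y') → RangesComparable (a y') (a z) →
      RangesComparable (a y) (a z) := by
    intro y y' z hy hy' hz hne h1 h2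
    exact hS.comparable_trans (ha y hy).1 (ha y' hy').1 (ha z hz).1
      ((ha y hy).2.2.1.trans (ha y' hy').2.2.1.symm) ((ha y' hy').2.2.1.trans (ha z hz).2.2.1.symm)
      (ha y hy).2.1 (ha z hz).2.1 (hpos y' hy' hne) h1 h2
  let σ : Plane → Prop := fun y => RangesComparable (a y) (a p)
  have hcomp : ∀ y y', JoinedIn S x y → JoinedIn S x y' → (σ y ↔ σ y') →
      RangesComparable (a y) (a y') := by
    intro y y' hy hy' hσ
    rcases hpx with h | hpx
    · rw [h y hy, h y' hy']
      exact Or.inl le_rfl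
    by_cases h : σ y
    · exact htrans y p y' hy hp hy' hpx h (hσ.1 h).symm
    · rcases hS.exists_range_subset (ha y hy).1 (ha p hp).1 (ha y' hy').1
        ((ha y hy).2.2.1.trans (ha p hp).2.2.1.symm) ((ha p hp).2.2.1.trans (ha y' hy').2.2.1.symm)
        (fun t _ => (ha y hy).2.1 ⟨t, rfl⟩) (fun t _ => (ha p hp).2.1 ⟨t, rfl⟩)
        (fun t _ => (ha y' hy').2.1 ⟨t, rfl⟩) with h1 | h1 | h1
      · exact absurd h1 h
      · exact absurd (Or.symm h1) (fun h2 => h (hσ.2 h2))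
      · exact h1
  classical
  let lam : Plane → ℝ := fun y => if σ y then ((a y).len : ℝ) else -((a y).len : ℝ)
  have hlam : Set.InjOn lam {y | JoinedIn S x y} := by
    intro y hy y' hy' he
    by_cases hσ : σ y ↔ σ y'
    · have hl : (a y).len = (a y').len := by
        ext
        by_cases h : σ y
        · simpa [lam, h, hσ.1 h] using he
        · simpa [lam, h, mt hσ.2 h] using he
      have := (ha y hy).1.eq_of_comparable (ha y' hy').1
        ((ha y hy).2.2.1.trans (ha y' hy').2.2.1.symm) (hcomp y y' hy hy' hσ) hl
      rw [← (ha y hy).2.2.2, ← (ha y' hy').2.2.2, this]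
    · have h0 := (a y).len.2.1
      have h0' := (a y').len.2.1
      have : (a y).len = 0 ∧ (a y').len = 0 := by
        by_cases h : σ y <;> by_cases h' : σ y' <;> simp [lam, h, h'] at he hσ <;>
          constructor <;> refine Subtype.ext ?_ <;> change _ = (0 : ℝ) <;> linarith
      rw [hlen0 y hy this.1, hlen0 y' hy' this.2]
  let K : Set ℝ := lam '' {y | JoinedIn S x y}
  let φ : ℝ → Plane := Function.invFunOn lam {y | JoinedIn S x y}
  have hφ : ∀ y, JoinedIn S x y → φ (lam y) = y := fun y hy =>
    hlam.leftInvOn_invFunOn hy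
  have hseglam : ∀ y, JoinedIn S x y → ∀ t ≤ (a y).len,
      lam (a y t) = if σ y then (t : ℝ) else -t := by
    intro y hy t ht
    obtain ⟨h1, h2, h3⟩ := hseg y hy t ht
    rcases eq_or_ne t 0 with rfl | ht0
    · simp [lam, h3]
    have hz : a y t ≠ x := by
      intro h
      have h4 := (ha y hy).1.injOn ⟨unitInterval.nonneg', ht⟩
        ⟨le_rfl, unitInterval.nonneg'⟩ (h.trans (ha y hy).2.2.1.symm)
      exact ht0 h4
    have hy0 : y ≠ x := by
      rintro rfl
      have := (ha y hy).1.len_eq_zero_of_eq ((ha y hy).2.2.1.trans (ha y hy).2.2.2.symm)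
      exact ht0 (le_antisymm (this ▸ ht) unitInterval.nonneg')
    have hc : RangesComparable (a (a y t)) (a y) := by
      left
      rw [h2, Curve.trunc_range]
      exact Set.image_subset_range _ _
    have hσ : σ (a y t) ↔ σ y :=
      ⟨fun h => htrans _ _ _ hy h1 hp hz hc.symm h, fun h => htrans _ _ _ h1 hy hp hy0 hc h⟩
    simp only [lam, hσ, h3]
  have hlocal : ∀ r ∈ K, Set.uIcc 0 r ⊆ K ∧ ContinuousOn φ (Set.uIcc 0 r) := by
    rintro _ ⟨y, hy, rfl⟩
    have hl0 := (a y).len.2.1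
    by_cases hσ : σ y
    · have hly : lam y = (a y).len := by simp [lam, hσ]
      rw [hly, Set.uIcc_of_le hl0]
      have hmem : ∀ s ∈ Set.Icc (0 : ℝ) (a y).len, s ∈ K ∧
          φ s = a y (Set.projIcc 0 1 zero_le_one s) := by
        intro s hs
        have hs' : Set.projIcc (0 : ℝ) 1 zero_le_one s = ⟨s, hs.1, hs.2.trans (a y).len.2.2⟩ :=
          Set.projIcc_of_mem zero_le_one _
        rw [hs']
        have h1 := hseglam y hy ⟨s, hs.1, hs.2.trans (a y).len.2.2⟩ hs.2
        rw [if_pos hσ] at h1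
        have h2 := (hseg y hy ⟨s, hs.1, hs.2.trans (a y).len.2.2⟩ hs.2).1
        exact ⟨⟨_, h2, h1⟩, by rw [← hφ _ h2, h1]⟩
      refine ⟨fun s hs => (hmem s hs).1, ContinuousOn.congr ?_ fun s hs => (hmem s hs).2⟩
      exact ((a y).continuous.comp continuous_projIcc).continuousOn
    · have hly : lam y = -(a y).len := by simp [lam, hσ]
      rw [hly, Set.uIcc_of_ge (by linarith)]
      have hmem : ∀ s ∈ Set.Icc (-((a y).len : ℝ)) 0, s ∈ K ∧
          φ s = a y (Set.projIcc 0 1 zero_le_one (-s)) := by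
        intro s hs
        have hs1 : 0 ≤ -s := by linarith [hs.2]
        have hs2 : -s ≤ (a y).len := by linarith [hs.1]
        have hs' : Set.projIcc (0 : ℝ) 1 zero_le_one (-s) = ⟨-s, hs1, hs2.trans (a y).len.2.2⟩ :=
          Set.projIcc_of_mem zero_le_one _
        rw [hs']
        have h1 := hseglam y hy ⟨-s, hs1, hs2.trans (a y).len.2.2⟩ hs2
        rw [if_neg hσ, neg_neg] at h1
        have h2 := (hseg y hy ⟨-s, hs1, hs2.trans (a y).len.2.2⟩ hs2).1
        exact ⟨⟨_, h2, h1⟩, by rw [← hφ _ h2, h1]⟩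
      refine ⟨fun s hs => (hmem s hs).1, ContinuousOn.congr ?_ fun s hs => (hmem s hs).2⟩
      exact ((a y).continuous.comp (continuous_projIcc.comp continuous_neg)).continuousOn
  have hIcc : ∀ r ∈ K, ∀ s ∈ K, Set.uIcc r s ⊆ K ∧ ContinuousOn φ (Set.uIcc r s) := by
    intro r hr s hs
    have hsub : Set.uIcc r s ⊆ Set.uIcc 0 r ∪ Set.uIcc 0 s := by
      rw [Set.uIcc_comm 0 r]
      exact Set.uIcc_subset_uIcc_union_uIcc
    have hc : ContinuousOn φ (Set.uIcc 0 r ∪ Set.uIcc 0 s) :=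
      (hlocal r hr).2.union_of_isClosed (hlocal s hs).2 isClosed_Icc isClosed_Icc
    exact ⟨hsub.trans (Set.union_subset (hlocal r hr).1 (hlocal s hs).1), hc.mono hsub⟩
  have hinj : Set.InjOn φ K := by
    rintro _ ⟨y, hy, rfl⟩ _ ⟨y', hy', rfl⟩ he
    rw [hφ y hy, hφ y' hy'] at he
    rw [he]
  have himg : φ '' K = {y | JoinedIn S x y} := by
    ext y
    constructor
    · rintro ⟨_, ⟨z, hz, rfl⟩, rfl⟩
      rwa [hφ z hz]
    · exact fun hy => ⟨_, ⟨y, hy, rfl⟩, hφ y hy⟩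
  refine ⟨K, φ, ⟨?_, continuousOn_of_Icc fun r hr s hs => (hIcc r hr s hs).2.mono
    Set.Icc_subset_uIcc, hinj, himg, ?_⟩⟩
  · rw [Set.ordConnected_iff_uIcc_subset]
    exact fun r hr s hs => (hIcc r hr s hs).1
  · intro r hr s hs f hf hfS h0 h1
    obtain ⟨hsub, hcont⟩ := hIcc r hr s hs
    have hm : ∀ t : unitInterval, AffineMap.lineMap r s (t : ℝ) ∈ Set.uIcc r s := fun t => by
      rw [← segment_eq_uIcc, segment_eq_image_lineMap]
      exact ⟨t, t.2, rfl⟩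
    let k : Curve := ⟨fun t => φ (AffineMap.lineMap r s (t : ℝ)),
      hcont.comp_continuous (AffineMap.lineMap_continuous.comp continuous_subtype_val) hm⟩
    have hkr : Set.range k = φ '' Set.uIcc r s := by
      rw [← segment_eq_uIcc, segment_eq_image_lineMap, Set.image_image]
      ext z
      constructor
      · rintro ⟨t, rfl⟩; exact ⟨t, t.2, rfl⟩
      · rintro ⟨t, ht, rfl⟩; exact ⟨⟨t, ht⟩, rfl⟩
    have hk : HasMonotoneFibres k := by
      rcases eq_or_ne r s with rfl | hrs
      · intro u v _ _ w _
        simp [k]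
      · refine hasMonotoneFibres_of_injective fun u v huv => ?_
        have := hinj (hsub (hm u)) (hsub (hm v)) huv
        exact Subtype.ext (AffineMap.lineMap_injective ℝ hrs this)
    obtain ⟨g, hg, hgr, hg0, hg1⟩ := hk.exists_isArcCode
    have hgS : Set.range g ⊆ S := by
      rw [hgr, hkr]
      rintro _ ⟨t, ht, rfl⟩
      have : φ t ∈ φ '' K := ⟨t, hsub ht, rfl⟩
      rw [himg] at this
      exact JoinedIn.target_mem this
    have hjr : JoinedIn S x (f 0) := by
      have : φ r ∈ φ '' K := ⟨r, hr, rfl⟩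
      rw [himg] at this
      rw [h0]
      exact this
    have : f = g := huniq f g hf hg hfS hgS hjr (by rw [h0, hg0]; simp [k])
      (by rw [h1, hg1]; simp [k])
    rw [this, hgr, hkr]

/-- A path component of a triod-free set is a simple closed curve or an injective image of an
interval. -/
theorem TriodFree.circle_or_line {S : Set Plane} (hS : TriodFree S) {x : Plane} (hx : x ∈ S) :
    (∃ ψ : Curve, IsCircle ψ ∧ Set.range ψ = {y | JoinedIn S x y}) ∨
      ∃ K φ, IsLineParam S x K φ := by
  by_cases huniq : ∀ f g : Curve, IsArcCode f → IsArcCode g → Set.range f ⊆ S → Set.range g ⊆ S →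
      JoinedIn S x (f 0) → f 0 = g 0 → f 1 = g 1 → f = g
  · exact Or.inr (hS.exists_isLineParam hx huniq)
  · push Not at huniq
    obtain ⟨f, g, hf, hg, hfS, hgS, hxf, h0, h1, hne⟩ := huniq
    obtain ⟨ψ, hψ, hr⟩ := exists_isCircle hf hg h0 h1 hne
    have hψS : Set.range ψ ⊆ S := hr.trans (Set.union_subset hfS hgS)
    have hxψ : JoinedIn S x (ψ 0) := by
      rcases hr ⟨0, rfl⟩ with ⟨t, ht⟩ | ⟨t, ht⟩
      · rw [← ht]; exact hxf.trans ((joinedIn_range f 0 t).mono hfS)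
      · rw [← ht]; exact hxf.trans (h0 ▸ (joinedIn_range g 0 t).mono hgS)
    refine Or.inl ⟨ψ, hψ, Set.Subset.antisymm ?_ fun y hy => ?_⟩
    · rintro _ ⟨t, rfl⟩
      exact hxψ.trans ((joinedIn_range ψ 0 t).mono hψS)
    · exact hψ.mem_range_of_joinedIn hS hψS (hxψ.symm.trans hy)

theorem TriodFree.exists_injOn_image {S : Set Plane} (hS : TriodFree S) {x : Plane} (hx : x ∈ S) :
    ∃ (K : Set ℝ) (φ : ℝ → ℝ × ℝ), K.OrdConnected ∧ ContinuousOn φ K ∧ Set.InjOn φ K ∧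
      φ '' K = {y | JoinedIn S x y} := by
  rcases hS.circle_or_line hx with ⟨ψ, hψ, hr⟩ | ⟨K, φ, h⟩
  · refine ⟨Set.Ico 0 1, fun t => ψ (Set.projIcc 0 1 zero_le_one t), Set.ordConnected_Ico,
      (ψ.continuous.comp continuous_projIcc).continuousOn, ?_, ?_⟩
    · intro s hs t ht he
      simp only at he
      rw [Set.projIcc_of_mem zero_le_one ⟨hs.1, hs.2.le⟩,
        Set.projIcc_of_mem zero_le_one ⟨ht.1, ht.2.le⟩] at he
      exact congrArg Subtype.val (hψ.2 (show _ < _ from hs.2) (show _ < _ from ht.2) he)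
    · rw [← hr, ← hψ.image_Iio]
      ext y
      constructor
      · rintro ⟨t, ht, rfl⟩
        exact ⟨⟨t, ht.1, ht.2.le⟩, ht.2, by
          simp only; rw [Set.projIcc_of_mem zero_le_one ⟨ht.1, ht.2.le⟩]⟩
      · rintro ⟨t, ht, rfl⟩
        exact ⟨t, ⟨t.2.1, ht⟩, by simp⟩
  · exact ⟨K, φ, h.ordConnected, h.continuousOn, h.injOn, h.image_eq⟩

/-! ### Borel maps that are at most two-to-one -/

open MeasureTheory TopologicalSpace

/-- The fibres of the restriction of `f` to `A` have at most two elements. -/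
def AtMostTwo {X Y : Type*} (f : X → Y) (A : Set X) : Prop :=
  ∀ x ∈ A, ∀ y ∈ A, ∀ z ∈ A, f x = f y → f y = f z → x = y ∨ y = z ∨ x = z

section

variable {X Y : Type*} [MeasurableSpace X] [StandardBorelSpace X] [MeasurableSpace Y]
  [StandardBorelSpace Y]

theorem AtMostTwo.exists_partition {f : X → Y} {A : Set X} (h : AtMostTwo f A)
    (hA : MeasurableSet A) (hf : Measurable f) :
    ∃ B ⊆ A, MeasurableSet B ∧ Set.InjOn f B ∧ Set.InjOn f (A \ B) := by
  set e := embeddingReal X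
  have he := measurableEmbedding_embeddingReal X
  set C : Set (X × X) := {p | p.1 ∈ A ∧ p.2 ∈ A ∧ f p.1 = f p.2 ∧ e p.1 < e p.2} with hC
  have hCm : MeasurableSet C := by
    refine (measurable_fst hA).inter ((measurable_snd hA).inter (MeasurableSet.inter ?_ ?_))
    · exact measurableSet_eq_fun (hf.comp measurable_fst) (hf.comp measurable_snd)
    · exact measurableSet_lt (he.measurable.comp measurable_fst) (he.measurable.comp measurable_snd)
  have hinj : Set.InjOn Prod.fst C := by
    rintro ⟨x, y⟩ ⟨hx, hy, hxy, hlt⟩ ⟨x', y'⟩ ⟨hx', hy', hxy', hlt'⟩ h0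
    simp only at *
    subst h0
    rcases h x hx y hy y' hy' hxy (hxy.symm.trans hxy') with h1 | h1 | h1
    · exact absurd (h1 ▸ hlt) (lt_irrefl _)
    · rw [h1]
    · exact absurd (h1 ▸ hlt') (lt_irrefl _)
  refine ⟨Prod.fst '' C, ?_, hCm.image_of_measurable_injOn measurable_fst hinj, ?_, ?_⟩
  · rintro _ ⟨p, hp, rfl⟩
    exact hp.1
  · rintro _ ⟨⟨x, y⟩, ⟨hx, hy, hxy, hlt⟩, rfl⟩ _ ⟨⟨x', y'⟩, ⟨hx', hy', hxy', hlt'⟩, rfl⟩ h0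
    simp only at *
    rcases h x hx x' hx' y hy h0 (h0.symm.trans hxy) with h1 | h1 | h1
    · exact h1
    · rcases h x hx x' hx' y' hy' h0 hxy' with h2 | h2 | h2
      · exact h2
      · exact absurd (h2 ▸ hlt') (lt_irrefl _)
      · subst h1 h2
        exact absurd (hlt.trans hlt') (lt_irrefl _)
    · exact absurd (h1 ▸ hlt) (lt_irrefl _)
  · rintro x ⟨hx, hxC⟩ y ⟨hy, hyC⟩ hxy
    rcases lt_trichotomy (e x) (e y) with h1 | h1 | h1
    · exact absurd ⟨(x, y), ⟨hx, hy, hxy, h1⟩, rfl⟩ hxC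
    · exact he.injective h1
    · exact absurd ⟨(y, x), ⟨hy, hx, hxy.symm, h1⟩, rfl⟩ hyC

theorem AtMostTwo.measurableSet_image {f : X → Y} {A : Set X} (h : AtMostTwo f A)
    (hA : MeasurableSet A) (hf : Measurable f) : MeasurableSet (f '' A) := by
  obtain ⟨B, hBA, hB, h1, h2⟩ := h.exists_partition hA hf
  rw [← Set.union_sdiff_cancel hBA, Set.image_union]
  exact (hB.image_of_measurable_injOn hf h1).union
    ((hA.diff hB).image_of_measurable_injOn hf h2)

/-- A countable union of at most two-to-one Borel correspondences is enumerated by countably many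
Borel functions. -/
theorem exists_measurable_enumeration {ι : Type*} [Countable ι] {A : ι → Set X}
    (hA : ∀ i, MeasurableSet (A i)) {src tgt : X → Y} (hs : Measurable src) (ht : Measurable tgt)
    (h2 : ∀ i, AtMostTwo src (A i)) :
    ∃ g : ℕ → Y → Y, (∀ j, Measurable (g j)) ∧ ∀ y, (∃ i, ∃ x ∈ A i, src x = y) →
      ∀ w, (∃ j, g j y = w) ↔ ∃ i, ∃ x ∈ A i, src x = y ∧ tgt x = w := by
  classical
  rcases isEmpty_or_nonempty ι with hι | hι
  · exact ⟨fun _ => id, fun _ => measurable_id, fun y ⟨i, _⟩ => hι.elim i⟩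
  choose B hBA hB h1 h1' using fun i => (h2 i).exists_partition (hA i) hs
  obtain ⟨c, hc⟩ := exists_surjective_nat (ι × Bool)
  set E : ℕ → Set X := fun j => if (c j).2 then B (c j).1 else A (c j).1 \ B (c j).1 with hE
  have hEm : ∀ j, MeasurableSet (E j) := fun j => by
    simp only [hE]
    split_ifs
    · exact hB _
    · exact (hA _).diff (hB _)
  have hEi : ∀ j, Set.InjOn src (E j) := fun j => by
    simp only [hE]
    split_ifs
    · exact h1 _
    · exact h1' _
  have hEA : ∀ x, (∃ j, x ∈ E j) ↔ ∃ i, x ∈ A i := by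
    intro x
    constructor
    · rintro ⟨j, hj⟩
      simp only [hE] at hj
      split_ifs at hj
      · exact ⟨_, hBA _ hj⟩
      · exact ⟨_, hj.1⟩
    · rintro ⟨i, hi⟩
      by_cases hx : x ∈ B i
      · obtain ⟨j, hj⟩ := hc (i, true)
        exact ⟨j, by simp only [hE, hj]; simpa using hx⟩
      · obtain ⟨j, hj⟩ := hc (i, false)
        exact ⟨j, by simp only [hE, hj]; simpa using ⟨hi, hx⟩⟩
  have key : ∀ j, ∃ g' : Y → Y, Measurable g' ∧ ∀ x ∈ E j, g' (src x) = tgt x := by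
    intro j
    have : StandardBorelSpace (E j) := (hEm j).standardBorel
    have hemb : MeasurableEmbedding (src ∘ (Subtype.val : E j → X)) :=
      (hs.comp measurable_subtype_coe).measurableEmbedding
        fun a b hab => Subtype.ext (hEi j a.2 b.2 hab)
    rcases isEmpty_or_nonempty Y with hY | hY
    · exact ⟨id, measurable_id, fun x _ => hY.elim (src x)⟩
    · obtain ⟨g', hg', hgg⟩ := hemb.exists_measurable_extend
        (ht.comp measurable_subtype_coe) fun _ => hY
      exact ⟨g', hg', fun x hx => congrFun hgg ⟨x, hx⟩⟩
  choose G hG hGE using key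
  set R : ℕ → Set Y := fun j => src '' E j with hR
  have hRm : ∀ j, MeasurableSet (R j) := fun j =>
    (hEm j).image_of_measurable_injOn hs (hEi j)
  set p : ℕ → Y → Prop := fun n y => y ∈ R n ∨ ∀ k, y ∉ R k with hp
  have hpm : ∀ n, MeasurableSet {y | p n y} := fun n =>
    (hRm n).union (by
      have : {y | ∀ k, y ∉ R k} = ⋂ k, (R k)ᶜ := by ext; simp
      change MeasurableSet {y | ∀ k, y ∉ R k}
      rw [this]
      exact MeasurableSet.iInter fun k => (hRm k).compl)
  have hpe : ∀ y, ∃ n, p n y := fun y => by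
    by_cases h : ∃ k, y ∈ R k
    · exact h.imp fun k hk => Or.inl hk
    · exact ⟨0, Or.inr (not_exists.1 h)⟩
  have hfm := Measurable.find hG hpm hpe
  refine ⟨fun j => (R j).piecewise (G j) fun y => G (Nat.find (hpe y)) y,
    fun j => (hG j).piecewise (hRm j) hfm, ?_⟩
  rintro y ⟨i, x, hx, hxy⟩ w
  have hyR : ∃ k, y ∈ R k := by
    obtain ⟨j, hj⟩ := (hEA x).2 ⟨i, hx⟩
    exact ⟨j, x, hj, hxy⟩
  have hval : ∀ k, y ∈ R k → ∃ i, ∃ x ∈ A i, src x = y ∧ tgt x = G k y := by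
    rintro k ⟨z, hz, rfl⟩
    obtain ⟨i, hi⟩ := (hEA z).1 ⟨k, hz⟩
    exact ⟨i, z, hi, rfl, (hGE k z hz).symm⟩
  constructor
  · rintro ⟨j, rfl⟩
    beta_reduce
    by_cases hj : y ∈ R j
    · rw [Set.piecewise_eq_of_mem _ _ _ hj]
      exact hval j hj
    · rw [Set.piecewise_eq_of_notMem _ _ _ hj]
      refine hval _ ?_
      rcases Nat.find_spec (hpe y) with h | h
      · exact h
      · exact absurd hyR (not_exists.2 h)
  · rintro ⟨i, z, hz, hzy, rfl⟩
    obtain ⟨j, hj⟩ := (hEA z).2 ⟨i, hz⟩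
    refine ⟨j, ?_⟩
    beta_reduce
    rw [Set.piecewise_eq_of_mem _ _ _ (show y ∈ R j from ⟨z, hj, hzy⟩), ← hzy]
    exact hGE j z hj

end

/-! ### Borel sets of curves -/

theorem polishSpace_continuousMap (X : Type*) [TopologicalSpace X] [PolishSpace X] :
    PolishSpace C(unitInterval, X) := by
  let _ := upgradeIsCompletelyMetrizable X
  infer_instance

theorem measurableSet_of_polishSpace {H : Set Plane} (hH : PolishSpace H) : MeasurableSet H := by
  have := measurableSet_range_of_continuous_injective (f := (Subtype.val : H → Plane))
    continuous_subtype_val Subtype.val_injective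
  rwa [Subtype.range_coe] at this

theorem measurableSet_range_subset {H : Set Plane} (hH : PolishSpace H) :
    MeasurableSet {f : Curve | Set.range f ⊆ H} := by
  have := polishSpace_continuousMap H
  have h := measurableSet_range_of_continuous_injective
    (f := fun g : C(unitInterval, H) => (⟨Subtype.val ∘ g, by fun_prop⟩ : Curve))
    (ContinuousMap.continuous_postcomp ⟨Subtype.val, continuous_subtype_val⟩)
    (fun g g' h => by
      ext1 t
      exact Subtype.ext (DFunLike.congr_fun h t))
  convert h
  ext f
  constructor
  · intro hf
    exact ⟨⟨fun t => ⟨f t, hf ⟨t, rfl⟩⟩, by fun_prop⟩, rfl⟩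
  · rintro ⟨g, rfl⟩ _ ⟨t, rfl⟩
    exact (g t).2

theorem isClosed_exists_mem {X K : Type*} [TopologicalSpace X] [TopologicalSpace K]
    [CompactSpace K] {Z : Set (X × K)} (hZ : IsClosed Z) : IsClosed {x | ∃ t, (x, t) ∈ Z} := by
  convert isClosedMap_fst_of_compactSpace Z hZ
  ext x
  simp

/-- The points of the unit interval with rational value. -/
def IsRat (t : unitInterval) : Prop := ∃ r : ℚ, (r : ℝ) = t

theorem IsClosed.forall {X ι : Type*} [TopologicalSpace X] {p : ι → X → Prop}
    (h : ∀ i, IsClosed {x | p i x}) : IsClosed {x | ∀ i, p i x} := by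
  have : {x | ∀ i, p i x} = ⋂ i, {x | p i x} := by
    ext
    simp
  rw [this]
  exact isClosed_iInter h

theorem countable_isRat : {t : unitInterval | IsRat t}.Countable := by
  have : {t : unitInterval | IsRat t} = Subtype.val ⁻¹' Set.range ((↑) : ℚ → ℝ) := rfl
  rw [this]
  exact (Set.countable_range _).preimage Subtype.val_injective

theorem exists_isRat_between {a b : unitInterval} (h : a < b) : ∃ r, IsRat r ∧ a < r ∧ r < b := by
  obtain ⟨r, hr, hr'⟩ := exists_rat_btwn (show (a : ℝ) < b from h)
  exact ⟨⟨r, a.2.1.trans hr.le, hr'.le.trans b.2.2⟩, ⟨r, rfl⟩, hr, hr'⟩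

theorem exists_isRat_mem_Ico {a b : unitInterval} (h : a < b) : ∃ r, IsRat r ∧ a ≤ r ∧ r < b := by
  obtain ⟨r, hr, hr'⟩ := exists_isRat_between h
  exact ⟨r, hr, hr'.1.le, hr'.2⟩

theorem measurableSet_forall_isRat {X : Type*} [MeasurableSpace X] {p : unitInterval → X → Prop}
    (h : ∀ r, IsRat r → MeasurableSet {x | p r x}) :
    MeasurableSet {x | ∀ r, IsRat r → p r x} := by
  have : {x | ∀ r, IsRat r → p r x} = ⋂ r ∈ {t | IsRat t}, {x | p r x} := by
    ext
    simp
  rw [this]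
  exact MeasurableSet.biInter countable_isRat h

theorem measurableSet_exists_isRat {X : Type*} [MeasurableSpace X] {p : unitInterval → X → Prop}
    (h : ∀ r, IsRat r → MeasurableSet {x | p r x}) :
    MeasurableSet {x | ∃ r, IsRat r ∧ p r x} := by
  have : {x | ∃ r, IsRat r ∧ p r x} = ⋃ r ∈ {t | IsRat t}, {x | p r x} := by
    ext
    simp
  rw [this]
  exact MeasurableSet.biUnion countable_isRat h

theorem Curve.continuous_eval (t : unitInterval) : Continuous fun f : Curve => f t :=
  continuous_eval_const t

theorem Curve.measurable_eval (t : unitInterval) : Measurable fun f : Curve => f t :=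
  (Curve.continuous_eval t).measurable

theorem isArcCode_iff {f : Curve} : IsArcCode f ↔
    ((∀ t, arcWeight f t = arcWeight f 0 + min t f.len) ∧ ∀ t, f (min t f.len) = f t) ∧
    ∀ a, IsRat a → ∀ b, IsRat b → a < b →
      f.len ≤ a ∨ ¬∃ p : unitInterval × unitInterval, p.1 ≤ a ∧ b ≤ p.2 ∧ f p.1 = f p.2 := by
  constructor
  · refine fun hf => ⟨⟨hf.weight_eq, hf.apply_min⟩, fun a _ b _ hab => ?_⟩
    by_contra! h
    obtain ⟨ha, ⟨s, t⟩, hs, ht, hst⟩ := h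
    have h1 := (hf.eq_iff s t).1 hst
    simp only at hs ht
    rw [min_eq_left (hs.trans ha.le)] at h1
    exact (lt_min (hab.trans_le ht) ha).not_ge (h1 ▸ hs)
  · rintro ⟨⟨h1, h2⟩, h3⟩
    have h4 : ∀ s t, s < t → s < f.len → f s ≠ f t := by
      intro s t hst hs h
      obtain ⟨b, hb, hsb, hbt⟩ := exists_isRat_between (lt_min hst hs)
      obtain ⟨a, ha, hsa, hab⟩ := exists_isRat_between hsb
      rcases h3 a ha b hb hab with h5 | h5
      · exact absurd (hab.trans (hbt.trans_le (min_le_right _ _))) h5.not_gt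
      · exact h5 ⟨(s, t), hsa.le, (hbt.trans_le (min_le_left _ _)).le, h⟩
    refine ⟨h1, fun s t => ⟨fun h => ?_, fun h => by rw [← h2 s, ← h2 t, h]⟩⟩
    rw [← h2 s, ← h2 t] at h
    by_contra hne
    rcases lt_or_gt_of_ne hne with h5 | h5
    · exact h4 _ _ h5 (h5.trans_le (min_le_right _ _)) h
    · exact h4 _ _ h5 (h5.trans_le (min_le_right _ _)) h.symm

theorem measurableSet_isArcCode : MeasurableSet {f : Curve | IsArcCode f} := by
  simp only [isArcCode_iff]
  refine MeasurableSet.inter (MeasurableSet.inter ?_ ?_) ?_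
  · refine IsClosed.measurableSet ?_
    refine IsClosed.forall fun t => isClosed_eq ?_ ?_
    · exact continuous_arcWeight_uncurry.comp (continuous_id.prodMk continuous_const)
    · refine (continuous_arcWeight_uncurry.comp (continuous_id.prodMk continuous_const)).add ?_
      exact continuous_subtype_val.comp (continuous_const.min Curve.continuous_len)
  · refine IsClosed.measurableSet ?_
    refine IsClosed.forall fun t => isClosed_eq ?_ (Curve.continuous_eval t)
    have := Curve.continuous_len
    fun_prop
  · refine measurableSet_forall_isRat fun a _ => measurableSet_forall_isRat fun b _ => ?_
    by_cases hab : a < b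
    · simp only [hab, true_imp_iff]
      refine (isClosed_le Curve.continuous_len continuous_const).measurableSet.union ?_
      refine (MeasurableSet.compl (IsClosed.measurableSet (isClosed_exists_mem
        (Z := {x : Curve × (unitInterval × unitInterval) |
          x.2.1 ≤ a ∧ b ≤ x.2.2 ∧ x.1 x.2.1 = x.1 x.2.2}) ?_)))
      refine IsClosed.and (isClosed_le (by fun_prop) continuous_const) (IsClosed.and
        (isClosed_le continuous_const (by fun_prop)) (isClosed_eq (by fun_prop) (by fun_prop)))
    · simp [hab]

/-- Curve codes in a triod-free set, none of which properly extends another, are determined by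
their starting points up to two choices. -/
theorem TriodFree.atMostTwo {S : Set Plane} (hS : TriodFree S) {Φ : Set Curve}
    (h1 : ∀ f ∈ Φ, IsArcCode f) (h2 : ∀ f ∈ Φ, ∀ t < f.len, f t ∈ S)
    (h3 : ∀ f ∈ Φ, ∀ g ∈ Φ, f 0 = g 0 → Set.range f ⊆ Set.range g → g.len ≤ f.len) :
    AtMostTwo (fun f : Curve => f 0) Φ := by
  have key : ∀ f ∈ Φ, ∀ g ∈ Φ, f 0 = g 0 → Set.range f ⊆ Set.range g → f = g := by
    intro f hf g hg h0 h
    exact (h1 f hf).eq_of_comparable (h1 g hg) h0 (Or.inl h)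
      (le_antisymm ((h1 f hf).initial_segment (h1 g hg) h0 h).1 (h3 f hf g hg h0 h))
  intro f hf g hg h hh hfg hgh
  rcases hS.exists_range_subset (h1 f hf) (h1 g hg) (h1 h hh) hfg hgh (h2 f hf) (h2 g hg)
    (h2 h hh) with (h | h) | (h | h) | (h | h)
  · exact Or.inl (key _ hf _ hg hfg h)
  · exact Or.inl (key _ hg _ hf hfg.symm h).symm
  · exact Or.inr (Or.inl (key _ hg _ hh hgh h))
  · exact Or.inr (Or.inl (key _ hh _ hg hgh.symm h).symm)
  · exact Or.inr (Or.inr (key _ hf _ hh (hfg.trans hgh) h))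
  · exact Or.inr (Or.inr (key _ hh _ hf (hfg.trans hgh).symm h).symm)

/-! ### Concatenating a sequence of shrinking paths -/

theorem joinedIn_of_antitone_basis {X : Type*} [TopologicalSpace X] {S : Set X} {y : X}
    {U : ℕ → Set X} (hb : (nhds y).HasAntitoneBasis U) (hy : y ∈ S) {b : ℕ → X}
    (h : ∀ n, JoinedIn (S ∩ U n) (b n) (b (n + 1))) : JoinedIn (S ∩ U 0) (b 0) y := by
  choose γ hγ using h
  set G : ℕ → ℝ → X := fun n t => (γ n).extend (t - n) with hG
  set F : ℝ → X := fun t => G ⌊t⌋₊ t with hF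
  have hFn : ∀ n : ℕ, ∀ t : ℝ, (n : ℝ) ≤ t → t ≤ n + 1 → F t = G n t := by
    intro n t h1 h2
    rcases h2.lt_or_eq with h2 | h2
    · have : ⌊t⌋₊ = n := (Nat.floor_eq_iff (n.cast_nonneg.trans h1)).2 ⟨h1, h2⟩
      simp only [hF, this]
    · have : ⌊t⌋₊ = n + 1 := by rw [h2]; exact_mod_cast Nat.floor_natCast (n + 1)
      simp only [hF, this]
      subst h2
      simp [hG]
  have hF0 : ∀ t : ℝ, t ≤ 0 → F t = b 0 := by
    intro t ht
    have : ⌊t⌋₊ = 0 := Nat.floor_of_nonpos ht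
    change G ⌊t⌋₊ t = b 0
    rw [this]
    exact Path.extend_of_le_zero (γ 0) (by simpa using ht)
  have hFmem : ∀ n : ℕ, ∀ t : ℝ, (n : ℝ) ≤ t → F t ∈ S ∩ U n := by
    intro n t ht
    have h1 : n ≤ ⌊t⌋₊ := Nat.le_floor ht
    have h2 : F t ∈ Set.range (γ ⌊t⌋₊) := by
      rw [← Path.extend_range]
      exact ⟨_, rfl⟩
    obtain ⟨s, hs⟩ := h2
    rw [← hs]
    exact ⟨(hγ _ s).1, hb.antitone h1 (hγ _ s).2⟩
  have hcn : ∀ n : ℕ, ContinuousOn F (Set.Iic (n : ℝ)) := by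
    intro n
    induction n with
    | zero =>
      refine (continuousOn_const (c := b 0)).congr fun t ht => hF0 t ?_
      simpa using ht
    | succ n ih =>
      have h1 : Set.Iic ((n + 1 : ℕ) : ℝ) = Set.Iic (n : ℝ) ∪ Set.Icc (n : ℝ) (n + 1) := by
        rw [Set.Iic_union_Icc_eq_Iic (by linarith)]
        simp
      rw [h1]
      refine ih.union_of_isClosed ?_ isClosed_Iic isClosed_Icc
      refine ContinuousOn.congr ?_ fun t ht => hFn n t ht.1 ht.2
      exact ((γ n).continuous_extend.comp (continuous_id.sub continuous_const)).continuousOn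
  have hFc : Continuous F := by
    refine continuous_iff_continuousAt.2 fun t => ?_
    obtain ⟨n, hn⟩ := exists_nat_gt t
    exact (hcn n).continuousAt (Iic_mem_nhds hn)
  classical
  set f : unitInterval → X := fun t => if t = 1 then y else F (t / (1 - t)) with hf
  have hlarge : ∀ n : ℕ, ∀ t : unitInterval, t ≠ 1 → (n : ℝ) * (1 - t) < t → f t ∈ S ∩ U n := by
    intro n t ht h1
    simp only [hf, if_neg ht]
    have h2 : (t : ℝ) < 1 := lt_of_le_of_ne t.2.2 fun h => ht (Subtype.ext h)
    exact hFmem n _ (by rw [le_div_iff₀ (by linarith)]; exact h1.le)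
  have hfc : Continuous f := by
    refine continuous_iff_continuousAt.2 fun t => ?_
    by_cases ht : t = 1
    · subst ht
      have h1 : f 1 = y := by simp [hf]
      rw [ContinuousAt, h1, hb.toHasBasis.tendsto_right_iff]
      rintro n -
      have ho : IsOpen {t : unitInterval | (n : ℝ) * (1 - t) < t} :=
        isOpen_lt (by fun_prop) (by fun_prop)
      filter_upwards [ho.mem_nhds (by simp)] with t ht
      by_cases h : t = 1
      · rw [h, h1]
        exact mem_of_mem_nhds (hb.toHasBasis.mem_of_mem trivial)
      · exact (hlarge n t h ht).2
    · have h1 : f =ᶠ[nhds t] fun t => F (t / (1 - t)) := by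
        filter_upwards [isOpen_compl_singleton.mem_nhds ht] with s hs
        exact if_neg hs
      refine ContinuousAt.congr ?_ h1.symm
      have h2 : (1 : ℝ) - t ≠ 0 := fun h => ht (Subtype.ext (by change _ = (1 : ℝ); linarith))
      exact hFc.continuousAt.comp
        (continuous_subtype_val.continuousAt.div (by fun_prop) h2)
  refine ⟨⟨⟨f, hfc⟩, ?_, ?_⟩, fun t => ?_⟩
  · have : (0 : unitInterval) ≠ 1 := zero_ne_one
    simp [hf, this, hF0 0 le_rfl]
  · simp [hf]
  · change f t ∈ S ∩ U 0
    by_cases ht : t = 1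
    · simp only [hf, if_pos ht]
      exact ⟨hy, mem_of_mem_nhds (hb.toHasBasis.mem_of_mem trivial)⟩
    · simp only [hf, if_neg ht]
      exact hFmem 0 _ (by
        have := t.2.1
        have := t.2.2
        push_cast
        exact div_nonneg (by linarith) (by linarith))

/-! ### Separating countably many disjoint analytic sets -/

theorem exists_measurable_envelope {α : Type*} [TopologicalSpace α] [T2Space α] [MeasurableSpace α]
    [OpensMeasurableSpace α] {𝓑 : Set (Set α)} (hc : 𝓑.Countable) (ha : ∀ B ∈ 𝓑, AnalyticSet B)
    (hd : ∀ B ∈ 𝓑, ∀ B' ∈ 𝓑, B ≠ B' → Disjoint B B') :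
    ∃ A : Set α → Set α, (∀ B ∈ 𝓑, MeasurableSet (A B) ∧ B ⊆ A B) ∧
      ∀ B ∈ 𝓑, ∀ B' ∈ 𝓑, ∀ x, x ∈ A B → x ∈ A B' → B = B' := by
  have h1 : ∀ B B', ∃ S, B ∈ 𝓑 → B' ∈ 𝓑 → B ≠ B' → B ⊆ S ∧ Disjoint B' S ∧ MeasurableSet S := by
    intro B B'
    by_cases h : B ∈ 𝓑 ∧ B' ∈ 𝓑 ∧ B ≠ B'
    · obtain ⟨S, h1, h2, h3⟩ := (ha B h.1).measurablySeparable (ha B' h.2.1)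
        (hd B h.1 B' h.2.1 h.2.2)
      exact ⟨S, fun _ _ _ => ⟨h1, h2, h3⟩⟩
    · exact ⟨∅, fun h1 h2 h3 => absurd ⟨h1, h2, h3⟩ h⟩
  choose S hS using h1
  refine ⟨fun B => ⋂ B' ∈ {B' | B' ∈ 𝓑 ∧ B ≠ B'}, S B B' \ S B' B, fun B hB => ⟨?_, ?_⟩, ?_⟩
  · refine MeasurableSet.biInter (hc.mono fun _ h => h.1) fun B' hB' => ?_
    exact (hS B B' hB hB'.1 hB'.2).2.2.diff (hS B' B hB'.1 hB hB'.2.symm).2.2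
  · refine Set.subset_iInter₂ fun B' hB' x hx => ?_
    exact ⟨(hS B B' hB hB'.1 hB'.2).1 hx,
      Set.disjoint_left.1 (hS B' B hB'.1 hB hB'.2.symm).2.1 hx⟩
  · intro B hB B' hB' x hx hx'
    by_contra hne
    simp only [Set.mem_iInter] at hx hx'
    exact (hx' B ⟨hB, Ne.symm hne⟩).2 (hx B' ⟨hB', hne⟩).1

theorem disjoint_triodicClasses {X : Type*} [TopologicalSpace X] {S : Set X} {B B' : Set X}
    (hB : B ∈ triodicClasses S) (hB' : B' ∈ triodicClasses S) (hne : B ≠ B') : Disjoint B B' := by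
  obtain ⟨c, γ, -, rfl⟩ := hB
  obtain ⟨c', γ', -, rfl⟩ := hB'
  refine Set.disjoint_left.2 fun x hx hx' => hne ?_
  exact JoinedIn.setOf_eq (JoinedIn.trans hx (JoinedIn.symm hx'))

theorem analyticSet_joinedIn {S : Set Plane} (hS : MeasurableSet {f : Curve | Set.range f ⊆ S})
    (c : Plane) : AnalyticSet {x | JoinedIn S c x} := by
  have : {x | JoinedIn S c x} = (fun f : Curve => f 1) ''
      ({f : Curve | Set.range f ⊆ S} ∩ {f : Curve | f 0 = c}) := by
    ext x
    constructor
    · rintro ⟨γ, hγ⟩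
      refine ⟨γ.toContinuousMap, ⟨?_, γ.source⟩, γ.target⟩
      rintro _ ⟨t, rfl⟩
      exact hγ t
    · rintro ⟨f, ⟨hf, rfl⟩, rfl⟩
      exact (joinedIn_range f 0 1).mono hf
  rw [this]
  refine MeasurableSet.analyticSet_image ?_ (Curve.measurable_eval 1)
  exact hS.inter (Curve.measurable_eval 0 (measurableSet_singleton c))

/-! ### The points all of whose local components are triodic -/

/-- The points of `H` all of whose local path components contain a triod. -/
def triodicCore (H : Set Plane) : Set Plane :=
  {y | y ∈ H ∧ ∀ U ∈ countableBasis Plane, y ∈ U →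
    {z | JoinedIn (H ∩ U) y z} ∈ triodicClasses (H ∩ U)}

theorem IsTriod.center_mem {X : Type*} [TopologicalSpace X] {S : Set X} {c : X}
    {γ : Fin 3 → unitInterval → X} (h : IsTriod S c γ) : c ∈ S := by
  rw [← h.zero 0]
  exact h.3 0 0

theorem IsTriod.joinedIn {X : Type*} [TopologicalSpace X] {S : Set X} {c : X}
    {γ : Fin 3 → unitInterval → X} (h : IsTriod S c γ) {U : Set X} (hU : IsOpen U) (hc : c ∈ U) :
    ∃ γ', IsTriod (S ∩ U) c γ' := by
  have h1 : ∀ i, ∃ b : unitInterval, 0 < b ∧ ∀ t ≤ b, γ i t ∈ U := by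
    intro i
    have h2 : γ i ⁻¹' U ∈ nhds (0 : unitInterval) :=
      (hU.preimage (h.continuous i)).mem_nhds (by rw [Set.mem_preimage, h.zero i]; exact hc)
    obtain ⟨b, hb, hbU⟩ := exists_Ico_subset_of_mem_nhds h2 ⟨1, zero_lt_one' unitInterval⟩
    obtain ⟨r, -, hr, hrb⟩ := exists_isRat_between hb
    exact ⟨r, hr, fun t ht => hbU ⟨unitInterval.nonneg', ht.trans_lt hrb⟩⟩
  choose b hb hbU using h1
  refine ⟨fun i t => γ i (unitInterval.lerp 0 (b i) t), ?_, ?_, ?_, ?_, ?_⟩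
  · exact fun i => (h.continuous i).comp (unitInterval.continuous_lerp _ _)
  · exact fun i => (h.injective i).comp (unitInterval.lerp_injective (hb i).ne)
  · refine fun i t => ⟨h.mem i _, hbU i _ ?_⟩
    have := unitInterval.lerp_mem_uIcc 0 (b i) t
    rw [Set.uIcc_of_le (hb i).le] at this
    exact this.2
  · intro i
    rw [unitInterval.lerp_zero, h.zero]
  · intro i j s t hij hst
    obtain ⟨h1, h2⟩ := h.disjoint i j _ _ hij hst
    exact ⟨unitInterval.lerp_injective (hb i).ne (h1.trans (unitInterval.lerp_zero _ _).symm),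
      unitInterval.lerp_injective (hb j).ne (h2.trans (unitInterval.lerp_zero _ _).symm)⟩

theorem IsTriod.mono {X : Type*} [TopologicalSpace X] {S T : Set X} {c : X}
    {γ : Fin 3 → unitInterval → X} (h : IsTriod S c γ) (hST : S ⊆ T) : IsTriod T c γ :=
  ⟨h.1, h.2, fun i t => hST (h.3 i t), h.4, h.5⟩

theorem IsTriod.mem_triodicCore {H : Set Plane} {c : Plane} {γ : Fin 3 → unitInterval → Plane}
    (h : IsTriod H c γ) : c ∈ triodicCore H := by
  refine ⟨h.center_mem, fun U hU hcU => ?_⟩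
  obtain ⟨γ', h'⟩ := h.joinedIn (isOpen_of_mem_countableBasis hU) hcU
  exact ⟨c, γ', h', rfl⟩

theorem triodFree_diff_triodicCore (H : Set Plane) : TriodFree (H \ triodicCore H) :=
  fun _ _ h => h.center_mem.2 (h.mono Set.sdiff_subset).mem_triodicCore

theorem exists_joinedIn_triodicCore_iff {H : Set Plane} {x : Plane} :
    (∃ y ∈ triodicCore H, JoinedIn H x y) ↔ {y | JoinedIn H x y} ∈ triodicClasses H := by
  constructor
  · rintro ⟨y, hy, hxy⟩
    obtain ⟨U, hU, hyU, -⟩ := (isBasis_countableBasis Plane).exists_subset_of_mem_open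
      (Set.mem_univ y) isOpen_univ
    obtain ⟨c, γ, h, hc⟩ := hy.2 U hU hyU
    have h1 : JoinedIn (H ∩ U) y c := by
      have : c ∈ {z | JoinedIn (H ∩ U) c z} := JoinedIn.refl h.center_mem
      rw [← hc] at this
      exact this
    exact ⟨c, γ, h.mono Set.inter_subset_left,
      JoinedIn.setOf_eq (hxy.trans (h1.mono Set.inter_subset_left))⟩
  · rintro ⟨c, γ, h, hc⟩
    refine ⟨c, h.mem_triodicCore, ?_⟩
    have : c ∈ {y | JoinedIn H c y} := JoinedIn.refl h.center_mem
    rw [← hc] at this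
    exact this

theorem isClosed_preimage_triodicCore {H : Set Plane} {f : Curve} (hf : Set.range f ⊆ H) :
    IsClosed (f ⁻¹' triodicCore H) := by
  refine isOpen_compl_iff.1 (isOpen_iff_mem_nhds.2 fun t ht => ?_)
  have h1 : ∃ U ∈ countableBasis Plane, f t ∈ U ∧
      {z | JoinedIn (H ∩ U) (f t) z} ∉ triodicClasses (H ∩ U) := by
    by_contra! h
    exact ht ⟨hf ⟨t, rfl⟩, h⟩
  obtain ⟨U, hU, htU, hn⟩ := h1
  have hUo := isOpen_of_mem_countableBasis hU
  obtain ⟨ε, hε, hεU⟩ := Metric.isOpen_iff.1 (hUo.preimage f.continuous) t htU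
  filter_upwards [Metric.ball_mem_nhds t hε] with s hs hsc
  apply hn
  have hj : JoinedIn (H ∩ U) (f t) (f s) := by
    refine joinedIn_of_mem_uIcc f.continuous fun u hu => ⟨hf ⟨u, rfl⟩, hεU ?_⟩
    refine lt_of_le_of_lt (Set.abs_sub_left_of_mem_uIcc (a := (t : ℝ)) (b := s) ?_) hs
    rcases le_total t s with h | h
    · rw [Set.uIcc_of_le h] at hu
      rw [Set.uIcc_of_le (show (t : ℝ) ≤ s from h)]
      exact hu
    · rw [Set.uIcc_of_ge h] at hu
      rw [Set.uIcc_of_ge (show (s : ℝ) ≤ t from h)]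
      exact hu
  rw [JoinedIn.setOf_eq hj]
  exact hsc.2 U hU (by simpa using (hj.mem).2.2)

/-- A coherent choice of triodic local components at `y` is the choice of the components of `y`. -/
theorem mem_of_coherent_triodicClasses {H : Set Plane} {y : Plane} (hy : y ∈ H)
    {B : Set Plane → Set Plane}
    (hB : ∀ U ∈ countableBasis Plane, y ∈ U → B U ∈ triodicClasses (H ∩ U))
    (hmono : ∀ U ∈ countableBasis Plane, ∀ V ∈ countableBasis Plane, y ∈ U → U ⊆ V → B U ⊆ B V) :
    y ∈ triodicCore H := by
  refine ⟨hy, fun U hU hyU => ?_⟩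
  have hbas : (nhds y).HasBasis (fun V => V ∈ countableBasis Plane ∧ y ∈ V ∧ V ⊆ U) id := by
    refine ⟨fun t => ⟨fun ht => ?_, fun ⟨V, hV, hVt⟩ =>
      Filter.mem_of_superset ((isOpen_of_mem_countableBasis hV.1).mem_nhds hV.2.1) hVt⟩⟩
    obtain ⟨V, hV, hyV, hVt⟩ := (isBasis_countableBasis Plane).mem_nhds_iff.1
      (Filter.inter_mem ht ((isOpen_of_mem_countableBasis hU).mem_nhds hyU))
    exact ⟨V, ⟨hV, hyV, fun z hz => (hVt hz).2⟩, fun z hz => (hVt hz).1⟩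
  obtain ⟨V, hV, hVb⟩ := hbas.exists_antitone_subbasis
  have hne : ∀ n, ∃ b, b ∈ B (V n) := fun n => by
    obtain ⟨c, γ, h, hc⟩ := hB (V n) (hV n).1 (hV n).2.1
    exact ⟨c, hc ▸ JoinedIn.refl h.center_mem⟩
  choose b hb using hne
  have hBV : ∀ n, ∀ z ∈ B (V n), {w | JoinedIn (H ∩ V n) z w} = B (V n) := by
    intro n z hz
    obtain ⟨c, γ, h, hc⟩ := hB (V n) (hV n).1 (hV n).2.1
    rw [hc] at hz ⊢
    exact (JoinedIn.setOf_eq hz).symm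
  have hstep : ∀ n, JoinedIn (H ∩ V n) (b n) (b (n + 1)) := by
    intro n
    have h1 : b (n + 1) ∈ B (V n) := hmono _ (hV _).1 _ (hV n).1 (hV _).2.1
      (hVb.antitone n.le_succ) (hb (n + 1))
    rw [← hBV n _ (hb n)] at h1
    exact h1
  have h1 := joinedIn_of_antitone_basis hVb hy hstep
  have h2 : y ∈ B (V 0) := by rw [← hBV 0 _ (hb 0)]; exact h1
  have h3 : y ∈ B U := hmono _ (hV 0).1 U hU (hV 0).2.1 (hV 0).2.2 h2
  obtain ⟨c, γ, h, hc⟩ := hB U hU hyU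
  rw [hc] at h3
  exact ⟨c, γ, h, (JoinedIn.setOf_eq h3).symm⟩

/-! ### Borel complexity of the triodic core -/

theorem measurableSet_forall_mem {X ι : Type*} [MeasurableSpace X] {s : Set ι} (hs : s.Countable)
    {p : ι → X → Prop} (h : ∀ i ∈ s, MeasurableSet {x | p i x}) :
    MeasurableSet {x | ∀ i ∈ s, p i x} := by
  have : {x | ∀ i ∈ s, p i x} = ⋂ i ∈ s, {x | p i x} := by
    ext
    simp
  rw [this]
  exact MeasurableSet.biInter hs h

theorem measurableSet_exists_mem {X ι : Type*} [MeasurableSpace X] {s : Set ι} (hs : s.Countable)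
    {p : ι → X → Prop} (h : ∀ i ∈ s, MeasurableSet {x | p i x}) :
    MeasurableSet {x | ∃ i ∈ s, p i x} := by
  have : {x | ∃ i ∈ s, p i x} = ⋃ i ∈ s, {x | p i x} := by
    ext
    simp
  rw [this]
  exact MeasurableSet.biUnion hs h

theorem MeasurableSet.const_imp {X : Type*} [MeasurableSpace X] {c : Prop} {q : X → Prop}
    (hq : c → MeasurableSet {x | q x}) : MeasurableSet {x | c → q x} := by
  by_cases hc : c
  · simpa [hc] using hq hc
  · simp [hc]

/-- The `k`-th interval of the subdivision of the unit interval into `m + 1` equal parts. -/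
def gridInterval (m k : ℕ) : Set unitInterval :=
  {t | (k : ℝ) ≤ (m + 1) * t ∧ ((m : ℝ) + 1) * t ≤ k + 1}

theorem isClosed_gridInterval (m k : ℕ) : IsClosed (gridInterval m k) :=
  IsClosed.and (isClosed_le continuous_const (by fun_prop))
    (isClosed_le (by fun_prop) continuous_const)

theorem exists_isRat_le {t : unitInterval} {κ : ℕ → ℕ} (h : ∀ m, (κ m : ℝ) ≤ (m + 1) * t) (n : ℕ) :
    ∃ x, IsRat x ∧ x ≤ t ∧ ∀ m ≤ n, (κ m : ℝ) ≤ (m + 1) * x := by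
  have h1 : ∀ m : ℕ, ∃ x, IsRat x ∧ x ≤ t ∧ (κ m : ℝ) ≤ (m + 1) * x := by
    intro m
    have hm : (0 : ℝ) < m + 1 := by positivity
    have h2 : (κ m : ℝ) / (m + 1) ≤ t := by
      rw [div_le_iff₀ hm, mul_comm]
      exact h m
    refine ⟨⟨κ m / (m + 1), by positivity, h2.trans t.2.2⟩, ⟨κ m / (m + 1), by push_cast; rfl⟩, h2, ?_⟩
    change (κ m : ℝ) ≤ (m + 1) * (κ m / (m + 1))
    rw [mul_div_cancel₀ _ hm.ne']
  induction n with
  | zero =>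
    obtain ⟨x, h2, h3, h4⟩ := h1 0
    refine ⟨x, h2, h3, fun m hm => ?_⟩
    obtain rfl : m = 0 := Nat.le_zero.1 hm
    exact h4
  | succ n ih =>
    obtain ⟨x, h2, h3, h4⟩ := h1 (n + 1)
    obtain ⟨x', h2', h3', h4'⟩ := ih
    have hmul : ∀ m : ℕ, ∀ a b : unitInterval, a ≤ b → ((m : ℝ) + 1) * a ≤ (m + 1) * b :=
      fun m a b hab => mul_le_mul_of_nonneg_left (show (a : ℝ) ≤ b from hab) (by positivity)
    rcases le_total x x' with h5 | h5
    · refine ⟨x', h2', h3', fun m hm => ?_⟩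
      rcases Nat.le_succ_iff.1 hm with hm | rfl
      · exact h4' m hm
      · exact h4.trans (hmul _ _ _ h5)
    · refine ⟨x, h2, h3, fun m hm => ?_⟩
      rcases Nat.le_succ_iff.1 hm with hm | rfl
      · exact (h4' m hm).trans (hmul _ _ _ h5)
      · exact h4

theorem exists_mapsTo_gridInterval {f : Curve} {t : unitInterval} {κ : ℕ → ℕ}
    (h : ∀ m, t ∈ gridInterval m (κ m)) {U : Set Plane} (hU : IsOpen U) (ht : f t ∈ U) :
    ∃ m, Set.MapsTo f (gridInterval m (κ m)) U := by
  obtain ⟨ε, hε, hεU⟩ := Metric.isOpen_iff.1 (hU.preimage f.continuous) t ht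
  obtain ⟨m, hm⟩ := exists_nat_one_div_lt hε
  refine ⟨m, fun s hs => hεU ?_⟩
  have hm0 : (0 : ℝ) < m + 1 := by positivity
  rw [Metric.mem_ball, Subtype.dist_eq, Real.dist_eq]
  refine lt_of_le_of_lt ?_ hm
  rw [le_div_iff₀ hm0, ← abs_of_pos hm0, ← abs_mul, abs_le]
  obtain ⟨h1, h2⟩ := h m
  obtain ⟨h3, h4⟩ := hs
  constructor <;> nlinarith

/-- The rational points of `f '' J` lie in the Borel envelopes of coherent triodic classes. -/
def IsCoherentOn (H : Set Plane) (A : Set Plane → Set Plane → Set Plane) (J : Set unitInterval)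
    (f : Curve) : Prop :=
  ∀ U ∈ countableBasis Plane, ∀ V ∈ countableBasis Plane, U ⊆ V → Set.MapsTo f J U →
    ∃ B ∈ triodicClasses (H ∩ U), ∃ B' ∈ triodicClasses (H ∩ V), B ⊆ B' ∧
      ∀ r, IsRat r → r ∈ J → f r ∈ A U B ∧ f r ∈ A V B'

theorem measurableSet_isCoherentOn {H : Set Plane} {A : Set Plane → Set Plane → Set Plane}
    (hA : ∀ U ∈ countableBasis Plane, ∀ B ∈ triodicClasses (H ∩ U), MeasurableSet (A U B))
    {J : Set unitInterval} (hJ : IsClosed J) : MeasurableSet {f | IsCoherentOn H A J f} := by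
  refine measurableSet_forall_mem (countable_countableBasis _) fun U hU =>
    measurableSet_forall_mem (countable_countableBasis _) fun V hV =>
    MeasurableSet.const_imp fun _ => MeasurableSet.imp ?_ ?_
  · exact (ContinuousMap.isOpen_setOfPred_mapsTo hJ.isCompact
      (isOpen_of_mem_countableBasis hU)).measurableSet
  · refine measurableSet_exists_mem (countable_triodicClasses _) fun B hB =>
      measurableSet_exists_mem (countable_triodicClasses _) fun B' hB' =>
      (MeasurableSet.const _).inter (measurableSet_forall_isRat fun r _ =>
        MeasurableSet.const_imp fun _ => ?_)
    exact (Curve.measurable_eval r (hA U hU B hB)).inter (Curve.measurable_eval r (hA V hV B' hB'))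

theorem exists_mem_triodicCore_iff {H : Set Plane} {A : Set Plane → Set Plane → Set Plane}
    (hA : ∀ U ∈ countableBasis Plane, ∀ B ∈ triodicClasses (H ∩ U), B ⊆ A U B)
    (hA' : ∀ U ∈ countableBasis Plane, ∀ B ∈ triodicClasses (H ∩ U),
      ∀ B' ∈ triodicClasses (H ∩ U), ∀ x, x ∈ A U B → x ∈ A U B' → B = B')
    {f : Curve} (hf : Set.range f ⊆ H) :
    (∃ t, f t ∈ triodicCore H) ↔ ∀ n, ∃ x, IsRat x ∧ ∀ m ≤ n, ∃ k ≤ m + 1,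
      x ∈ gridInterval m k ∧ IsCoherentOn H A (gridInterval m k) f := by
  constructor
  · rintro ⟨t, ht⟩ n
    have hk : ∀ m : ℕ, t ∈ gridInterval m ⌊((m : ℝ) + 1) * t⌋₊ := fun m =>
      ⟨Nat.floor_le (mul_nonneg (by positivity) t.2.1), (Nat.lt_floor_add_one _).le⟩
    obtain ⟨x, hx, hxt, hxm⟩ := exists_isRat_le (fun m => (hk m).1) n
    refine ⟨x, hx, fun m hm => ⟨_, ?_, ⟨hxm m hm, ?_⟩, ?_⟩⟩
    · refine Nat.floor_le_of_le ?_
      push_cast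
      exact mul_le_of_le_one_right (by positivity) t.2.2
    · refine le_trans ?_ (hk m).2
      exact mul_le_mul_of_nonneg_left (show (x : ℝ) ≤ t from hxt) (by positivity)
    · intro U hU V hV hUV hmaps
      have htU := hmaps (hk m)
      refine ⟨_, ht.2 U hU htU, _, ht.2 V hV (hUV htU), fun z hz => ?_, fun r _ hrJ => ?_⟩
      · exact JoinedIn.mono hz (Set.inter_subset_inter_right _ hUV)
      · have hj : JoinedIn (H ∩ U) (f t) (f r) := by
          refine joinedIn_of_mem_uIcc f.continuous fun u hu => ⟨hf ⟨u, rfl⟩, hmaps ?_⟩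
          have hm0 : (0 : ℝ) ≤ m + 1 := by positivity
          rcases le_total t r with h | h
          · rw [Set.uIcc_of_le h] at hu
            exact ⟨(hk m).1.trans (mul_le_mul_of_nonneg_left (Subtype.coe_le_coe.2 hu.1) hm0),
              (mul_le_mul_of_nonneg_left (Subtype.coe_le_coe.2 hu.2) hm0).trans hrJ.2⟩
          · rw [Set.uIcc_of_ge h] at hu
            exact ⟨hrJ.1.trans (mul_le_mul_of_nonneg_left (Subtype.coe_le_coe.2 hu.1) hm0),
              (mul_le_mul_of_nonneg_left (Subtype.coe_le_coe.2 hu.2) hm0).trans (hk m).2⟩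
        exact ⟨hA U hU _ (ht.2 U hU htU) hj, hA V hV _ (ht.2 V hV (hUV htU))
          (hj.mono (Set.inter_subset_inter_right _ hUV))⟩
  · intro h
    set G : ℕ → Set unitInterval := fun m =>
      ⋃ k ∈ {k | k ≤ m + 1 ∧ IsCoherentOn H A (gridInterval m k) f}, gridInterval m k with hG
    have hGc : ∀ m, IsClosed (G m) := fun m =>
      Set.Finite.isClosed_biUnion ((Set.finite_Iic (m + 1)).subset fun k hk => hk.1)
        fun k _ => isClosed_gridInterval m k
    have hne : (⋂ n, ⋂ m ∈ Set.Iic n, G m).Nonempty := by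
      refine IsCompact.nonempty_iInter_of_sequence_nonempty_isCompact_isClosed _ ?_ ?_ ?_ ?_
      · exact fun n => Set.biInter_subset_biInter_left (Set.Iic_subset_Iic.2 n.le_succ)
      · intro n
        obtain ⟨x, -, hx⟩ := h n
        refine ⟨x, Set.mem_iInter₂.2 fun m hm => ?_⟩
        obtain ⟨k, hk, hxk, hck⟩ := hx m hm
        exact Set.mem_biUnion (⟨hk, hck⟩ : k ≤ m + 1 ∧ _) hxk
      · exact (isClosed_biInter fun m _ => hGc m).isCompact
      · exact fun n => isClosed_biInter fun m _ => hGc m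
    obtain ⟨t, ht⟩ := hne
    have ht' : ∀ m, ∃ k, IsCoherentOn H A (gridInterval m k) f ∧ t ∈ gridInterval m k := by
      intro m
      have h1 := Set.mem_iInter₂.1 (Set.mem_iInter.1 ht m) m (Set.mem_Iic.2 le_rfl)
      simp only [hG, Set.mem_iUnion₂] at h1
      obtain ⟨k, hk, htk⟩ := h1
      exact ⟨k, hk.2, htk⟩
    choose κ hκ htκ using ht'
    have hcommon : ∀ m m', ∃ x, IsRat x ∧ x ∈ gridInterval m (κ m) ∧ x ∈ gridInterval m' (κ m') := by
      intro m m'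
      obtain ⟨x, hx, hxt, hxm⟩ := exists_isRat_le (fun m => (htκ m).1) (max m m')
      have hle : ∀ m : ℕ, ((m : ℝ) + 1) * x ≤ κ m + 1 := fun m =>
        (mul_le_mul_of_nonneg_left (show (x : ℝ) ≤ t from hxt) (by positivity)).trans (htκ m).2
      exact ⟨x, hx, ⟨hxm m (le_max_left _ _), hle m⟩, ⟨hxm m' (le_max_right _ _), hle m'⟩⟩
    have hex : ∀ U, ∃ B, U ∈ countableBasis Plane → f t ∈ U → B ∈ triodicClasses (H ∩ U) ∧
        ∃ m, ∀ r, IsRat r → r ∈ gridInterval m (κ m) → f r ∈ A U B := by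
      intro U
      by_cases hU : U ∈ countableBasis Plane ∧ f t ∈ U
      · obtain ⟨m, hm⟩ := exists_mapsTo_gridInterval htκ (isOpen_of_mem_countableBasis hU.1) hU.2
        obtain ⟨B, hB, B', -, -, hr⟩ := hκ m U hU.1 U hU.1 subset_rfl hm
        exact ⟨B, fun _ _ => ⟨hB, m, fun r hr1 hr2 => (hr r hr1 hr2).1⟩⟩
      · exact ⟨∅, fun h1 h2 => absurd ⟨h1, h2⟩ hU⟩
    choose B hB using hex
    refine ⟨t, mem_of_coherent_triodicClasses (hf ⟨t, rfl⟩) (B := B)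
      (fun U hU htU => (hB U hU htU).1) fun U hU V hV htU hUV => ?_⟩
    obtain ⟨m, hm⟩ := exists_mapsTo_gridInterval htκ (isOpen_of_mem_countableBasis hU) htU
    obtain ⟨B₁, hB₁, B₂, hB₂, hsub, hr⟩ := hκ m U hU V hV hUV hm
    have heq : ∀ W ∈ countableBasis Plane, f t ∈ W → ∀ B' ∈ triodicClasses (H ∩ W),
        (∀ r, IsRat r → r ∈ gridInterval m (κ m) → f r ∈ A W B') → B W = B' := by
      intro W hW htW B' hB' hr'
      obtain ⟨h1, m', hm'⟩ := hB W hW htW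
      obtain ⟨x, hx, hxm, hxm'⟩ := hcommon m m'
      exact hA' W hW _ h1 _ hB' (f x) (hm' x hx hxm') (hr' x hx hxm)
    rw [heq U hU htU B₁ hB₁ fun r h1 h2 => (hr r h1 h2).1,
      heq V hV (hUV htU) B₂ hB₂ fun r h1 h2 => (hr r h1 h2).2]
    exact hsub

theorem measurableSet_exists_mem_triodicCore {H : Set Plane} (hH : PolishSpace H) :
    MeasurableSet {f : Curve | Set.range f ⊆ H ∧ ∃ t, f t ∈ triodicCore H} := by
  have hrange : ∀ U ∈ countableBasis Plane,
      MeasurableSet {f : Curve | Set.range f ⊆ H ∩ U} := by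
    intro U hU
    simp only [Set.subset_inter_iff]
    refine (measurableSet_range_subset hH).inter (IsOpen.measurableSet ?_)
    have : {f : Curve | Set.range f ⊆ U} = {f : Curve | Set.MapsTo f Set.univ U} :=
      Set.ext fun f => Set.mapsTo_univ_iff_range_subset.symm
    change IsOpen {f : Curve | Set.range f ⊆ U}
    rw [this]
    exact ContinuousMap.isOpen_setOfPred_mapsTo isCompact_univ (isOpen_of_mem_countableBasis hU)
  have henv : ∀ U, ∃ A : Set Plane → Set Plane, U ∈ countableBasis Plane →
      (∀ B ∈ triodicClasses (H ∩ U), MeasurableSet (A B) ∧ B ⊆ A B) ∧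
      ∀ B ∈ triodicClasses (H ∩ U), ∀ B' ∈ triodicClasses (H ∩ U), ∀ x, x ∈ A B → x ∈ A B' →
        B = B' := by
    intro U
    by_cases hU : U ∈ countableBasis Plane
    · obtain ⟨A, h1, h2⟩ := exists_measurable_envelope (countable_triodicClasses (H ∩ U))
        (by rintro _ ⟨c, γ, -, rfl⟩; exact analyticSet_joinedIn (hrange U hU) c)
        (fun B hB B' hB' hne => disjoint_triodicClasses hB hB' hne)
      exact ⟨A, fun _ => ⟨h1, h2⟩⟩
    · exact ⟨id, fun h => absurd h hU⟩
  choose A hA using henv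
  have heq : {f : Curve | Set.range f ⊆ H ∧ ∃ t, f t ∈ triodicCore H} =
      {f : Curve | Set.range f ⊆ H} ∩ {f | ∀ n : ℕ, ∃ x, IsRat x ∧ ∀ m ∈ Set.Iic n,
        ∃ k ∈ Set.Iic (m + 1), x ∈ gridInterval m k ∧ IsCoherentOn H A (gridInterval m k) f} := by
    ext f
    refine and_congr_right fun hf => ?_
    exact exists_mem_triodicCore_iff (fun U hU B hB => ((hA U hU).1 B hB).2)
      (fun U hU => (hA U hU).2) hf
  rw [heq]
  refine (measurableSet_range_subset hH).inter (measurableSet_setOfPred.2 (Measurable.forall fun n =>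
    measurableSet_setOfPred.1 (measurableSet_exists_isRat fun x _ =>
      measurableSet_forall_mem (Set.to_countable _) fun m _ =>
      measurableSet_exists_mem (Set.to_countable _) fun k _ => ?_)))
  exact (MeasurableSet.const _).inter (measurableSet_isCoherentOn
    (fun U hU B hB => ((hA U hU).1 B hB).1) (isClosed_gridInterval m k))

/-! ### The triodic part of `H` -/

theorem measurableSet_triodicCore {H : Set Plane} (hH : PolishSpace H) :
    MeasurableSet (triodicCore H) := by
  have h : Measurable fun y : Plane => (ContinuousMap.const unitInterval y : Curve) :=
    ContinuousMap.continuous_const'.measurable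
  convert h (measurableSet_exists_mem_triodicCore hH)
  ext y
  constructor
  · refine fun hy => ⟨?_, 0, hy⟩
    rintro _ ⟨t, rfl⟩
    exact hy.1
  · exact fun hy => hy.2.choose_spec

theorem Curve.continuous_trunc (r : unitInterval) : Continuous fun f : Curve => f.trunc r :=
  ContinuousMap.continuous_precomp ⟨fun t => min t r, by fun_prop⟩

theorem IsArcCode.exists_first_hit {f : Curve} (hf : IsArcCode f) {C : Set Plane}
    (hC : IsClosed (f ⁻¹' C)) (h : ∃ t, f t ∈ C) :
    ∃ g, IsArcCode g ∧ Set.range g ⊆ Set.range f ∧ g 0 = f 0 ∧ g 1 ∈ C ∧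
      ∀ t < g.len, g t ∉ C := by
  obtain ⟨a, ha, hl⟩ := hC.isCompact.exists_isLeast h
  obtain ⟨h1, h2⟩ := hf.trunc a
  refine ⟨f.trunc a, h1, ?_, ?_, ?_, ?_⟩
  · rintro _ ⟨t, rfl⟩
    exact ⟨_, rfl⟩
  · rw [Curve.trunc_apply, min_eq_left unitInterval.nonneg']
  · rw [Curve.trunc_apply, min_eq_right unitInterval.le_one']
    exact ha
  · intro t ht htC
    rw [h2] at ht
    have h3 : t < a := ht.trans_le (min_le_left _ _)
    rw [Curve.trunc_apply, min_eq_left h3.le] at htC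
    exact h3.not_ge (hl htC)

/-- The points of `H` whose path component contains a triod. -/
def triodicPart (H : Set Plane) : Set Plane := {x | x ∈ H ∧ ∃ y ∈ triodicCore H, JoinedIn H x y}

theorem measurableSet_triodicPart {H : Set Plane} (hH : PolishSpace H) :
    MeasurableSet (triodicPart H) := by
  set Φ : Set Curve := {f | IsArcCode f} ∩ ({f | Set.range f ⊆ H} ∩ ({f | f 1 ∈ triodicCore H} ∩
    {f | ∀ r, IsRat r → r < f.len → ¬(Set.range (f.trunc r) ⊆ H ∧
      ∃ t, f.trunc r t ∈ triodicCore H)})) with hΦ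
  have hΦm : MeasurableSet Φ := by
    refine measurableSet_isArcCode.inter ((measurableSet_range_subset hH).inter
      ((Curve.measurable_eval 1 (measurableSet_triodicCore hH)).inter
      (measurableSet_forall_isRat fun r _ => MeasurableSet.imp ?_ (MeasurableSet.compl ?_))))
    · exact (isOpen_lt continuous_const Curve.continuous_len).measurableSet
    · exact (Curve.continuous_trunc r).measurable (measurableSet_exists_mem_triodicCore hH)
  have hΦt : ∀ f ∈ Φ, ∀ t < f.len, f t ∈ H \ triodicCore H := by
    rintro f ⟨-, h1, -, h2⟩ t ht
    refine ⟨h1 ⟨t, rfl⟩, fun h3 => ?_⟩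
    obtain ⟨r, hr, htr, hrl⟩ := exists_isRat_mem_Ico ht
    refine h2 r hr hrl ⟨?_, t, ?_⟩
    · rintro _ ⟨s, rfl⟩
      exact h1 ⟨_, rfl⟩
    · rwa [Curve.trunc_apply, min_eq_left htr]
  have h2 : AtMostTwo (fun f : Curve => f 0) Φ := by
    refine (triodFree_diff_triodicCore H).atMostTwo (fun f hf => hf.1) hΦt ?_
    intro f hf g hg h0 hfg
    by_contra! hlt
    refine (hΦt g hg f.len hlt).2 ?_
    have h3 := (hf.1.initial_segment hg.1 h0 hfg).2 f.len
    rw [min_self] at h3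
    rw [← h3, hf.1.apply_len]
    exact hf.2.2.1
  convert h2.measurableSet_image hΦm (Curve.measurable_eval 0)
  ext x
  constructor
  · rintro ⟨hx, y, hy, hxy⟩
    obtain ⟨f, hf, hfH, rfl, rfl⟩ := hxy.exists_isArcCode
    obtain ⟨g, hg, hgf, hg0, hg1, hgt⟩ := hf.exists_first_hit
      (isClosed_preimage_triodicCore hfH) ⟨1, hy⟩
    refine ⟨g, ⟨hg, hgf.trans hfH, hg1, ?_⟩, hg0⟩
    rintro r hr hrl ⟨-, t, ht⟩
    exact hgt _ ((min_le_right _ _).trans_lt hrl) ht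
  · rintro ⟨f, ⟨-, h3, h4, -⟩, rfl⟩
    exact ⟨h3 ⟨0, rfl⟩, f 1, h4, (joinedIn_range f 0 1).mono h3⟩

theorem triodicPart_eq (H : Set Plane) : triodicPart H = ⋃₀ triodicClasses H := by
  ext x
  constructor
  · rintro ⟨hx, h⟩
    exact ⟨_, exists_joinedIn_triodicCore_iff.1 h, JoinedIn.refl hx⟩
  · rintro ⟨B, ⟨c, γ, h, rfl⟩, hx⟩
    exact ⟨(JoinedIn.mem hx).2, c, h.mem_triodicCore, hx.symm⟩

theorem measurableSet_of_mem_triodicClasses {H : Set Plane} (hH : PolishSpace H) {B : Set Plane}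
    (hB : B ∈ triodicClasses H) : MeasurableSet B := by
  have ha : ∀ B ∈ triodicClasses H, AnalyticSet B := by
    rintro _ ⟨c, γ, -, rfl⟩
    exact analyticSet_joinedIn (measurableSet_range_subset hH) c
  refine (ha B hB).measurableSet_of_compl ?_
  have h1 : Bᶜ = (triodicPart H)ᶜ ∪ ⋃ B' ∈ triodicClasses H \ {B}, B' := by
    rw [triodicPart_eq]
    ext x
    constructor
    · intro hx
      by_cases h : x ∈ ⋃₀ triodicClasses H
      · obtain ⟨B', hB', hxB'⟩ := h
        refine Or.inr (Set.mem_biUnion ⟨hB', fun h => hx ?_⟩ hxB')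
        rw [Set.mem_singleton_iff] at h
        rwa [← h]
      · exact Or.inl h
    · rintro (hx | hx) hxB
      · exact hx ⟨B, hB, hxB⟩
      · obtain ⟨B', hB', hxB'⟩ := Set.mem_iUnion₂.1 hx
        exact Set.disjoint_left.1 (disjoint_triodicClasses hB'.1 hB hB'.2) hxB' hxB
  rw [h1, Set.union_eq_iUnion]
  refine AnalyticSet.iUnion fun b => ?_
  cases b
  · have : Countable ↥(triodicClasses H \ {B}) :=
      ((countable_triodicClasses H).mono Set.sdiff_subset).to_subtype
    rw [cond_false, Set.biUnion_eq_iUnion]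
    exact AnalyticSet.iUnion fun B' => ha _ B'.2.1
  · exact (measurableSet_triodicPart hH).compl.analyticSet

/-- The points of `H` whose path component contains no triod. -/
def atriodicPart (H : Set Plane) : Set Plane := H \ triodicPart H

theorem atriodicPart_subset (H : Set Plane) : atriodicPart H ⊆ H := Set.sdiff_subset

theorem triodFree_atriodicPart (H : Set Plane) : TriodFree (atriodicPart H) :=
  fun _ _ h => h.center_mem.2 ⟨h.center_mem.1, _, (h.mono (atriodicPart_subset H)).mem_triodicCore,
    JoinedIn.refl h.center_mem.1⟩

theorem measurableSet_atriodicPart {H : Set Plane} (hH : PolishSpace H) :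
    MeasurableSet (atriodicPart H) :=
  (measurableSet_of_polishSpace hH).diff (measurableSet_triodicPart hH)

theorem JoinedIn.mem_atriodicPart {H : Set Plane} {x y : Plane} (h : JoinedIn H x y)
    (hx : x ∈ atriodicPart H) : y ∈ atriodicPart H :=
  ⟨h.mem.2, fun hy => hx.2 ⟨hx.1, hy.2.imp fun _ hz => ⟨hz.1, h.trans hz.2⟩⟩⟩

theorem range_subset_atriodicPart {H : Set Plane} {f : Curve} {t : unitInterval}
    (ht : f t ∈ atriodicPart H) (hf : Set.range f ⊆ H) : Set.range f ⊆ atriodicPart H := by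
  rintro _ ⟨s, rfl⟩
  exact ((joinedIn_range f t s).mono hf).mem_atriodicPart ht

theorem joinedIn_atriodicPart_iff {H : Set Plane} {x y : Plane} (hx : x ∈ atriodicPart H) :
    JoinedIn (atriodicPart H) x y ↔ JoinedIn H x y := by
  refine ⟨fun h => h.mono (atriodicPart_subset H), fun h => ?_⟩
  obtain ⟨f, -, hf, rfl, rfl⟩ := h.exists_isArcCode
  exact (joinedIn_range f 0 1).mono (range_subset_atriodicPart hx hf)

theorem measurableSet_range_subset_atriodicPart {H : Set Plane} (hH : PolishSpace H) :
    MeasurableSet {f : Curve | Set.range f ⊆ atriodicPart H} := by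
  have : {f : Curve | Set.range f ⊆ atriodicPart H} =
      {f : Curve | Set.range f ⊆ H} ∩ {f | f 0 ∈ atriodicPart H} :=
    Set.ext fun f => ⟨fun h => ⟨h.trans (atriodicPart_subset H), h ⟨0, rfl⟩⟩,
      fun h => range_subset_atriodicPart h.2 h.1⟩
  rw [this]
  exact (measurableSet_range_subset hH).inter
    (Curve.measurable_eval 0 (measurableSet_atriodicPart hH))

/-! ### Curves stopped at a closed set -/

theorem isClosed_exists_mem_Icc {C : Set Plane} (hC : IsClosed C) (r s : unitInterval) :
    IsClosed {f : Curve | ∃ t, r ≤ t ∧ t ≤ s ∧ f t ∈ C} := by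
  refine isClosed_exists_mem (Z := {p : Curve × unitInterval | r ≤ p.2 ∧ p.2 ≤ s ∧ p.1 p.2 ∈ C}) ?_
  refine (isClosed_le continuous_const continuous_snd).inter
    ((isClosed_le continuous_snd continuous_const).inter (hC.preimage ?_))
  exact continuous_eval

/-- The arcs in `S` which end at the first parameter from `r` on at which they hit `B`. -/
def stoppedArcs (S B : Set Plane) (r : unitInterval) : Set Curve :=
  {f | IsArcCode f ∧ Set.range f ⊆ S ∧ r ≤ f.len ∧ f 1 ∈ B ∧ ∀ t, r ≤ t → t < f.len → f t ∉ B}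

theorem measurableSet_stoppedArcs {S B : Set Plane}
    (hS : MeasurableSet {f : Curve | Set.range f ⊆ S}) (hB : IsClosed B) (r : unitInterval) :
    MeasurableSet (stoppedArcs S B r) := by
  have h : stoppedArcs S B r = {f | IsArcCode f} ∩ ({f | Set.range f ⊆ S} ∩ ({f | r ≤ f.len} ∩
      ({f | f 1 ∈ B} ∩ {f | ∀ s, IsRat s → s < f.len → ¬∃ t, r ≤ t ∧ t ≤ s ∧ f t ∈ B}))) := by
    ext f
    refine and_congr_right fun _ => and_congr_right fun _ => and_congr_right fun _ =>
      and_congr_right fun _ => ⟨?_, ?_⟩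
    · rintro h s - hs ⟨t, hrt, hts, ht⟩
      exact h t hrt (hts.trans_lt hs) ht
    · intro h t hrt ht htB
      obtain ⟨s, hs, hts, hsl⟩ := exists_isRat_mem_Ico ht
      exact h s hs hsl ⟨t, hrt, hts, htB⟩
  rw [h]
  refine measurableSet_isArcCode.inter (hS.inter (MeasurableSet.inter ?_
    ((Curve.measurable_eval 1 hB.measurableSet).inter
    (measurableSet_forall_isRat fun s _ => MeasurableSet.imp ?_ (MeasurableSet.compl ?_)))))
  · exact (isClosed_le continuous_const Curve.continuous_len).measurableSet
  · exact (isOpen_lt continuous_const Curve.continuous_len).measurableSet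
  · exact (isClosed_exists_mem_Icc hB r s).measurableSet

theorem atMostTwo_stoppedArcs {S : Set Plane} (hS : TriodFree S) (B : Set Plane)
    (r : unitInterval) : AtMostTwo (fun f : Curve => f 0) (stoppedArcs S B r) := by
  refine hS.atMostTwo (fun f hf => hf.1) (fun f hf t _ => hf.2.1 ⟨t, rfl⟩) ?_
  intro f hf g hg h0 hfg
  by_contra! hlt
  refine hg.2.2.2.2 f.len hf.2.2.1 hlt ?_
  have h3 := (hf.1.initial_segment hg.1 h0 hfg).2 f.len
  rw [min_self] at h3
  rw [← h3, hf.1.apply_len]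
  exact hf.2.2.2.1

/-- The points of `S` whose path component meets `C`. -/
def hittingSet (S C : Set Plane) : Set Plane := {x | ∃ y ∈ C, JoinedIn S x y}

theorem exists_mem_stoppedArcs {S C : Set Plane} (hC : IsClosed C) {x : Plane}
    (hx : x ∈ hittingSet S C) : ∃ f ∈ stoppedArcs S C 0, f 0 = x := by
  obtain ⟨y, hy, hxy⟩ := hx
  obtain ⟨f, hf, hfH, rfl, rfl⟩ := hxy.exists_isArcCode
  obtain ⟨g, hg, hgf, hg0, hg1, hgt⟩ := hf.exists_first_hit (hC.preimage f.continuous) ⟨1, hy⟩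
  exact ⟨g, ⟨hg, hgf.trans hfH, unitInterval.nonneg', hg1, fun t _ => hgt t⟩, hg0⟩

theorem measurableSet_hittingSet {S C : Set Plane} (hS : TriodFree S)
    (hSm : MeasurableSet {f : Curve | Set.range f ⊆ S}) (hC : IsClosed C) :
    MeasurableSet (hittingSet S C) := by
  convert (atMostTwo_stoppedArcs hS C 0).measurableSet_image (measurableSet_stoppedArcs hSm hC 0)
    (Curve.measurable_eval 0)
  ext x
  constructor
  · exact exists_mem_stoppedArcs hC
  · rintro ⟨f, hf, rfl⟩
    exact ⟨f 1, hf.2.2.2.1, (joinedIn_range f 0 1).mono hf.2.1⟩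

theorem exists_measurable_retraction {S C : Set Plane} (hS : TriodFree S)
    (hSm : MeasurableSet {f : Curve | Set.range f ⊆ S}) (hC : IsClosed C) :
    ∃ π : Plane → Plane, Measurable π ∧ ∀ x ∈ hittingSet S C, π x ∈ C ∧ JoinedIn S x (π x) := by
  obtain ⟨g, hg, h⟩ := exists_measurable_enumeration (ι := Unit)
    (fun _ => measurableSet_stoppedArcs hSm hC 0) (Curve.measurable_eval 0)
    (Curve.measurable_eval 1) fun _ => atMostTwo_stoppedArcs hS C 0
  refine ⟨g 0, hg 0, fun x hx => ?_⟩
  obtain ⟨f, hf, hfx⟩ := exists_mem_stoppedArcs hC hx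
  obtain ⟨-, f', hf', rfl, hf1⟩ := (h x ⟨(), f, hf, hfx⟩ _).1 ⟨0, rfl⟩
  rw [← hf1]
  exact ⟨hf'.2.2.2.1, (joinedIn_range f' 0 1).mono hf'.2.1⟩

/-- The last parameter at which a curve hits `C`. -/
noncomputable def lastHit (C : Set Plane) (f : Curve) : unitInterval := sSup {t | f t ∈ C}

theorem measurable_lastHit {C : Set Plane} (hC : IsClosed C) : Measurable (lastHit C) := by
  refine measurable_of_Ici fun a => ?_
  rcases (unitInterval.nonneg' (t := a)).eq_or_lt with rfl | ha
  · convert MeasurableSet.univ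
    exact Set.eq_univ_of_forall fun f => unitInterval.nonneg'
  · convert (isClosed_exists_mem_Icc hC a 1).measurableSet
    ext f
    constructor
    · intro h
      by_cases hne : {t | f t ∈ C}.Nonempty
      · obtain ⟨t, ht, hl⟩ := (hC.preimage f.continuous).isCompact.exists_isGreatest hne
        refine ⟨t, ?_, unitInterval.le_one', ht⟩
        have h1 : lastHit C f = t := IsGreatest.csSup_eq ⟨ht, hl⟩
        rw [← h1]
        exact h
      · rw [Set.not_nonempty_iff_eq_empty] at hne
        have h1 : a ≤ sSup {t | f t ∈ C} := h
        rw [hne, sSup_empty] at h1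
        exact absurd h1 ha.not_ge
    · rintro ⟨t, hat, -, ht⟩
      exact hat.trans (le_sSup (show t ∈ {t | f t ∈ C} from ht))

theorem IsGreatest.lastHit_eq {C : Set Plane} {f : Curve} {t : unitInterval}
    (h : IsGreatest {t | f t ∈ C} t) : lastHit C f = t := h.csSup_eq

theorem measurable_apply_lastHit {C : Set Plane} (hC : IsClosed C) :
    Measurable fun f : Curve => f (lastHit C f) :=
  (continuous_eval (F := Curve)).measurable.comp (measurable_id.prodMk (measurable_lastHit hC))

/-! ### Crossings from one closed set to another -/

/-- The arc `k` in `S` starts in `A`, ends in `B`, and meets `A ∪ B` only at its endpoints. -/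
structure IsCrossing (S A B : Set Plane) (k : Curve) : Prop where
  isArcCode : IsArcCode k
  range_subset : Set.range k ⊆ S
  start_mem : k 0 ∈ A
  end_mem : k 1 ∈ B
  eq_start : ∀ t, k t ∈ A → k t = k 0
  eq_end : ∀ t, k t ∈ B → k t = k 1

theorem exists_isCrossing_of_injOn {S A B : Set Plane} {f : Curve} {a b : unitInterval}
    (hf : Set.InjOn f (Set.uIcc a b)) (hfS : Set.range f ⊆ S) (ha : f a ∈ A) (hb : f b ∈ B)
    (hA : ∀ t ∈ Set.uIcc a b, f t ∈ A → t = a) (hB : ∀ t ∈ Set.uIcc a b, f t ∈ B → t = b) :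
    ∃ k, IsCrossing S A B k ∧ Set.range k = f '' Set.uIcc a b ∧ k 0 = f a ∧ k 1 = f b := by
  obtain ⟨k, hk, hr, h0, h1⟩ := exists_isArcCode_of_injOn hf
  have hm : ∀ t, ∃ s ∈ Set.uIcc a b, f s = k t := fun t => by
    rw [← Set.mem_image, ← hr]
    exact ⟨t, rfl⟩
  refine ⟨k, ⟨hk, ?_, h0 ▸ ha, h1 ▸ hb, fun t ht => ?_, fun t ht => ?_⟩, hr, h0, h1⟩
  · rw [hr]
    exact (Set.image_subset_range _ _).trans hfS
  · obtain ⟨s, hs, h⟩ := hm t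
    rw [← h] at ht ⊢
    rw [hA s hs ht, h0]
  · obtain ⟨s, hs, h⟩ := hm t
    rw [← h] at ht ⊢
    rw [hB s hs ht, h1]

theorem IsCrossing.exists_reverse {S A B : Set Plane} {k : Curve} (h : IsCrossing S A B k) :
    ∃ k', IsCrossing S B A k' ∧ Set.range k' = Set.range k ∧ k' 0 = k 1 ∧ k' 1 = k 0 := by
  have hm : ∀ t ∈ Set.uIcc k.len 0, t ≤ k.len := fun t ht => by
    rw [Set.uIcc_of_ge unitInterval.nonneg'] at ht
    exact ht.2
  have hinj := h.isArcCode.injOn_uIcc le_rfl (unitInterval.nonneg' (t := k.len))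
  have hl := h.isArcCode.apply_len
  obtain ⟨k', h1, hr, h2, h3⟩ := exists_isCrossing_of_injOn (S := S) (A := B) (B := A)
    hinj h.range_subset (hl ▸ h.end_mem) h.start_mem
    (fun t ht htB => hinj ht Set.left_mem_uIcc ((h.eq_end t htB).trans hl.symm))
    (fun t ht htA => hinj ht Set.right_mem_uIcc (h.eq_start t htA))
  refine ⟨k', h1, ?_, h2.trans hl, h3⟩
  rw [hr, h.isArcCode.range_eq, Set.uIcc_of_ge unitInterval.nonneg']

theorem IsCrossing.eq_zero {S A B : Set Plane} {k : Curve} (h : IsCrossing S A B k)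
    {t : unitInterval} (ht : t ≤ k.len) (htA : k t ∈ A) : t = 0 :=
  h.isArcCode.injOn ⟨unitInterval.nonneg', ht⟩ ⟨le_rfl, unitInterval.nonneg'⟩ (h.eq_start t htA)

theorem exists_isCrossing {S A B : Set Plane} {f : Curve} (hf : IsArcCode f)
    (hfS : Set.range f ⊆ S) {r : unitInterval} (hB : f 1 ∈ B)
    (hfB : ∀ t, r ≤ t → t < f.len → f t ∉ B) (hA : IsClosed A) (hAB : Disjoint A B)
    (hfA : ∃ t, r ≤ t ∧ f t ∈ A) :
    ∃ α, IsGreatest {t | f t ∈ A} α ∧ α < f.len ∧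
      ∃ k, IsCrossing S A B k ∧ k 0 = f α ∧ k 1 = f 1 := by
  obtain ⟨t, hrt, htA⟩ := hfA
  obtain ⟨α, hα, hl⟩ := (hA.preimage f.continuous).isCompact.exists_isGreatest ⟨t, htA⟩
  have hrα : r ≤ α := hrt.trans (hl htA)
  have hlt : α < f.len := by
    by_contra! h
    have h1 := hf.apply_of_len_le h
    refine Set.disjoint_left.1 hAB hα ?_
    rw [h1]
    exact hB
  have hu : Set.uIcc α f.len = Set.Icc α f.len := Set.uIcc_of_le hlt.le
  have hinj := hf.injOn_uIcc hlt.le le_rfl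
  have hA' : ∀ t ∈ Set.uIcc α f.len, f t ∈ A → t = α := fun t ht htA => by
    rw [hu] at ht
    exact le_antisymm (hl htA) ht.1
  have hB' : ∀ t ∈ Set.uIcc α f.len, f t ∈ B → t = f.len := fun t ht htB => by
    rw [hu] at ht
    by_contra hne
    exact hfB t (hrα.trans ht.1) (lt_of_le_of_ne ht.2 hne) htB
  obtain ⟨k, h1, -, h2, h3⟩ := exists_isCrossing_of_injOn hinj hfS hα
    (hf.apply_len.symm ▸ hB) hA' hB'
  exact ⟨α, ⟨hα, hl⟩, hlt, k, h1, h2, h3.trans hf.apply_len⟩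

/-- The starting points of the crossings in the path component of `x`. -/
def crossingStarts (S A B : Set Plane) (x : Plane) : Set Plane :=
  {w | JoinedIn S x w ∧ ∃ k, IsCrossing S A B k ∧ k 0 = w}

theorem crossingStarts_eq {S A B : Set Plane} {x y : Plane} (h : JoinedIn S x y) :
    crossingStarts S A B x = crossingStarts S A B y :=
  Set.ext fun _ => and_congr_left fun _ => ⟨fun h' => h.symm.trans h', fun h' => h.trans h'⟩

theorem crossingStarts_nonempty_iff {S A B : Set Plane} (hA : IsClosed A) (hB : IsClosed B)
    (hAB : Disjoint A B) {x : Plane} :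
    (crossingStarts S A B x).Nonempty ↔ x ∈ hittingSet S A ∧ x ∈ hittingSet S B := by
  constructor
  · rintro ⟨w, hw, k, hk, rfl⟩
    exact ⟨⟨_, hk.start_mem, hw⟩, _, hk.end_mem,
      hw.trans ((joinedIn_range k 0 1).mono hk.range_subset)⟩
  · rintro ⟨⟨u, hu, hxu⟩, v, hv, hxv⟩
    obtain ⟨f, hf, hf0⟩ := exists_mem_stoppedArcs hB ⟨v, hv, hxu.symm.trans hxv⟩
    obtain ⟨α, -, -, k, hk, hk0, -⟩ := exists_isCrossing hf.1 hf.2.1 hf.2.2.2.1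
      hf.2.2.2.2 hA hAB ⟨0, le_rfl, hf0 ▸ hu⟩
    refine ⟨f α, ?_, k, hk, hk0⟩
    rw [← hf0] at hxu
    exact hxu.trans ((joinedIn_range f 0 α).mono hf.2.1)

theorem IsCrossing.exists_stoppedArc {S A B : Set Plane} (hB : IsClosed B) (hAB : Disjoint A B)
    {g k : Curve} (hk : IsCrossing S A B k) (hg : IsArcCode g) (hgS : Set.range g ⊆ S)
    (h : g 1 = k 0) (hd : ∀ t < g.len, g t ∉ Set.range k) :
    ∃ r, IsRat r ∧ ∃ f ∈ stoppedArcs S B r, f 0 = g 0 ∧ f 1 = k 1 ∧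
      ∃ α, r ≤ α ∧ f α = k 0 ∧ IsGreatest {t | f t ∈ A} α := by
  obtain ⟨f, hf, hfr, hf0, hf1⟩ := hg.exists_append hk.isArcCode h (by
    intro s t hst
    rcases lt_or_ge s g.len with hs | hs
    · exact absurd ⟨t, hst.symm⟩ (hd s hs)
    · exact hg.apply_of_len_le hs)
  obtain ⟨hl, hgf⟩ := hg.initial_segment hf hf0.symm (by rw [hfr]; exact Set.subset_union_left)
  have hα : f g.len = k 0 := by
    have := hgf g.len
    rw [min_self, hg.apply_len] at this
    rw [← this, h]
  have hafter : ∀ t, g.len < t → t ≤ f.len → f t ∈ Set.range k := by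
    intro t ht htl
    have : f t ∈ Set.range g ∪ Set.range k := hfr ▸ ⟨t, rfl⟩
    refine this.resolve_left ?_
    rintro ⟨s, hs⟩
    rw [hgf s] at hs
    have := hf.injOn ⟨unitInterval.nonneg', (min_le_right _ _).trans hl⟩
      ⟨unitInterval.nonneg', htl⟩ hs
    exact (this ▸ ht).not_ge (min_le_right _ _)
  have hinj : ∀ t ≤ f.len, ∀ s ≤ f.len, f t = f s → t = s := fun t ht s hs hts =>
    hf.injOn ⟨unitInterval.nonneg', ht⟩ ⟨unitInterval.nonneg', hs⟩ hts
  have hBt : ∀ t, g.len ≤ t → t < f.len → f t ∉ B := by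
    intro t ht htl htB
    rcases ht.eq_or_lt with rfl | ht
    · exact Set.disjoint_left.1 hAB hk.start_mem (hα ▸ htB)
    · obtain ⟨s, hs⟩ := hafter t ht htl.le
      rw [← hs] at htB
      have h1 := hk.eq_end s htB
      rw [hs, ← hf1, ← hf.apply_len] at h1
      exact htl.ne (hinj t htl.le _ le_rfl h1)
  have hgr : IsGreatest {t | f t ∈ A} g.len := by
    refine ⟨(hα.symm ▸ hk.start_mem : f g.len ∈ A), fun t ht => ?_⟩
    by_contra! hlt
    rcases le_or_gt t f.len with htl | htl
    · obtain ⟨s, hs⟩ := hafter t hlt htl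
      have h1 := hk.eq_start s (by rw [hs]; exact ht)
      rw [hs, ← hα] at h1
      exact hlt.ne' (hinj t htl _ hl h1)
    · have h1 : f t ∈ A := ht
      rw [hf.apply_of_len_le htl.le, hf1] at h1
      exact Set.disjoint_left.1 hAB h1 hk.end_mem
  have hr : ∃ r, IsRat r ∧ r ≤ g.len ∧ ∀ t, r ≤ t → t < g.len → f t ∉ B := by
    rcases (unitInterval.nonneg' (t := g.len)).eq_or_lt with h0 | h0
    · exact ⟨0, ⟨0, by simp⟩, unitInterval.nonneg',
        fun t _ ht => absurd (h0 ▸ ht) unitInterval.nonneg'.not_gt⟩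
    · have hn : f ⁻¹' Bᶜ ∈ nhds g.len := (hB.isOpen_compl.preimage f.continuous).mem_nhds
        fun h => Set.disjoint_left.1 hAB hk.start_mem (hα ▸ h)
      obtain ⟨l, hl0, hls⟩ := exists_Ioc_subset_of_mem_nhds hn ⟨0, h0⟩
      obtain ⟨r, hrr, hlr, hrg⟩ := exists_isRat_between hl0
      exact ⟨r, hrr, hrg.le, fun t hrt htg => hls ⟨hlr.trans_le hrt, htg.le⟩⟩
  obtain ⟨r, hrr, hrg, hrB⟩ := hr
  refine ⟨r, hrr, f, ⟨hf, ?_, hrg.trans hl, hf1 ▸ hk.end_mem, fun t hrt htl => ?_⟩, hf0, hf1,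
    g.len, hrg, hα, hgr⟩
  · rw [hfr]
    exact Set.union_subset hgS hk.range_subset
  · rcases lt_or_ge t g.len with h1 | h1
    · exact hrB t hrt h1
    · exact hBt t h1 htl

theorem TriodFree.exists_arc_to_crossing {S A B : Set Plane} (hS : TriodFree S) {u w : Plane}
    (hu : u ∈ A) (huw : JoinedIn S u w) {k : Curve} (hk : IsCrossing S A B k) (hkw : k 0 = w) :
    ∃ g, IsArcCode g ∧ Set.range g ⊆ S ∧ g 0 = u ∧ (∀ t < g.len, g t ∉ Set.range k) ∧
      (g 1 = k 0 ∨ g 1 = k 1) := by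
  obtain ⟨f, hf, hfS, rfl, rfl⟩ := huw.exists_isArcCode
  obtain ⟨g, hg, hgf, hg0, ⟨γ', hγ'⟩, hgk⟩ := hf.exists_first_hit
    (k.isClosed_range.preimage f.continuous) ⟨1, 0, hkw⟩
  refine ⟨g, hg, hgf.trans hfS, hg0, hgk, ?_⟩
  obtain ⟨γ, hγl, hγ⟩ : ∃ γ ≤ k.len, k γ = g 1 :=
    ⟨min γ' k.len, min_le_right _ _, by rw [hk.isArcCode.apply_min, hγ']⟩
  by_contra! hne
  have hγ0 : 0 < γ := lt_of_le_of_ne unitInterval.nonneg' fun h => hne.1 (by rw [← hγ, ← h])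
  have hγ1 : γ < k.len := lt_of_le_of_ne hγl fun h =>
    hne.2 (by rw [← hγ, h, hk.isArcCode.apply_len])
  have hl : 0 < g.len := by
    refine lt_of_le_of_ne unitInterval.nonneg' fun h => ?_
    have h1 := hg.apply_eq_of_len_eq_zero h.symm 1
    refine hγ0.ne' (hk.eq_zero hγl ?_)
    rwa [hγ, h1, hg0]
  have hi : ∀ {s t}, s ≤ k.len → t ≤ k.len → k s = k t → s = t := fun hs ht h =>
    hk.isArcCode.injOn ⟨unitInterval.nonneg', hs⟩ ⟨unitInterval.nonneg', ht⟩ h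
  have hgu : ∀ t ∈ Set.uIcc g.len 0, t ≠ g.len → t < g.len := fun t ht hne => by
    rw [Set.uIcc_of_ge unitInterval.nonneg'] at ht
    exact lt_of_le_of_ne ht.2 hne
  refine hS.false_of_legs (c := g 1) (f₁ := g) (f₂ := k) (f₃ := k) hl.ne' hγ0.ne' hγ1.ne
    (hg.injOn_uIcc le_rfl unitInterval.nonneg') (hk.isArcCode.injOn_uIcc hγl unitInterval.nonneg')
    (hk.isArcCode.injOn_uIcc hγl le_rfl) hg.apply_len hγ hγ
    (fun t _ => hfS (hgf ⟨t, rfl⟩)) (fun t _ => hk.range_subset ⟨t, rfl⟩)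
    (fun t _ => hk.range_subset ⟨t, rfl⟩)
    (fun t ht htn v _ h => hgk t (hgu t ht htn) ⟨v, h.symm⟩)
    (fun t ht htn v _ h => hgk t (hgu t ht htn) ⟨v, h.symm⟩) ?_
  intro s hs hsn t ht hst
  rw [Set.uIcc_of_ge unitInterval.nonneg'] at hs
  rw [Set.uIcc_of_le hγl] at ht
  have := hi (hs.2.trans hγl) ht.2 hst
  exact hsn (le_antisymm hs.2 (this ▸ ht.1))

theorem exists_measurable_crossingStarts {S A B : Set Plane} (hS : TriodFree S)
    (hSm : MeasurableSet {f : Curve | Set.range f ⊆ S}) (hA : IsClosed A) (hB : IsClosed B)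
    (hAB : Disjoint A B) :
    ∃ g : ℕ → Plane → Plane, (∀ j, Measurable (g j)) ∧
      ∀ x, (crossingStarts S A B x).Nonempty → ∀ w, (∃ j, g j x = w) ↔ w ∈ crossingStarts S A B x := by
  obtain ⟨π, hπ, hπx⟩ := exists_measurable_retraction hS hSm hA
  set Φ : {r // IsRat r} ⊕ {r // IsRat r} → Set Curve := Sum.elim
    (fun r => stoppedArcs S B r.1 ∩ {f | ∃ t, r.1 ≤ t ∧ t ≤ 1 ∧ f t ∈ A})
    (fun r => stoppedArcs S A r.1 ∩ {f | ∃ t, r.1 ≤ t ∧ t ≤ 1 ∧ f t ∈ B}) with hΦ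
  have : Countable {r // IsRat r} := countable_isRat.to_subtype
  have hmono : ∀ {Ψ Ψ' : Set Curve}, AtMostTwo (fun f : Curve => f 0) Ψ → Ψ' ⊆ Ψ →
      AtMostTwo (fun f : Curve => f 0) Ψ' := fun h hs x hx y hy z hz =>
    h x (hs hx) y (hs hy) z (hs hz)
  obtain ⟨g, hg, h⟩ := exists_measurable_enumeration (A := Φ) (by
      rintro (r | r)
      · exact (measurableSet_stoppedArcs hSm hB _).inter
          (isClosed_exists_mem_Icc hA _ _).measurableSet
      · exact (measurableSet_stoppedArcs hSm hA _).inter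
          (isClosed_exists_mem_Icc hB _ _).measurableSet)
    (Curve.measurable_eval 0) (measurable_apply_lastHit hA) (by
      rintro (r | r)
      · exact hmono (atMostTwo_stoppedArcs hS B _) Set.inter_subset_left
      · exact hmono (atMostTwo_stoppedArcs hS A _) Set.inter_subset_left)
  have hsound : ∀ i, ∀ f ∈ Φ i, f (lastHit A f) ∈ crossingStarts S A B (f 0) := by
    rintro (r | r) f ⟨⟨h1, h2, -, h4, h5⟩, t, hrt, -, ht⟩
    · obtain ⟨α, hα, -, k, hk, hk0, -⟩ := exists_isCrossing h1 h2 h4 h5 hA hAB ⟨t, hrt, ht⟩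
      rw [hα.lastHit_eq]
      exact ⟨(joinedIn_range f 0 α).mono h2, k, hk, hk0⟩
    · obtain ⟨α, -, -, k, hk, -, hk1⟩ :=
        exists_isCrossing h1 h2 h4 h5 hB hAB.symm ⟨t, hrt, ht⟩
      obtain ⟨k', hk', -, hk0, -⟩ := hk.exists_reverse
      rw [IsGreatest.lastHit_eq ⟨h4, fun t _ => unitInterval.le_one'⟩]
      exact ⟨(joinedIn_range f 0 1).mono h2, k', hk', hk0.trans hk1⟩
  have hcomplete : ∀ u ∈ A, ∀ w ∈ crossingStarts S A B u,
      ∃ i, ∃ f ∈ Φ i, f 0 = u ∧ f (lastHit A f) = w := by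
    rintro u hu w ⟨huw, k, hk, hkw⟩
    obtain ⟨g, hg, hgS, hg0, hd, h | h⟩ := hS.exists_arc_to_crossing hu huw hk hkw
    · obtain ⟨r, hr, f, hf, hf0, hf1, α, hα, hfα, hgr⟩ := hk.exists_stoppedArc hB hAB hg hgS h hd
      refine ⟨Sum.inl ⟨r, hr⟩, f, ⟨hf, α, hα, unitInterval.le_one', hgr.1⟩, hf0.trans hg0, ?_⟩
      rw [hgr.lastHit_eq, hfα, hkw]
    · obtain ⟨k', hk', hkr, hk0, hk1⟩ := hk.exists_reverse
      obtain ⟨r, hr, f, hf, hf0, hf1, α, hα, hfα, hgr⟩ := hk'.exists_stoppedArc hA hAB.symm hg hgS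
        (h.trans hk0.symm) (hkr ▸ hd)
      refine ⟨Sum.inr ⟨r, hr⟩, f, ⟨hf, α, hα, unitInterval.le_one', hgr.1⟩, hf0.trans hg0, ?_⟩
      rw [IsGreatest.lastHit_eq ⟨hf.2.2.2.1, fun t _ => unitInterval.le_one'⟩, hf1, hk1, hkw]
  refine ⟨fun j x => g j (π x), fun j => (hg j).comp hπ, fun x hx w => ?_⟩
  obtain ⟨h1, h2⟩ := hπx x ((crossingStarts_nonempty_iff hA hB hAB).1 hx).1
  rw [crossingStarts_eq h2] at hx ⊢
  obtain ⟨w', hw'⟩ := hx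
  obtain ⟨i, f, hf, hf0, -⟩ := hcomplete _ h1 w' hw'
  rw [h _ ⟨i, f, hf, hf0⟩]
  constructor
  · rintro ⟨i, f, hf, hf0, rfl⟩
    rw [← hf0]
    exact hsound i f hf
  · exact hcomplete _ h1 w

/-! ### Betweenness of crossings -/

theorem TriodFree.atMostTwo_endpoints {S : Set Plane} (hS : TriodFree S) :
    AtMostTwo (fun f : Curve => (f 0, f 1)) {f | IsArcCode f ∧ Set.range f ⊆ S} := by
  intro f hf g hg h hh hfg hgh
  rw [Prod.mk.injEq] at hfg hgh
  have key : AtMostTwo (fun f : Curve => f 0)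
      {k | IsArcCode k ∧ Set.range k ⊆ S ∧ k 1 = f 1} := by
    refine hS.atMostTwo (fun k hk => hk.1) (fun k hk t _ => hk.2.1 ⟨t, rfl⟩) ?_
    intro k hk l hl h0 hr
    obtain ⟨h1, h2⟩ := hk.1.initial_segment hl.1 h0 hr
    have h3 := h2 1
    rw [min_eq_right unitInterval.le_one', hk.2.2, ← hl.2.2, ← hl.1.apply_len] at h3
    exact (hl.1.injOn ⟨unitInterval.nonneg', le_rfl⟩ ⟨unitInterval.nonneg', h1⟩ h3).le
  exact key f ⟨hf.1, hf.2, rfl⟩ g ⟨hg.1, hg.2, hfg.2.symm⟩ h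
    ⟨hh.1, hh.2, (hfg.2.trans hgh.2).symm⟩ hfg.1 hgh.1

/-- The point `w` lies on some arc in `S` from `u` to `v`. -/
def ArcBetween (S : Set Plane) (u w v : Plane) : Prop :=
  ∃ f : Curve, IsArcCode f ∧ Set.range f ⊆ S ∧ f 0 = u ∧ f 1 = v ∧ w ∈ Set.range f

theorem TriodFree.measurableSet_arcBetween {S : Set Plane} (hS : TriodFree S)
    (hSm : MeasurableSet {f : Curve | Set.range f ⊆ S}) :
    MeasurableSet {p : Plane × Plane × Plane | ArcBetween S p.1 p.2.1 p.2.2} := by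
  set Φ : Set (Curve × Plane) := Prod.fst ⁻¹' {f | IsArcCode f ∧ Set.range f ⊆ S} ∩
    {p | ∃ t, p.1 t = p.2} with hΦ
  have hc : IsClosed {p : Curve × Plane | ∃ t, p.1 t = p.2} := by
    refine isClosed_exists_mem (Z := {z : (Curve × Plane) × unitInterval | z.1.1 z.2 = z.1.2}) ?_
    refine isClosed_eq ?_ (by fun_prop)
    exact continuous_eval.comp ((continuous_fst.comp continuous_fst).prodMk continuous_snd)
  have h2 : AtMostTwo (fun p : Curve × Plane => (p.1 0, p.2, p.1 1)) Φ := by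
    rintro ⟨f, a⟩ hf ⟨g, b⟩ hg ⟨h, c⟩ hh hfg hgh
    simp only [Prod.mk.injEq] at hfg hgh ⊢
    obtain ⟨h1, rfl, h2⟩ := hfg
    obtain ⟨h3, rfl, h4⟩ := hgh
    have := hS.atMostTwo_endpoints f hf.1 g hg.1 h hh.1 (Prod.ext h1 h2) (Prod.ext h3 h4)
    simpa using this
  convert h2.measurableSet_image
    ((measurable_fst (measurableSet_isArcCode.inter hSm)).inter hc.measurableSet)
    (((Curve.measurable_eval 0).comp measurable_fst).prodMk
      (measurable_snd.prodMk ((Curve.measurable_eval 1).comp measurable_fst)))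
  ext ⟨x, w, y⟩
  constructor
  · rintro ⟨f, hf, hfS, rfl, rfl, hw⟩
    exact ⟨(f, w), ⟨⟨hf, hfS⟩, hw⟩, rfl⟩
  · rintro ⟨⟨f, w'⟩, ⟨⟨hf, hfS⟩, hw⟩, h⟩
    obtain ⟨rfl, h'⟩ := Prod.ext_iff.1 h
    obtain ⟨rfl, rfl⟩ := Prod.ext_iff.1 h'
    exact ⟨f, hf, hfS, rfl, rfl, hw⟩

/-- The vertical line with first coordinate `a`. -/
def vline (a : ℝ) : Set Plane := {z | z.1 = a}

theorem isClosed_vline (a : ℝ) : IsClosed (vline a) := isClosed_eq continuous_fst continuous_const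

theorem disjoint_vline {a b : ℝ} (h : a ≠ b) : Disjoint (vline a) (vline b) :=
  Set.disjoint_left.2 fun _ h1 h2 => h (h1.symm.trans h2)

theorem TriodFree.finite_crossings {S : Set Plane} (hS : TriodFree S) {p q : ℝ} (hpq : p < q)
    {ψ : Curve} (hψS : Set.range ψ ⊆ S) {I : Set unitInterval} (hI : I.OrdConnected)
    (hψ : Set.InjOn ψ I) :
    {t | t ∈ I ∧ ∃ k, IsCrossing S (vline p) (vline q) k ∧ k 0 = ψ t}.Finite := by
  set T : Set unitInterval := {t | t ∈ I ∧ ∃ k, IsCrossing S (vline p) (vline q) k ∧ k 0 = ψ t}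
  suffices h : (T ∩ Set.univ).Finite by rwa [Set.inter_univ] at h
  refine isCompact_univ.induction_on (p := fun s => (T ∩ s).Finite) (by simp)
    (fun s t hst ht => ht.subset (Set.inter_subset_inter_right _ hst))
    (fun s t hs ht => by rw [Set.inter_union_distrib_left]; exact hs.union ht) ?_
  intro t₀ _
  have hn : {t | |(ψ t).1 - (ψ t₀).1| < (q - p) / 2} ∈ nhds t₀ := by
    refine (isOpen_lt ?_ continuous_const).mem_nhds ?_
    · exact ((continuous_fst.comp ψ.continuous).sub continuous_const).abs
    · change |(ψ t₀).1 - (ψ t₀).1| < _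
      rw [sub_self, abs_zero]
      linarith
  obtain ⟨b, c, -, hbc, hs⟩ := exists_Icc_mem_subset_of_mem_nhds hn
  refine ⟨Set.Icc b c, mem_nhdsWithin_of_mem_nhds hbc, ?_⟩
  by_contra hinf
  obtain ⟨F, hF, hF3⟩ := Set.Infinite.exists_subset_card_eq hinf 3
  set e := F.orderEmbOfFin hF3
  have he : ∀ i, e i ∈ T ∩ Set.Icc b c := fun i => hF (F.orderEmbOfFin_mem hF3 i)
  have hlt : ∀ {i j}, i < j → e i < e j := fun h => e.strictMono h
  obtain ⟨k, hk, hk0⟩ := (he 1).1.2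
  have hsub : Set.Icc (e 0) (e 2) ⊆ I := hI.out (he 0).1.1 (he 2).1.1
  have hnot : ∀ i, i ≠ 1 → ψ (e i) ∉ Set.range k := by
    rintro i hi ⟨s, hs⟩
    have h1 : k s ∈ vline p := by
      obtain ⟨k', hk', hk0'⟩ := (he i).1.2
      rw [hs, ← hk0']
      exact hk'.start_mem
    have h2 := hk.eq_start s h1
    rw [hs, hk0] at h2
    exact hi (e.injective (hψ (he i).1.1 (he 1).1.1 h2))
  have hr := hS.range_subset_of_mem (hlt (i := 0) (j := 1) (by decide))
    (hlt (i := 1) (j := 2) (by decide)) (hψ.mono hsub) (fun t _ => hψS ⟨t, rfl⟩) hk.isArcCode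
    hk.range_subset hk0 (hnot 0 (by decide)) (hnot 2 (by decide))
  have hclose : ∀ t, |(k t).1 - (ψ t₀).1| < (q - p) / 2 := by
    intro t
    obtain ⟨s, hs', h⟩ := hr ⟨t, rfl⟩
    rw [← h]
    exact hs ⟨(he 0).2.1.trans hs'.1, hs'.2.trans (he 2).2.2⟩
  have h0 := hclose 0
  have h1 := hclose 1
  have h2 : (k 0).1 = p := hk.start_mem
  have h3 : (k 1).1 = q := hk.end_mem
  rw [h2, abs_lt] at h0
  rw [h3, abs_lt] at h1
  linarith [h0.1, h1.2]

/-- If a triod-free component has infinitely many crossings between two vertical lines, then their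
starting points are ordered like a set of integers. -/
theorem TriodFree.exists_order_crossingStarts {S : Set Plane} (hS : TriodFree S) {p q : ℝ}
    (hpq : p < q) {x : Plane} (hinf : (crossingStarts S (vline p) (vline q) x).Infinite) :
    ∃ τ : Plane → ℝ, Set.InjOn τ (crossingStarts S (vline p) (vline q) x) ∧
      (∀ u ∈ crossingStarts S (vline p) (vline q) x, ∀ w ∈ crossingStarts S (vline p) (vline q) x,
        ∀ v ∈ crossingStarts S (vline p) (vline q) x,
          ArcBetween S u w v ↔ τ w ∈ Set.uIcc (τ u) (τ v)) ∧
      ∀ u ∈ crossingStarts S (vline p) (vline q) x, ∀ v ∈ crossingStarts S (vline p) (vline q) x,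
        {w | w ∈ crossingStarts S (vline p) (vline q) x ∧ ArcBetween S u w v}.Finite := by
  set D := crossingStarts S (vline p) (vline q) x with hD
  have hx : x ∈ S := by
    obtain ⟨w, hw⟩ := hinf.nonempty
    exact hw.1.mem.1
  rcases hS.circle_or_line hx with ⟨ψ, hψ, hr⟩ | ⟨K, φ, h⟩
  · exfalso
    have hψS : Set.range ψ ⊆ S := hr ▸ fun y hy => JoinedIn.mem hy |>.2
    refine hinf (((hS.finite_crossings hpq hψS Set.ordConnected_Iio hψ.2).image ψ).subset ?_)
    rintro w ⟨hw, hk⟩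
    have h1 : w ∈ ψ '' Set.Iio 1 := by
      rw [hψ.image_Iio, hr]
      exact hw
    obtain ⟨t, ht, rfl⟩ := h1
    exact ⟨t, ⟨ht, hk⟩, rfl⟩
  · set τ := Function.invFunOn φ K
    have hτ : ∀ w ∈ D, τ w ∈ K ∧ φ (τ w) = w := by
      intro w hw
      have h1 : w ∈ φ '' K := by
        rw [h.image_eq]
        exact hw.1
      exact ⟨Function.invFunOn_mem h1, Function.invFunOn_eq h1⟩
    have hcode : ∀ u ∈ D, ∀ v ∈ D, ∃ f : Curve, IsArcCode f ∧ Set.range f ⊆ S ∧ f 0 = u ∧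
        f 1 = v := fun u hu v hv => (hu.1.symm.trans hv.1).exists_isArcCode
    have hrange : ∀ u ∈ D, ∀ v ∈ D, ∀ f : Curve, IsArcCode f → Set.range f ⊆ S → f 0 = u →
        f 1 = v → Set.range f = φ '' Set.uIcc (τ u) (τ v) := by
      intro u hu v hv f hf hfS h0 h1
      exact h.range_eq _ (hτ u hu).1 _ (hτ v hv).1 f hf hfS (h0.trans (hτ u hu).2.symm)
        (h1.trans (hτ v hv).2.symm)
    refine ⟨τ, ?_, ?_, ?_⟩
    · intro u hu v hv huv
      rw [← (hτ u hu).2, huv, (hτ v hv).2]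
    · intro u hu w hw v hv
      constructor
      · rintro ⟨f, hf, hfS, h0, h1, hwf⟩
        rw [hrange u hu v hv f hf hfS h0 h1] at hwf
        obtain ⟨s, hs, hsw⟩ := hwf
        have h2 := h.injOn (h.ordConnected.uIcc_subset (hτ u hu).1 (hτ v hv).1 hs) (hτ w hw).1
          (hsw.trans (hτ w hw).2.symm)
        rwa [← h2]
      · intro hwu
        obtain ⟨f, hf, hfS, h0, h1⟩ := hcode u hu v hv
        refine ⟨f, hf, hfS, h0, h1, ?_⟩
        rw [hrange u hu v hv f hf hfS h0 h1]
        exact ⟨_, hwu, (hτ w hw).2⟩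
    · intro u hu v hv
      obtain ⟨f, hf, hfS, h0, h1⟩ := hcode u hu v hv
      refine ((hS.finite_crossings hpq hfS Set.ordConnected_Icc hf.injOn).image f).subset ?_
      rintro w ⟨hw, g, hg, hgS, hg0, hg1, hwg⟩
      rw [hrange u hu v hv g hg hgS hg0 hg1, ← hrange u hu v hv f hf hfS h0 h1, hf.range_eq] at hwg
      obtain ⟨t, ht, rfl⟩ := hwg
      exact ⟨t, ⟨ht, hw.2⟩, rfl⟩

/-! ### Borel relations with ordered countable sections -/

theorem measurableSet_setOf_exists {X ι : Type*} [MeasurableSpace X] [Countable ι]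
    {p : ι → X → Prop} (h : ∀ i, MeasurableSet {x | p i x}) : MeasurableSet {x | ∃ i, p i x} := by
  convert MeasurableSet.iUnion h
  ext
  simp

theorem measurableSet_setOf_forall {X ι : Type*} [MeasurableSpace X] [Countable ι]
    {p : ι → X → Prop} (h : ∀ i, MeasurableSet {x | p i x}) : MeasurableSet {x | ∀ i, p i x} := by
  convert MeasurableSet.iInter h
  ext
  simp

/-- The set of values at `x` of a sequence of functions. -/
def valueSet {P : Type} (g : ℕ → P → P) (x : P) : Set P := Set.range fun j => g j x

theorem measurableSet_inter_valueSet_nonempty {P : Type}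
    [MeasurableSpace P] {g : ℕ → P → P} (hg : ∀ j, Measurable (g j))
    {A : Set P} (hA : MeasurableSet A) : MeasurableSet {x | (A ∩ valueSet g x).Nonempty} := by
  have h : {x | (A ∩ valueSet g x).Nonempty} = ⋃ j, g j ⁻¹' A := by
    ext x
    simp only [Set.mem_iUnion]
    constructor
    · rintro ⟨_, hA, j, rfl⟩
      exact ⟨j, hA⟩
    · rintro ⟨j, hj⟩
      exact ⟨_, hj, j, rfl⟩
  rw [h]
  exact MeasurableSet.iUnion fun j => hg j hA

section

variable {P : Type} [MeasurableSpace P] [StandardBorelSpace P]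

theorem measurableSet_inter_valueSet_finite {g : ℕ → P → P} (hg : ∀ j, Measurable (g j)) {A : Set P}
    (hA : MeasurableSet A) : MeasurableSet {x | (A ∩ valueSet g x).Finite} := by
  have h : {x | (A ∩ valueSet g x).Finite} =
      ⋃ n : ℕ, ⋂ k : ℕ, {x | g k x ∈ A → ∃ m : Fin n, g m x = g k x} := by
    ext x
    simp only [Set.mem_iUnion, Set.mem_iInter]
    constructor
    · intro hx
      have hfin : ∀ w ∈ A ∩ valueSet g x, ∃ j, g j x = w := fun w hw => hw.2
      choose! j hj using hfin
      obtain ⟨n, hn⟩ := (hx.image j).bddAbove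
      refine ⟨n + 1, fun k hk => ?_⟩
      have hw : g k x ∈ A ∩ valueSet g x := ⟨hk, k, rfl⟩
      exact ⟨⟨j (g k x), Nat.lt_succ_of_le (hn ⟨_, hw, rfl⟩)⟩, hj _ hw⟩
    · rintro ⟨n, hn⟩
      refine (Set.finite_range fun m : Fin n => g m x).subset ?_
      rintro _ ⟨hk, k, rfl⟩
      exact hn k hk
  rw [h]
  refine MeasurableSet.iUnion fun n => MeasurableSet.iInter fun k => ?_
  refine MeasurableSet.imp (hg k hA) ?_
  exact measurableSet_setOf_exists fun m : Fin n => measurableSet_eq_fun (hg m) (hg k)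

theorem exists_measurable_invariant_selector {g : ℕ → P → P} (hg : ∀ j, Measurable (g j))
    {A : ℕ → Set P} (hA : ∀ i, MeasurableSet (A i)) :
    ∃ s : P → P, Measurable s ∧ (∀ x, s x ∈ valueSet g x) ∧
      ∀ x y, valueSet g x = valueSet g y →
        (∃ i, (A i ∩ valueSet g x).Finite ∧ (A i ∩ valueSet g x).Nonempty) → s x = s y := by
  classical
  set e := embeddingReal P
  have he := measurableEmbedding_embeddingReal P
  set m : ℕ → ℕ → P → Prop := fun i j x =>
    g j x ∈ A i ∧ ∀ k, g k x ∈ A i → e (g j x) ≤ e (g k x) with hm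
  have hmm : ∀ i j, MeasurableSet {x | m i j x} := by
    intro i j
    exact (hg j (hA i)).inter (measurableSet_setOf_forall fun k => MeasurableSet.imp (hg k (hA i))
      (measurableSet_le (he.measurable.comp (hg j)) (he.measurable.comp (hg k))))
  set m' : ℕ → ℕ → P → Prop := fun i j x => m i j x ∨ ¬∃ j, m i j x with hm'
  have hmm' : ∀ i j, MeasurableSet {x | m' i j x} := by
    intro i j
    exact (hmm i j).union (measurableSet_setOf_exists (hmm i)).compl
  have hex' : ∀ i x, ∃ j, m' i j x := fun i x => by
    by_cases h : ∃ j, m i j x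
    · exact h.imp fun j hj => Or.inl hj
    · exact ⟨0, Or.inr h⟩
  set h : ℕ → P → P := fun i x => g (Nat.find (hex' i x)) x with hh
  have hhm : ∀ i, Measurable (h i) := fun i => Measurable.find hg (hmm' i) (hex' i)
  set b : ℕ → P → Prop := fun i x =>
    (A i ∩ valueSet g x).Finite ∧ (A i ∩ valueSet g x).Nonempty with hb
  have hbm : ∀ i, MeasurableSet {x | b i x} := fun i =>
    (measurableSet_inter_valueSet_finite hg (hA i)).inter
      (measurableSet_inter_valueSet_nonempty hg (hA i))
  have hspec : ∀ i x, b i x → h i x ∈ A i ∩ valueSet g x ∧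
      ∀ w ∈ A i ∩ valueSet g x, e (h i x) ≤ e w := by
    rintro i x ⟨h1, h2⟩
    obtain ⟨w, ⟨hwA, j, hjw⟩, hw⟩ := h1.exists_minimalFor e _ h2
    have hj : ∃ j, m i j x := by
      refine ⟨j, by rwa [← hjw] at hwA, fun k hk => ?_⟩
      have h3 : g j x = w := hjw
      rw [h3]
      rcases le_total (e w) (e (g k x)) with h4 | h4
      · exact h4
      · exact hw ⟨hk, k, rfl⟩ h4
    have h3 := (Nat.find_spec (hex' i x)).resolve_right (not_not.2 hj)
    refine ⟨⟨h3.1, _, rfl⟩, ?_⟩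
    rintro _ ⟨hA, k, rfl⟩
    exact h3.2 k hA
  set b' : ℕ → P → Prop := fun i x => b i x ∨ ¬∃ i, b i x with hb'
  have hbm' : ∀ i, MeasurableSet {x | b' i x} := by
    intro i
    exact (hbm i).union (measurableSet_setOf_exists hbm).compl
  have hexb : ∀ x, ∃ i, b' i x := fun x => by
    by_cases h : ∃ j, b j x
    · exact h.imp fun j hj => Or.inl hj
    · exact ⟨0, Or.inr h⟩
  refine ⟨fun x => h (Nat.find (hexb x)) x, Measurable.find hhm hbm' hexb, fun x => ⟨_, rfl⟩, ?_⟩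
  intro x y hxy hi
  have hbb : ∀ i, b i x = b i y := fun i => by simp only [hb, hxy]
  have hfind : Nat.find (hexb x) = Nat.find (hexb y) :=
    Nat.find_congr' fun {i} => by simp only [hb', hbb]
  have hbx : b (Nat.find (hexb x)) x := (Nat.find_spec (hexb x)).resolve_right (not_not.2 hi)
  beta_reduce
  rw [← hfind]
  obtain ⟨h1, h2⟩ := hspec _ x hbx
  obtain ⟨h3, h4⟩ := hspec _ y (hbb _ ▸ hbx)
  rw [← hxy] at h3 h4
  exact he.injective (le_antisymm (h2 _ h3) (h4 _ h1))

end

/-! ### Hyperfiniteness of Borel relations with ordered sections -/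

/-- The betweenness relation `Bt` on `D` comes from an injection of `D` into the line, and its
intervals are finite. -/
structure IsOrderedBy {P : Type*} (Bt : P → P → P → Prop) (D : Set P) (τ : P → ℝ) : Prop where
  injOn : Set.InjOn τ D
  between_iff : ∀ u ∈ D, ∀ w ∈ D, ∀ v ∈ D, Bt u w v ↔ τ w ∈ Set.uIcc (τ u) (τ v)
  finite : ∀ u ∈ D, ∀ v ∈ D, {w | w ∈ D ∧ Bt u w v}.Finite

/-- The elements of `A` which are not strictly between two elements of `A` in their section. -/
def extremeSet {P : Type} (g : ℕ → P → P) (Bt : P → P → P → Prop) (A : Set P) : Set P :=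
  {u | u ∈ A ∧ ¬∃ j k, g j u ∈ A ∧ g j u ≠ u ∧ g k u ∈ A ∧ g k u ≠ u ∧ Bt (g j u) u (g k u)}

section

variable {P : Type} {g : ℕ → P → P} {Bt : P → P → P → Prop} {D A : Set P} {τ : P → ℝ}

theorem IsOrderedBy.neg (h : IsOrderedBy Bt D τ) : IsOrderedBy Bt D fun w => -τ w := by
  refine ⟨fun u hu v hv huv => h.injOn hu hv (neg_injective huv), fun u hu w hw v hv => ?_,
    h.finite⟩
  rw [h.between_iff u hu w hw v hv, Set.mem_uIcc, Set.mem_uIcc]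
  constructor <;> rintro (⟨h1, h2⟩ | ⟨h1, h2⟩)
  · exact Or.inr ⟨by linarith, by linarith⟩
  · exact Or.inl ⟨by linarith, by linarith⟩
  · exact Or.inr ⟨by linarith, by linarith⟩
  · exact Or.inl ⟨by linarith, by linarith⟩

theorem IsOrderedBy.mem_extremeSet_iff (h : IsOrderedBy Bt D τ) (hg : ∀ u ∈ D, valueSet g u = D)
    {u : P} (hu : u ∈ D) : u ∈ extremeSet g Bt A ↔
      u ∈ A ∧ ¬((∃ a ∈ A ∩ D, τ a < τ u) ∧ ∃ a ∈ A ∩ D, τ u < τ a) := by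
  have hgD : ∀ j, g j u ∈ D := fun j => hg u hu ▸ ⟨j, rfl⟩
  refine and_congr_right fun _ => not_congr ⟨?_, ?_⟩
  · rintro ⟨j, k, hj, hju, hk, hku, hb⟩
    rw [h.between_iff _ (hgD j) _ hu _ (hgD k), Set.mem_uIcc] at hb
    have h1 : τ (g j u) ≠ τ u := fun h' => hju (h.injOn (hgD j) hu h')
    have h2 : τ (g k u) ≠ τ u := fun h' => hku (h.injOn (hgD k) hu h')
    rcases hb with ⟨h3, h4⟩ | ⟨h3, h4⟩
    · exact ⟨⟨_, ⟨hj, hgD j⟩, lt_of_le_of_ne h3 h1⟩, _, ⟨hk, hgD k⟩, lt_of_le_of_ne h4 h2.symm⟩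
    · exact ⟨⟨_, ⟨hk, hgD k⟩, lt_of_le_of_ne h3 h2⟩, _, ⟨hj, hgD j⟩, lt_of_le_of_ne h4 h1.symm⟩
  · rintro ⟨⟨a, ⟨ha, haD⟩, hau⟩, b, ⟨hb, hbD⟩, hub⟩
    have haB := (h.between_iff a haD u hu b hbD).2 (Set.mem_uIcc_of_le hau.le hub.le)
    rw [← hg u hu] at haD hbD
    obtain ⟨j, rfl⟩ := haD
    obtain ⟨k, rfl⟩ := hbD
    exact ⟨j, k, ha, fun h' => hau.ne (congrArg τ h'), hb, fun h' => hub.ne' (congrArg τ h'), haB⟩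

theorem IsOrderedBy.finite_extremeSet (h : IsOrderedBy Bt D τ) (hg : ∀ u ∈ D, valueSet g u = D) :
    (extremeSet g Bt A ∩ D).Finite := by
  have h1 : {u | u ∈ A ∩ D ∧ ∀ a ∈ A ∩ D, τ u ≤ τ a}.Subsingleton := fun u hu v hv =>
    h.injOn hu.1.2 hv.1.2 (le_antisymm (hu.2 v hv.1) (hv.2 u hu.1))
  have h2 : {u | u ∈ A ∩ D ∧ ∀ a ∈ A ∩ D, τ a ≤ τ u}.Subsingleton := fun u hu v hv =>
    h.injOn hu.1.2 hv.1.2 (le_antisymm (hv.2 u hu.1) (hu.2 v hv.1))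
  refine (h1.finite.union h2.finite).subset ?_
  rintro u ⟨hu, huD⟩
  obtain ⟨huA, hu'⟩ := (h.mem_extremeSet_iff hg huD).1 hu
  rw [not_and_or] at hu'
  push Not at hu'
  exact hu'.imp (fun h3 => ⟨⟨huA, huD⟩, h3⟩) fun h3 => ⟨⟨huA, huD⟩, h3⟩

theorem IsOrderedBy.exists_gt (h : IsOrderedBy Bt D τ) (hg : ∀ u ∈ D, valueSet g u = D)
    (hA : (A ∩ D).Nonempty) (he : extremeSet g Bt A ∩ D = ∅) {u : P} (hu : u ∈ D) :
    ∃ a ∈ A ∩ D, τ u < τ a := by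
  by_contra! hle
  obtain ⟨a, ha, haD⟩ := hA
  have hmem : ∀ w ∈ A ∩ D, τ a ≤ τ w → w ∈ {w | w ∈ D ∧ Bt a w u} ∩ A := fun w hw haw =>
    ⟨⟨hw.2, (h.between_iff a haD w hw.2 u hu).2 (Set.mem_uIcc_of_le haw (hle w hw))⟩, hw.1⟩
  obtain ⟨m, hm, hmax⟩ := ((h.finite a haD u hu).inter_of_left A).exists_maximalFor τ _
    ⟨a, hmem a ⟨ha, haD⟩ le_rfl⟩
  have hne : m ∉ extremeSet g Bt A := fun h' => (he ▸ (⟨h', hm.1.1⟩ : m ∈ extremeSet g Bt A ∩ D) :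
    m ∈ (∅ : Set P))
  rw [h.mem_extremeSet_iff hg hm.1.1] at hne
  push Not at hne
  obtain ⟨-, b, hb, hmb⟩ := hne hm.2
  have ham : τ a ≤ τ m := by
    by_contra! hlt
    exact hlt.not_ge (hmax (hmem a ⟨ha, haD⟩ le_rfl) hlt.le)
  exact hmb.not_ge (hmax (hmem b hb (ham.trans hmb.le)) hmb.le)

theorem IsOrderedBy.finite_gap (h : IsOrderedBy Bt D τ) (hg : ∀ u ∈ D, valueSet g u = D)
    (hA : (A ∩ D).Nonempty) (he : extremeSet g Bt A ∩ D = ∅) {u : P} (hu : u ∈ D) :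
    {v | v ∈ D ∧ ∀ w ∈ D, Bt u w v → w ∉ A}.Finite := by
  obtain ⟨a, ha, hua⟩ := h.exists_gt hg hA he hu
  obtain ⟨b, hb, hub⟩ := h.neg.exists_gt hg hA he hu
  refine (h.finite b hb.2 a ha.2).subset ?_
  rintro v ⟨hv, hw⟩
  refine ⟨hv, (h.between_iff b hb.2 v hv a ha.2).2 (Set.mem_uIcc_of_le ?_ ?_)⟩
  · by_contra! hlt
    refine hw b hb.2 ?_ hb.1
    rw [h.between_iff u hu b hb.2 v hv]
    exact Set.mem_uIcc_of_ge hlt.le (neg_lt_neg_iff.1 hub).le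
  · by_contra! hlt
    refine hw a ha.2 ?_ ha.1
    rw [h.between_iff u hu a ha.2 v hv]
    exact Set.mem_uIcc_of_le hua.le hlt.le

/-- The vanishing markers obtained by successively deciding, in each section, membership in the
sets `B n` so as to keep infinitely many elements. -/
def markerSet (g : ℕ → P → P) (B : ℕ → Set P) : ℕ → Set P
  | 0 => Set.univ
  | n + 1 => {u | u ∈ markerSet g B n ∧
      (u ∈ B n ↔ ((markerSet g B n ∩ B n) ∩ valueSet g u).Infinite)}

variable {B : ℕ → Set P}

theorem antitone_markerSet : Antitone (markerSet g B) :=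
  antitone_nat_of_succ_le fun _ _ hu => hu.1

theorem infinite_markerSet (hD : D.Infinite) (hg : ∀ u ∈ D, valueSet g u = D) (n : ℕ) :
    (markerSet g B n ∩ D).Infinite := by
  induction n with
  | zero => rwa [markerSet, Set.univ_inter]
  | succ n ih =>
    by_cases h : ((markerSet g B n ∩ B n) ∩ D).Infinite
    · refine h.mono ?_
      rintro u ⟨⟨h1, h2⟩, hu⟩
      refine ⟨⟨h1, iff_of_true h2 ?_⟩, hu⟩
      rwa [hg u hu]
    · refine (ih.sdiff (Set.not_infinite.1 h)).mono ?_
      rintro u ⟨⟨h1, hu⟩, h2⟩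
      refine ⟨⟨h1, iff_of_false (fun h3 => h2 ⟨⟨h1, h3⟩, hu⟩) ?_⟩, hu⟩
      rwa [hg u hu]

theorem subsingleton_iInter_markerSet (hB : ∀ u v, (∀ n, u ∈ B n ↔ v ∈ B n) → u = v)
    (hg : ∀ u ∈ D, valueSet g u = D) : ((⋂ n, markerSet g B n) ∩ D).Subsingleton := by
  rintro u ⟨hu, huD⟩ v ⟨hv, hvD⟩
  rw [Set.mem_iInter] at hu hv
  refine hB u v fun n => ?_
  rw [(hu (n + 1)).2, (hv (n + 1)).2, hg u huD, hg v hvD]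

variable [MeasurableSpace P] [StandardBorelSpace P]

theorem measurableSet_markerSet (hg : ∀ j, Measurable (g j)) (hB : ∀ n, MeasurableSet (B n))
    (n : ℕ) : MeasurableSet (markerSet g B n) := by
  induction n with
  | zero => exact MeasurableSet.univ
  | succ n ih =>
    have h1 : MeasurableSet {u | ((markerSet g B n ∩ B n) ∩ valueSet g u).Infinite} :=
      (measurableSet_inter_valueSet_finite hg (ih.inter (hB n))).compl
    refine ih.inter ?_
    have h2 : {u | u ∈ B n ↔ ((markerSet g B n ∩ B n) ∩ valueSet g u).Infinite} =
        {u | u ∈ B n → ((markerSet g B n ∩ B n) ∩ valueSet g u).Infinite} ∩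
        {u | ((markerSet g B n ∩ B n) ∩ valueSet g u).Infinite → u ∈ B n} :=
      Set.ext fun u => iff_iff_implies_and_implies
    change MeasurableSet {u | u ∈ B n ↔ ((markerSet g B n ∩ B n) ∩ valueSet g u).Infinite}
    rw [h2]
    exact (MeasurableSet.imp (hB n) h1).inter (MeasurableSet.imp h1 (hB n))

theorem measurableSet_extremeSet (hg : ∀ j, Measurable (g j))
    (hBt : MeasurableSet {p : P × P × P | Bt p.1 p.2.1 p.2.2}) (hA : MeasurableSet A) :
    MeasurableSet (extremeSet g Bt A) := by
  refine hA.inter (MeasurableSet.compl (measurableSet_setOf_exists fun j =>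
    measurableSet_setOf_exists fun k => ?_))
  have hne : ∀ j, MeasurableSet {u | g j u ≠ u} := fun j =>
    (measurableSet_eq_fun (hg j) measurable_id).compl
  exact (hg j hA).inter ((hne j).inter ((hg k hA).inter ((hne k).inter
    (((hg j).prodMk (measurable_id.prodMk (hg k))) hBt))))

variable (P) in
theorem exists_separating_seq :
    ∃ B : ℕ → Set P, (∀ n, MeasurableSet (B n)) ∧ ∀ u v, (∀ n, u ∈ B n ↔ v ∈ B n) → u = v := by
  have he := measurableEmbedding_embeddingReal P
  obtain ⟨r, hr⟩ := exists_surjective_nat ℚ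
  refine ⟨fun n => {u | embeddingReal P u < (r n : ℚ)},
    fun n => measurableSet_lt he.measurable measurable_const, fun u v h => ?_⟩
  have key : ∀ u v, (∀ n : ℕ, embeddingReal P u < (r n : ℚ) ↔
      embeddingReal P v < (r n : ℚ)) → embeddingReal P v ≤ embeddingReal P u := by
    intro u v h
    by_contra! hlt
    obtain ⟨c, h1, h2⟩ := exists_rat_btwn hlt
    obtain ⟨n, rfl⟩ := hr c
    exact lt_asymm ((h n).1 h1) h2
  exact he.injective (le_antisymm (key v u fun n => (h n).symm) (key u v h))

end

/-- The sets whose finite nonempty traces select points from the sections. -/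
def selectingSet {P : Type} (g : ℕ → P → P) (Bt : P → P → P → Prop) (B : ℕ → Set P) : ℕ → Set P
  | 0 => Set.univ
  | 1 => ⋂ n, markerSet g B n
  | n + 2 => extremeSet g Bt (markerSet g B n)

/-- The members of sections in which no selecting set has a finite nonempty trace. -/
def unselectedSet {P : Type} (X : Set P) (g : ℕ → P → P) (Bt : P → P → P → Prop)
    (B : ℕ → Set P) : Set P :=
  {u | u ∈ X ∧ u ∈ valueSet g u ∧ ∀ i, ¬((selectingSet g Bt B i ∩ valueSet g u).Finite ∧
    (selectingSet g Bt B i ∩ valueSet g u).Nonempty)}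

/-- Two points are related when no marker lies between them. -/
def gapRel {P : Type} (G : Set P) (g : ℕ → P → P) (Bt : P → P → P → Prop) (A : Set P)
    (u v : P) : Prop :=
  u = v ∨ (u ∈ G ∧ v ∈ valueSet g u ∧ ∀ w ∈ valueSet g u, Bt u w v → w ∉ A)

section

variable {P : Type} {X : Set P} {g : ℕ → P → P} {Bt : P → P → P → Prop} {B : ℕ → Set P}

theorem mem_unselectedSet_of_mem
    (hX : ∀ x ∈ X, ∀ w ∈ valueSet g x, w ∈ X ∧ valueSet g w = valueSet g x) {u v : P}
    (hu : u ∈ unselectedSet X g Bt B) (hv : v ∈ valueSet g u) : v ∈ unselectedSet X g Bt B := by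
  obtain ⟨h1, h2⟩ := hX u hu.1 v hv
  refine ⟨h1, h2.symm ▸ hv, ?_⟩
  rw [h2]
  exact hu.2.2

theorem infinite_of_mem_unselectedSet {u : P} (hu : u ∈ unselectedSet X g Bt B) :
    (valueSet g u).Infinite := by
  have := hu.2.2 0
  rw [selectingSet, Set.univ_inter] at this
  exact fun h => this ⟨h, u, hu.2.1⟩

theorem equivalence_gapRel
    (hX : ∀ x ∈ X, ∀ w ∈ valueSet g x, w ∈ X ∧ valueSet g w = valueSet g x)
    (hτ : ∀ x ∈ X, (valueSet g x).Infinite → ∃ τ, IsOrderedBy Bt (valueSet g x) τ) (A : Set P) :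
    Equivalence (gapRel (unselectedSet X g Bt B) g Bt A) := by
  refine ⟨fun u => Or.inl rfl, ?_, ?_⟩
  · rintro u v (rfl | ⟨hu, hv, h⟩)
    · exact Or.inl rfl
    · obtain ⟨τ, h'⟩ := hτ u hu.1 (infinite_of_mem_unselectedSet hu)
      refine Or.inr ⟨mem_unselectedSet_of_mem hX hu hv, ?_⟩
      rw [(hX u hu.1 v hv).2]
      refine ⟨hu.2.1, fun w hw hb => h w hw ?_⟩
      rw [h'.between_iff v hv w hw u hu.2.1, Set.uIcc_comm] at hb
      rwa [h'.between_iff u hu.2.1 w hw v hv]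
  · rintro u v z (rfl | ⟨hu, hv, h⟩) huz
    · exact huz
    rcases huz with rfl | ⟨-, hz, h1⟩
    · exact Or.inr ⟨hu, hv, h⟩
    obtain ⟨τ, h'⟩ := hτ u hu.1 (infinite_of_mem_unselectedSet hu)
    rw [(hX u hu.1 v hv).2] at hz h1
    refine Or.inr ⟨hu, hz, fun w hw hb => ?_⟩
    rw [h'.between_iff u hu.2.1 w hw z hz] at hb
    rcases Set.uIcc_subset_uIcc_union_uIcc (b := τ v) hb with hb | hb
    · exact h w hw ((h'.between_iff u hu.2.1 w hw v hv).2 hb)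
    · exact h1 w hw ((h'.between_iff v hv w hw z hz).2 hb)

theorem finite_gapRel
    (hX : ∀ x ∈ X, ∀ w ∈ valueSet g x, w ∈ X ∧ valueSet g w = valueSet g x)
    (hτ : ∀ x ∈ X, (valueSet g x).Infinite → ∃ τ, IsOrderedBy Bt (valueSet g x) τ) (n : ℕ) (u : P) :
    {v | gapRel (unselectedSet X g Bt B) g Bt (markerSet g B n) u v}.Finite := by
  by_cases hu : u ∈ unselectedSet X g Bt B
  · have hinf := infinite_of_mem_unselectedSet hu
    obtain ⟨τ, h⟩ := hτ u hu.1 hinf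
    have hD : ∀ w ∈ valueSet g u, valueSet g w = valueSet g u := fun w hw => (hX u hu.1 w hw).2
    have he : extremeSet g Bt (markerSet g B n) ∩ valueSet g u = ∅ := by
      by_contra hne
      exact hu.2.2 (n + 2) ⟨h.finite_extremeSet hD, Set.nonempty_iff_ne_empty.2 hne⟩
    refine ((Set.finite_singleton u).union
      (h.finite_gap hD (infinite_markerSet hinf hD n).nonempty he hu.2.1)).subset ?_
    rintro v (rfl | ⟨-, hv⟩)
    · exact Or.inl rfl
    · exact Or.inr hv
  · refine (Set.finite_singleton u).subset ?_
    rintro v (rfl | ⟨h, -⟩)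
    · rfl
    · exact absurd h hu

theorem exists_gapRel
    (hX : ∀ x ∈ X, ∀ w ∈ valueSet g x, w ∈ X ∧ valueSet g w = valueSet g x)
    (hτ : ∀ x ∈ X, (valueSet g x).Infinite → ∃ τ, IsOrderedBy Bt (valueSet g x) τ)
    (hB : ∀ u v, (∀ n, u ∈ B n ↔ v ∈ B n) → u = v) {u v : P} (hu : u ∈ unselectedSet X g Bt B)
    (hv : v ∈ valueSet g u) : ∃ n, gapRel (unselectedSet X g Bt B) g Bt (markerSet g B n) u v := by
  obtain ⟨τ, h⟩ := hτ u hu.1 (infinite_of_mem_unselectedSet hu)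
  have hD : ∀ w ∈ valueSet g u, valueSet g w = valueSet g u := fun w hw => (hX u hu.1 w hw).2
  have hsub := (subsingleton_iInter_markerSet hB hD).finite
  have hempty : ∀ w ∈ valueSet g u, ∃ n, w ∉ markerSet g B n := by
    intro w hw
    by_contra! hall
    exact hu.2.2 1 ⟨hsub, w, Set.mem_iInter.2 hall, hw⟩
  choose! N hN using hempty
  obtain ⟨n, hn⟩ := ((h.finite u hu.2.1 v hv).image N).bddAbove
  exact ⟨n, Or.inr ⟨hu, hv, fun w hw hb hwA =>
    hN w hw (antitone_markerSet (hn ⟨w, ⟨hw, hb⟩, rfl⟩) hwA)⟩⟩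

variable [MeasurableSpace P] [StandardBorelSpace P]

theorem measurableSet_selectingSet (hg : ∀ j, Measurable (g j))
    (hBt : MeasurableSet {p : P × P × P | Bt p.1 p.2.1 p.2.2}) (hB : ∀ n, MeasurableSet (B n)) :
    ∀ i, MeasurableSet (selectingSet g Bt B i)
  | 0 => MeasurableSet.univ
  | 1 => MeasurableSet.iInter fun n => measurableSet_markerSet hg hB n
  | n + 2 => measurableSet_extremeSet hg hBt (measurableSet_markerSet hg hB n)

theorem measurableSet_unselectedSet (hXm : MeasurableSet X) (hg : ∀ j, Measurable (g j))
    (hBt : MeasurableSet {p : P × P × P | Bt p.1 p.2.1 p.2.2}) (hB : ∀ n, MeasurableSet (B n)) :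
    MeasurableSet (unselectedSet X g Bt B) := by
  have hs := measurableSet_selectingSet hg hBt hB
  refine hXm.inter (MeasurableSet.inter ?_ (measurableSet_setOf_forall fun i =>
    MeasurableSet.compl ((measurableSet_inter_valueSet_finite hg (hs i)).inter
      (measurableSet_inter_valueSet_nonempty hg (hs i)))))
  exact measurableSet_setOf_exists fun j => measurableSet_eq_fun (hg j) measurable_id

theorem measurableSet_gapRel {G A : Set P} (hG : MeasurableSet G) (hg : ∀ j, Measurable (g j))
    (hBt : MeasurableSet {p : P × P × P | Bt p.1 p.2.1 p.2.2}) (hA : MeasurableSet A) :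
    MeasurableSet {p : P × P | gapRel G g Bt A p.1 p.2} := by
  refine (measurableSet_eq_fun measurable_fst measurable_snd).union
    ((measurable_fst hG).inter (MeasurableSet.inter ?_ ?_))
  · exact measurableSet_setOf_exists fun j =>
      measurableSet_eq_fun ((hg j).comp measurable_fst) measurable_snd
  · have h : {p : P × P | ∀ w ∈ valueSet g p.1, Bt p.1 w p.2 → w ∉ A} =
        {p | ∀ k, Bt p.1 (g k p.1) p.2 → g k p.1 ∉ A} :=
      Set.ext fun p => Set.forall_mem_range
    change MeasurableSet {p : P × P | ∀ w ∈ valueSet g p.1, Bt p.1 w p.2 → w ∉ A}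
    rw [h]
    refine measurableSet_setOf_forall fun k => MeasurableSet.imp ?_
      ((hg k).comp measurable_fst hA).compl
    exact (measurable_fst.prodMk (((hg k).comp measurable_fst).prodMk measurable_snd)) hBt

theorem exists_hyperfinite_reduction (hXm : MeasurableSet X) (hg : ∀ j, Measurable (g j))
    (hBt : MeasurableSet {p : P × P × P | Bt p.1 p.2.1 p.2.2})
    (hX : ∀ x ∈ X, ∀ w ∈ valueSet g x, w ∈ X ∧ valueSet g w = valueSet g x)
    (hτ : ∀ x ∈ X, (valueSet g x).Infinite → ∃ τ, IsOrderedBy Bt (valueSet g x) τ) :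
    ∃ F : P → P → Prop, IsBorelEquivRel F ∧ IsHyperfinite F ∧
      (∀ u v, F u v → u = v ∨ u ∈ X ∧ v ∈ X ∧ valueSet g u = valueSet g v) ∧
      ∃ f : P → P, Measurable f ∧ (∀ x, f x ∈ valueSet g x) ∧
        ∀ x ∈ X, ∀ y ∈ X, valueSet g x = valueSet g y → F (f x) (f y) := by
  classical
  obtain ⟨B, hBm, hB⟩ := exists_separating_seq P
  obtain ⟨s, hs, hsg, hsi⟩ :=
    exists_measurable_invariant_selector hg (measurableSet_selectingSet hg hBt hBm)
  set G := unselectedSet X g Bt B with hG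
  have hGm : MeasurableSet G := measurableSet_unselectedSet hXm hg hBt hBm
  set F : ℕ → P → P → Prop := fun n => gapRel G g Bt (markerSet g B n) with hF
  have hFm : ∀ n, MeasurableSet {p : P × P | F n p.1 p.2} := fun n =>
    measurableSet_gapRel hGm hg hBt (measurableSet_markerSet hg hBm n)
  have hFe : ∀ n, Equivalence (F n) := fun n => equivalence_gapRel hX hτ _
  have hmono : ∀ m n, m ≤ n → ∀ x y, F m x y → F n x y := fun m n hmn x y h =>
    h.imp_right fun h' => ⟨h'.1, h'.2.1, fun w hw hb hA =>
      h'.2.2 w hw hb (antitone_markerSet hmn hA)⟩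
  refine ⟨fun u v => ∃ n, F n u v, ⟨⟨fun u => ⟨0, (hFe 0).refl u⟩, ?_, ?_⟩,
    measurableSet_setOf_exists hFm⟩, ⟨F, fun n => ⟨⟨hFe n, hFm n⟩, finite_gapRel hX hτ n⟩,
      fun n => hmono n (n + 1) n.le_succ, fun x y => Iff.rfl⟩, ?_, ?_⟩
  · rintro u v ⟨n, h⟩
    exact ⟨n, (hFe n).symm h⟩
  · rintro u v w ⟨n, h⟩ ⟨m, h'⟩
    exact ⟨max n m, (hFe _).trans (hmono _ _ (le_max_left _ _) _ _ h)
      (hmono _ _ (le_max_right _ _) _ _ h')⟩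
  · rintro u v ⟨n, rfl | ⟨hu, hv, -⟩⟩
    · exact Or.inl rfl
    · exact Or.inr ⟨hu.1, (hX u hu.1 v hv).1, (hX u hu.1 v hv).2.symm⟩
  · refine ⟨fun x => if g 0 x ∈ G then g 0 x else s x, Measurable.ite (hg 0 hGm) (hg 0) hs,
      fun x => ?_, ?_⟩
    · beta_reduce
      split_ifs
      · exact ⟨0, rfl⟩
      · exact hsg x
    · intro x hx y hy hxy
      have hgx : g 0 x ∈ valueSet g x := ⟨0, rfl⟩
      have hgy : g 0 y ∈ valueSet g x := hxy ▸ ⟨0, rfl⟩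
      have hvx := (hX x hx _ hgx).2
      have hvy := (hX x hx _ hgy).2
      beta_reduce
      by_cases hGx : g 0 x ∈ G
      · have hGy : g 0 y ∈ G := mem_unselectedSet_of_mem hX hGx (hvx.symm ▸ hgy)
        rw [if_pos hGx, if_pos hGy]
        exact exists_gapRel hX hτ hB hGx (hvx.symm ▸ hgy)
      · have hGy : g 0 y ∉ G := fun hGy =>
          hGx (mem_unselectedSet_of_mem hX hGy (hvy.symm ▸ hgx))
        rw [if_neg hGx, if_neg hGy]
        refine ⟨0, Or.inl (hsi x y hxy ?_)⟩
        by_contra! hall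
        refine hGx ⟨(hX x hx _ hgx).1, hvx.symm ▸ hgx, fun i hi => ?_⟩
        rw [hvx] at hi
        exact hi.2.ne_empty (hall i hi.1)

end

/-! ### The classes containing a crossing -/

theorem IsArcWith.exists_isCrossing {S A B J : Set Plane} {u v : Plane} (h : IsArcWith J u v)
    (hJ : J ⊆ S) (hA : J ∩ A = {u}) (hB : J ∩ B = {v}) :
    ∃ k, IsCrossing S A B k ∧ Set.range k = J ∧ k 0 = u := by
  obtain ⟨f, hf, hfi, rfl, rfl, rfl⟩ := h
  have h01 : Set.uIcc (0 : unitInterval) 1 = Set.univ := by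
    rw [Set.uIcc_of_le unitInterval.nonneg']
    exact Set.eq_univ_of_forall fun t => ⟨unitInterval.nonneg', unitInterval.le_one'⟩
  obtain ⟨k, hk, hr, h0, -⟩ := exists_isCrossing_of_injOn (S := S) (A := A) (B := B)
    (f := (⟨f, hf⟩ : Curve)) (a := 0) (b := 1) hfi.injOn hJ
    (hA.symm.subset (Set.mem_singleton _)).2 (hB.symm.subset (Set.mem_singleton _)).2
    (fun t _ ht => hfi (hA.subset ⟨⟨t, rfl⟩, ht⟩)) (fun t _ ht => hfi (hB.subset ⟨⟨t, rfl⟩, ht⟩))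
  refine ⟨k, hk, ?_, h0⟩
  rw [hr, h01, Set.image_univ]
  rfl

theorem IsCrossing.isArcWith {S A B : Set Plane} {k : Curve} (h : IsCrossing S A B k)
    (hAB : Disjoint A B) : IsArcWith (Set.range k) (k 0) (k 1) := by
  have hk := h.isArcCode
  have hne : (0 : unitInterval) ≠ k.len := fun h0 =>
    Set.disjoint_left.1 hAB h.start_mem (by rw [h0, hk.apply_len]; exact h.end_mem)
  have hmem : ∀ t, lerp 0 k.len t ∈ Set.Icc 0 k.len := fun t => by
    rw [← Set.uIcc_of_le unitInterval.nonneg']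
    exact unitInterval.lerp_mem_uIcc _ _ t
  refine ⟨fun t => k (lerp 0 k.len t), k.continuous.comp (unitInterval.continuous_lerp _ _),
    fun s t hst => unitInterval.lerp_injective hne (hk.injOn (hmem s) (hmem t) hst), ?_, ?_, ?_⟩
  · rw [hk.range_eq, ← Set.uIcc_of_le unitInterval.nonneg', ← unitInterval.range_lerp,
      ← Set.range_comp]
    rfl
  · beta_reduce
    rw [unitInterval.lerp_zero]
  · beta_reduce
    rw [unitInterval.lerp_one, hk.apply_len]

theorem IsCrossing.range_inter_left {S A B : Set Plane} {k : Curve} (h : IsCrossing S A B k) :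
    Set.range k ∩ A = {k 0} := by
  refine Set.Subset.antisymm ?_ (Set.singleton_subset_iff.2 ⟨⟨0, rfl⟩, h.start_mem⟩)
  rintro _ ⟨⟨t, rfl⟩, ht⟩
  exact h.eq_start t ht

theorem IsCrossing.range_inter_right {S A B : Set Plane} {k : Curve} (h : IsCrossing S A B k) :
    Set.range k ∩ B = {k 1} := by
  refine Set.Subset.antisymm ?_ (Set.singleton_subset_iff.2 ⟨⟨1, rfl⟩, h.end_mem⟩)
  rintro _ ⟨⟨t, rfl⟩, ht⟩
  exact h.eq_end t ht

/-- The points of `H` whose arc component is an injective image of an interval. -/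
def intervalPart (H : Set Plane) : Set Plane :=
  {x | x ∈ H ∧ ∃ (K : Set ℝ) (φ : ℝ → ℝ × ℝ), K.OrdConnected ∧
    ContinuousOn φ K ∧ Set.InjOn φ K ∧ φ '' K = {y | JoinedIn H x y}}

theorem JoinedIn.mem_intervalPart {H : Set Plane} {x y : Plane} (h : JoinedIn H x y)
    (hx : x ∈ intervalPart H) : y ∈ intervalPart H := by
  refine ⟨h.mem.2, ?_⟩
  rw [← h.setOf_eq]
  exact hx.2

theorem atriodicPart_subset_intervalPart (H : Set Plane) : atriodicPart H ⊆ intervalPart H := by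
  intro x hx
  refine ⟨atriodicPart_subset H hx, ?_⟩
  have := (triodFree_atriodicPart H).exists_injOn_image hx
  simpa only [joinedIn_atriodicPart_iff hx] using this

/-- The points of `intervalPart H` joined in `H` to the start of a crossing of the strip between
two vertical lines. -/
def crossingPart (H : Set Plane) (p q : ℝ) : Set Plane :=
  {x | x ∈ intervalPart H ∧ ∃ J : Set Plane, J ⊆ H ∧ ∃ u v : Plane, IsArcWith J u v ∧
    J ∩ vline p = {u} ∧ J ∩ vline q = {v} ∧ u ∈ intervalPart H ∧ JoinedIn H x u}

theorem JoinedIn.mem_crossingPart {H : Set Plane} {p q : ℝ} {x y : Plane} (h : JoinedIn H x y)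
    (hx : x ∈ crossingPart H p q) : y ∈ crossingPart H p q := by
  obtain ⟨hx, J, hJ, u, v, harc, hu, hv, hu', hxu⟩ := hx
  exact ⟨h.mem_intervalPart hx, J, hJ, u, v, harc, hu, hv, hu', h.symm.trans hxu⟩

theorem crossingPart_inter_atriodicPart (H : Set Plane) {p q : ℝ} (hpq : p ≠ q) :
    crossingPart H p q ∩ atriodicPart H =
      {x | (crossingStarts (atriodicPart H) (vline p) (vline q) x).Nonempty} := by
  ext x
  constructor
  · rintro ⟨⟨-, J, hJ, u, v, harc, hu, hv, -, hxu⟩, hx⟩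
    obtain ⟨k, hk, rfl, rfl⟩ := harc.exists_isCrossing hJ hu hv
    refine ⟨k 0, (joinedIn_atriodicPart_iff hx).2 hxu, k, { hk with range_subset := ?_ }, rfl⟩
    exact range_subset_atriodicPart (hxu.mem_atriodicPart hx) hJ
  · rintro ⟨_, hxw, k, hk, rfl⟩
    have hx := hxw.mem.1
    exact ⟨⟨atriodicPart_subset_intervalPart H hx, Set.range k,
      hk.range_subset.trans (atriodicPart_subset H), _, _, hk.isArcWith (disjoint_vline hpq),
      hk.range_inter_left, hk.range_inter_right, atriodicPart_subset_intervalPart H hxw.mem.2,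
      (joinedIn_atriodicPart_iff hx).1 hxw⟩, hx⟩

theorem measurableSet_setOf_crossingStarts_nonempty {H : Set Plane} (hH : PolishSpace H) {p q : ℝ}
    (hpq : p ≠ q) :
    MeasurableSet {x | (crossingStarts (atriodicPart H) (vline p) (vline q) x).Nonempty} := by
  simp only [crossingStarts_nonempty_iff (isClosed_vline p) (isClosed_vline q)
    (disjoint_vline hpq)]
  have hS := triodFree_atriodicPart H
  have hSm := measurableSet_range_subset_atriodicPart hH
  exact (measurableSet_hittingSet hS hSm (isClosed_vline p)).inter
    (measurableSet_hittingSet hS hSm (isClosed_vline q))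

theorem setOf_joinedIn_mem_triodicClasses {H : Set Plane} {x : Plane} (hx : x ∈ triodicPart H) :
    {y | JoinedIn H x y} ∈ triodicClasses H := by
  rw [triodicPart_eq] at hx
  obtain ⟨_, ⟨c, γ, h, rfl⟩, hcx⟩ := hx
  exact ⟨c, γ, h, (JoinedIn.setOf_eq hcx).symm⟩

theorem measurableSet_inter_triodicPart {H : Set Plane} (hH : PolishSpace H) {A : Set Plane}
    (hA : ∀ x y, x ∈ A → JoinedIn H x y → y ∈ A) : MeasurableSet (A ∩ triodicPart H) := by
  have : A ∩ triodicPart H = ⋃₀ {B | B ∈ triodicClasses H ∧ B ⊆ A} := by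
    ext x
    constructor
    · rintro ⟨hxA, hx⟩
      exact ⟨_, ⟨setOf_joinedIn_mem_triodicClasses hx, fun y hy => hA x y hxA hy⟩,
        JoinedIn.refl hx.1⟩
    · rintro ⟨B, ⟨hB, hBA⟩, hx⟩
      rw [triodicPart_eq]
      exact ⟨hBA hx, B, hB, hx⟩
  rw [this]
  exact MeasurableSet.sUnion ((countable_triodicClasses H).mono fun B hB => hB.1)
    fun B hB => measurableSet_of_mem_triodicClasses hH hB.1

theorem measurableSet_crossingPart {H : Set Plane} (hH : PolishSpace H) {p q : ℝ} (hpq : p ≠ q) :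
    MeasurableSet (crossingPart H p q) := by
  have : crossingPart H p q = crossingPart H p q ∩ triodicPart H ∪
      crossingPart H p q ∩ atriodicPart H := by
    rw [← Set.inter_union_distrib_left]
    refine (Set.inter_eq_left.2 fun x hx => ?_).symm
    exact (em (x ∈ triodicPart H)).imp_right fun h => ⟨hx.1.1, h⟩
  rw [this, crossingPart_inter_atriodicPart H hpq]
  exact (measurableSet_inter_triodicPart hH fun x y hx h => h.mem_crossingPart hx).union
    (measurableSet_setOf_crossingStarts_nonempty hH hpq)

theorem exists_hyperfinite_reduction_atriodicPart {H : Set Plane} (hH : PolishSpace H) {p q : ℝ}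
    (hpq : p < q) :
    ∃ F : Plane → Plane → Prop, IsBorelEquivRel F ∧ IsHyperfinite F ∧
      (∀ u v, F u v → u = v ∨ u ∈ atriodicPart H ∧ v ∈ atriodicPart H ∧ JoinedIn H u v) ∧
      ∃ f : Plane → Plane, Measurable f ∧ (∀ x ∈ crossingPart H p q ∩ atriodicPart H,
          JoinedIn H x (f x)) ∧
        ∀ x ∈ crossingPart H p q ∩ atriodicPart H, ∀ y, JoinedIn H x y → F (f x) (f y) := by
  have hS := triodFree_atriodicPart H
  have hSm := measurableSet_range_subset_atriodicPart hH
  rw [crossingPart_inter_atriodicPart H hpq.ne]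
  obtain ⟨g, hg, hgD⟩ := exists_measurable_crossingStarts hS hSm (isClosed_vline p)
    (isClosed_vline q) (disjoint_vline hpq.ne)
  set D := crossingStarts (atriodicPart H) (vline p) (vline q) with hD
  have hgD : ∀ x, (D x).Nonempty → valueSet g x = D x := fun x hx => Set.ext (hgD x hx)
  have hDx : ∀ x w, w ∈ D x → D w = D x := fun x w hw => (crossingStarts_eq hw.1).symm
  have hX : ∀ x ∈ {x | (D x).Nonempty}, ∀ w ∈ valueSet g x,
      w ∈ {x | (D x).Nonempty} ∧ valueSet g w = valueSet g x := by
    intro x hx w hw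
    rw [hgD x hx] at hw
    have hw' : (D w).Nonempty := (hDx x w hw).symm ▸ hx
    exact ⟨hw', by rw [hgD x hx, hgD w hw', hDx x w hw]⟩
  obtain ⟨F, hF, hFh, hFj, f, hf, hfg, hfF⟩ := exists_hyperfinite_reduction
    (measurableSet_setOf_crossingStarts_nonempty hH hpq.ne) hg (hS.measurableSet_arcBetween hSm)
    hX (fun x hx hinf => by
      rw [hgD x hx] at hinf ⊢
      obtain ⟨τ, h1, h2, h3⟩ := hS.exists_order_crossingStarts hpq hinf
      exact ⟨τ, h1, h2, h3⟩)
  refine ⟨F, hF, hFh, fun u v huv => (hFj u v huv).imp_right ?_, f, hf, fun x hx => ?_,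
    fun x hx y hxy => ?_⟩
  · rintro ⟨hu, hv, h⟩
    rw [hgD u hu, hgD v hv] at h
    obtain ⟨w, hw⟩ := hu
    have hw' : w ∈ D v := h ▸ (show w ∈ D u from hw)
    exact ⟨hw.1.mem.1, hw'.1.mem.1, (hw.1.trans hw'.1.symm).mono (atriodicPart_subset H)⟩
  · have := hfg x
    rw [hgD x hx] at this
    exact this.1.mono (atriodicPart_subset H)
  · obtain ⟨w, hw⟩ := id hx
    have hD' : D x = D y := crossingStarts_eq ((joinedIn_atriodicPart_iff hw.1.mem.1).2 hxy)
    have hy : (D y).Nonempty := hD' ▸ hx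
    refine hfF x hx y hy ?_
    rw [hgD x hx, hgD y hy, hD']

open Classical in
theorem isEssentiallyHyperfinite_crossingPart {H : Set Plane} (hH : PolishSpace H) {p q : ℝ}
    (hpq : p < q) :
    IsEssentiallyHyperfinite fun x y : crossingPart H p q => JoinedIn H x.1 y.1 := by
  obtain ⟨F, hF, hFh, hFj, f, hf, hfx, hfF⟩ := exists_hyperfinite_reduction_atriodicPart hH hpq
  have hc : ∀ B : Set Plane, ∃ c, B ∈ triodicClasses H → c ∈ B := by
    intro B
    rcases B.eq_empty_or_nonempty with rfl | ⟨c, hc⟩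
    · refine ⟨0, ?_⟩
      rintro ⟨c, γ, h, h'⟩
      exact (h'.symm.subset (JoinedIn.refl h.center_mem)).elim
    · exact ⟨c, fun _ => hc⟩
  choose c hc using hc
  set φ : Plane → Plane := fun x =>
    if x ∈ triodicPart H then c {y | JoinedIn H x y} else f x with hφ
  have hφt : ∀ {x}, x ∈ triodicPart H → φ x = c {y | JoinedIn H x y} := fun hx => if_pos hx
  have hφa : ∀ {x}, x ∉ triodicPart H → φ x = f x := fun hx => if_neg hx
  have hφm : Measurable φ := by
    intro T hT
    have : φ ⁻¹' T = ({x | c {y | JoinedIn H x y} ∈ T} ∩ triodicPart H) ∪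
        f ⁻¹' T ∩ (triodicPart H)ᶜ := by
      ext x
      by_cases hx : x ∈ triodicPart H
      · simp [hφt hx, hx]
      · simp [hφa hx, hx]
    rw [this]
    refine (measurableSet_inter_triodicPart hH fun x y hx hxy => ?_).union
      ((hf hT).inter (measurableSet_triodicPart hH).compl)
    change c _ ∈ T
    rw [← hxy.setOf_eq]
    exact hx
  have hφj : ∀ x ∈ crossingPart H p q, JoinedIn H x (φ x) := by
    intro x hx
    by_cases hxt : x ∈ triodicPart H
    · rw [hφt hxt]
      exact hc _ (setOf_joinedIn_mem_triodicClasses hxt)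
    · rw [hφa hxt]
      exact hfx x ⟨hx, hx.1.1, hxt⟩
  refine ⟨Plane, inferInstance, inferInstance, F, hF, hFh, fun x => φ x,
    hφm.comp measurable_subtype_coe, ?_⟩
  rintro ⟨x, hx⟩ ⟨y, hy⟩
  constructor
  · intro (h : JoinedIn H x y)
    change F (φ x) (φ y)
    by_cases hxt : x ∈ triodicPart H
    · have hyt : y ∈ triodicPart H := by
        by_contra hyt
        exact (h.symm.mem_atriodicPart ⟨hy.1.1, hyt⟩).2 hxt
      rw [hφt hxt, hφt hyt, h.setOf_eq]
      exact hF.1.refl _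
    · have hxa : x ∈ atriodicPart H := ⟨hx.1.1, hxt⟩
      rw [hφa hxt, hφa (h.mem_atriodicPart hxa).2]
      exact hfF x ⟨hx, hxa⟩ y h
  · intro (h : F (φ x) (φ y))
    have hxy : JoinedIn H (φ x) (φ y) := by
      rcases hFj _ _ h with h | h
      · rw [← h]
        exact JoinedIn.refl (hφj x hx).mem.2
      · exact h.2.2
    exact (hφj x hx).trans (hxy.trans (hφj y hy).symm)

/-- Let `H ⊆ ℝ²` be Polish, `p < q` rationals, `H₀` the set of points of `H` whose arc
component is a continuous injective image of a real interval, and let `M = π(ℳ_{p,q})`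
be the set of points of `H₀` path-connected in `H` to the endpoint `e₁(J)` of some arc
`J ∈ 𝒥_{p,q}`. Then `M` is a `≈_H`-invariant Borel subset of `H` and the restriction of
the path-connectedness relation of `H` to `M` is essentially hyperfinite. -/
theorem statement12 (H : Set (ℝ × ℝ)) (hH : PolishSpace H)
    (p q : ℚ) (hpq : p < q)
    (H₀ : Set (ℝ × ℝ))
    (hH₀ : H₀ = {x | x ∈ H ∧ ∃ (K : Set ℝ) (φ : ℝ → ℝ × ℝ), K.OrdConnected ∧
        ContinuousOn φ K ∧ Set.InjOn φ K ∧ φ '' K = {y | JoinedIn H x y}})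
    (M : Set (ℝ × ℝ))
    (hM : M = {x | x ∈ H₀ ∧ ∃ J : Set (ℝ × ℝ), J ⊆ H ∧
        ∃ u v : ℝ × ℝ, IsArcWith J u v ∧
          J ∩ {z : ℝ × ℝ | z.1 = (p : ℝ)} = {u} ∧
          J ∩ {z : ℝ × ℝ | z.1 = (q : ℝ)} = {v} ∧ u ∈ H₀ ∧
          JoinedIn H x u}) :
    (∀ x y : ℝ × ℝ, x ∈ M → JoinedIn H x y → y ∈ M) ∧
    MeasurableSet (Subtype.val ⁻¹' M : Set H) ∧
    IsEssentiallyHyperfinite (fun x y : M => JoinedIn H x.1 y.1) := by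
  have hlt : (p : ℝ) < q := Rat.cast_lt.2 hpq
  subst hH₀ hM
  exact ⟨fun x y hx hxy => JoinedIn.mem_crossingPart hxy hx,
    measurable_subtype_coe (measurableSet_crossingPart hH hlt.ne),
    isEssentiallyHyperfinite_crossingPart hH hlt⟩
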